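/- Let K be a number field and let Ē be a nef hermitian 𝒪_K-lattice of rank r ≥ 1. Then deg(Ē) ≥ −([K:ℚ]/2)·r·log r. -/

import Mathlib

open scoped NumberField ComplexOrder Classical

noncomputable section

/-- The hermitian pairing on complex coordinate vectors determined by the (Gram) matrix `M`:
`⟨u, v⟩ = ∑ conj(uᵢ) · Mᵢⱼ · vⱼ` (antilinear in the first variable). -/
def cForm {ι : Type} [Fintype ι] (M : Matrix ι ι ℂ) (u v : ι → ℂ) : ℂ :=
  ∑ i, ∑ j, (starRingEnd ℂ) (u i) * M i j * v j

/-- The hermitian pairing, at the complex embedding `σ` of `K`, of two `K`-rational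
coordinate vectors, for the metric with Gram matrix `M` at `σ`. -/
def eForm {K : Type} [Field K] {ι : Type} [Fintype ι] (M : Matrix ι ι ℂ)
    (σ : K →+* ℂ) (u v : ι → K) : ℂ :=
  cForm M (fun i => σ (u i)) (fun i => σ (v i))

/-- The arithmetic degree of a (finitely generated) `𝒪_K`-submodule `F` of `K^ι`, for the
hermitian metrics on `K^ι` whose Gram matrix at the complex embedding `σ` is `H σ`, with the
induced metrics on `F`.  It is computed from a `K`-linearly independent family `x` of elements
of `F` spanning the same `K`-subspace as `F`:
`deg F = log #(F / (𝒪_K x₁ + ⋯ + 𝒪_K x_s)) - ∑_σ log ‖x₁ ∧ ⋯ ∧ x_s‖_σ`,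
where `‖x₁ ∧ ⋯ ∧ x_s‖_σ` is the square root of the Gram determinant of `x` at `σ`.
(For `F` of rank one this is the usual `deg F = log #(F/𝒪_K ℓ) - ∑_v ε_v log ‖ℓ‖_v`, the sum
running over all complex embeddings; the general case agrees with `deg F = deg (det F)`,
where `det F = Λ^s F` carries the Gram-determinant metrics.) -/
def hDeg (K : Type) [Field K] [NumberField K] {ι : Type} [Fintype ι]
    (H : (K →+* ℂ) → Matrix ι ι ℂ) (F : Submodule (𝓞 K) (ι → K)) : ℝ :=
  if h : ∃ p : (s : ℕ) × (Fin s → ι → K), 0 < p.1 ∧ (∀ a, p.2 a ∈ F) ∧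
      LinearIndependent K p.2 ∧ ∀ y ∈ F, y ∈ Submodule.span K (Set.range p.2) then
    Real.log (Nat.card
        (↥F ⧸ Submodule.comap F.subtype (Submodule.span (𝓞 K) (Set.range h.choose.2))))
      - ∑ᶠ σ : K →+* ℂ, Real.log (Real.sqrt
          ((Matrix.of fun a b => eForm (H σ) σ (h.choose.2 a) (h.choose.2 b)).det.re))
  else 0

/-- The rank of an `𝒪_K`-submodule `F` of `K^ι`: the dimension of the `K`-subspace
it spans. -/
def hRank (K : Type) [Field K] [NumberField K] {ι : Type} [Fintype ι]
    (F : Submodule (𝓞 K) (ι → K)) : ℕ :=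
  Module.finrank K ↥(Submodule.span K (F : Set (ι → K)))

/-- The slope of a nonzero `𝒪_K`-submodule of `K^ι` with the induced metrics:
degree divided by rank. -/
def hMu (K : Type) [Field K] [NumberField K] {ι : Type} [Fintype ι]
    (H : (K →+* ℂ) → Matrix ι ι ℂ) (F : Submodule (𝓞 K) (ι → K)) : ℝ :=
  hDeg K H F / hRank K F

/-- The maximal slope `μ_max` of the hermitian `𝒪_K`-lattice `E ⊆ K^ι`: the supremum of the
slopes of its nonzero `𝒪_K`-submodules (of any rank), with the induced metrics. -/
def hMuMax (K : Type) [Field K] [NumberField K] {ι : Type} [Fintype ι]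
    (H : (K →+* ℂ) → Matrix ι ι ℂ) (E : Submodule (𝓞 K) (ι → K)) : ℝ :=
  sSup { m : ℝ | ∃ F : Submodule (𝓞 K) (ι → K), F ≠ ⊥ ∧ F ≤ E ∧ m = hMu K H F }

/-- The compatibility of the family of Gram matrices `H` with complex conjugation:
the metric at the conjugate embedding is the conjugate metric (so that the data of `H`
amounts to a euclidean/hermitian metric at each archimedean place of `K`). -/
def ConjCompatible (K : Type) [Field K] {ι : Type} [Fintype ι]
    (H : (K →+* ℂ) → Matrix ι ι ℂ) : Prop :=
  ∀ σ : K →+* ℂ, H ((starRingEnd ℂ).comp σ) = (H σ).map (starRingEnd ℂ)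

/-- The arithmetic degree of a nonzero rank-one hermitian `𝒪_K'`-lattice, presented as a
nonzero finitely generated `𝒪_{K'}`-submodule `L` of `K'` whose metric at the complex
embedding `σ` is `‖y‖_σ² = g σ · |σ(y)|²`:
`deg L = log #(L/𝒪_{K'} ℓ) - ∑_σ log ‖ℓ‖_σ` for a nonzero `ℓ ∈ L`. -/
def degLine (K' : Type) [Field K'] [NumberField K']
    (L : Submodule (𝓞 K') K') (g : (K' →+* ℂ) → ℝ) : ℝ :=
  if h : ∃ x : K', x ∈ L ∧ x ≠ 0 then
    Real.log (Nat.card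
        (↥L ⧸ Submodule.comap L.subtype (Submodule.span (𝓞 K') {h.choose})))
      - ∑ᶠ σ : K' →+* ℂ, Real.log (Real.sqrt (g σ * Complex.normSq (σ h.choose)))
  else 0

/-- The quotient metric induced at the embedding `σ` on a rank-one quotient of the hermitian
lattice `(K'^ι, H')` via the `K'`-linear surjection `ψ : K'^ι → K'`:
`‖1‖² = inf { ⟨e, e⟩_{H' σ} | ψ_σ(e) = 1 }` (infimum over the fibre of `1` in `ℂ^ι`). -/
def quotMetric {K' : Type} [Field K'] {ι : Type} [Fintype ι] [DecidableEq ι]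
    (H' : (K' →+* ℂ) → Matrix ι ι ℂ) (ψ : (ι → K') →ₗ[K'] K') (σ : K' →+* ℂ) : ℝ :=
  sInf { t : ℝ | ∃ e : ι → ℂ, (∑ i, σ (ψ (Pi.single i 1)) * e i) = 1 ∧
    t = (cForm (H' σ) e e).re }

/-- Base change of an `𝒪_K`-lattice `E ⊆ K^ι` to the ring of integers of a finite
extension `K'` of `K`: the `𝒪_{K'}`-span of the image of `E` in `K'^ι`. -/
def baseChange (K K' : Type) [Field K] [NumberField K] [Field K'] [NumberField K']
    [Algebra K K'] {ι : Type} [Fintype ι] (E : Submodule (𝓞 K) (ι → K)) :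
    Submodule (𝓞 K') (ι → K') :=
  Submodule.span (𝓞 K') ((fun v i => algebraMap K K' (v i)) '' (E : Set (ι → K)))

/-- The metrics on the base change to `K'` of a hermitian lattice over `K` with metrics `H`:
the Gram matrix at an embedding `σ'` of `K'` is the Gram matrix of `H` at the induced
embedding of `K`. -/
def baseChangeMetric (K K' : Type) [Field K] [Field K'] [Algebra K K'] {ι : Type}
    (H : (K →+* ℂ) → Matrix ι ι ℂ) : (K' →+* ℂ) → Matrix ι ι ℂ :=
  fun σ' => H (σ'.comp (algebraMap K K'))

/-- A hermitian `𝒪_K`-lattice `E ⊆ K^ι` (with metrics `H`) is nef if for every finite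
extension `K'/K`, every rank-one quotient of `E ⊗_{𝒪_K} 𝒪_{K'}`, with the quotient metrics,
has nonnegative arithmetic degree.  A rank-one quotient is the image of `E ⊗ 𝒪_{K'}` under a
`K'`-linear form `ψ` on `K'^ι` (every rank-one quotient of the full lattice `E ⊗ 𝒪_{K'}`
arises this way, with the quotient metrics given by `quotMetric`). -/
def IsNef (K : Type) [Field K] [NumberField K] {ι : Type} [Fintype ι] [DecidableEq ι]
    (H : (K →+* ℂ) → Matrix ι ι ℂ) (E : Submodule (𝓞 K) (ι → K)) : Prop :=
  ∀ (K' : Type) [Field K'] [NumberField K'] [Algebra K K'],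
    ∀ ψ : (ι → K') →ₗ[K'] K',
      Submodule.map (ψ.restrictScalars (𝓞 K')) (baseChange K K' E) ≠ ⊥ →
      0 ≤ degLine K' (Submodule.map (ψ.restrictScalars (𝓞 K')) (baseChange K K' E))
            (quotMetric (baseChangeMetric K K' H) ψ)

end

namespace HermitianLattice

open MvPolynomial

section HomogeneousIdeals

variable {R ι : Type} [CommRing R]

theorem homogeneousComponent_mul_of_isHomogeneous {f : MvPolynomial ι R} {m : ℕ}
    (hf : f.IsHomogeneous m) (g : MvPolynomial ι R) (n : ℕ) :
    homogeneousComponent (n + m) (f * g) = f * homogeneousComponent n g := by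
  conv_lhs => rw [← sum_homogeneousComponent g, Finset.mul_sum, map_sum]
  have h : ∀ i, homogeneousComponent (n + m) (f * homogeneousComponent i g) =
      if i = n then f * homogeneousComponent i g else 0 := fun i => by
    rw [homogeneousComponent_of_mem (hf.mul (homogeneousComponent_isHomogeneous i g))]
    congr 1
    apply propext
    omega
  simp only [h, Finset.sum_ite_eq']
  split_ifs with hn
  · rfl
  · rw [homogeneousComponent_eq_zero, mul_zero]
    simpa using hn

theorem homogeneousComponent_mul_of_lt {f : MvPolynomial ι R} {m n : ℕ}
    (hf : f.IsHomogeneous m) (g : MvPolynomial ι R) (h : n < m) :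
    homogeneousComponent n (f * g) = 0 := by
  rw [← sum_homogeneousComponent g, Finset.mul_sum, map_sum]
  refine Finset.sum_eq_zero fun i _ => ?_
  rw [homogeneousComponent_of_mem (hf.mul (homogeneousComponent_isHomogeneous i g)), if_neg]
  omega

theorem homogeneousComponent_mul (f g : MvPolynomial ι R) (n : ℕ) :
    homogeneousComponent n (f * g) = ∑ i ∈ Finset.range (f.totalDegree + 1),
      if i ≤ n then homogeneousComponent i f * homogeneousComponent (n - i) g else 0 := by
  conv_lhs => rw [← sum_homogeneousComponent f, Finset.sum_mul, map_sum]
  refine Finset.sum_congr rfl fun i _ => ?_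
  split_ifs with h
  · conv_lhs => rw [← Nat.sub_add_cancel h]
    exact homogeneousComponent_mul_of_isHomogeneous (homogeneousComponent_isHomogeneous i f) g _
  · exact homogeneousComponent_mul_of_lt (homogeneousComponent_isHomogeneous i f) g (by omega)

/-- An ideal of a polynomial ring that contains the homogeneous components of its elements. -/
def IsHom (I : Ideal (MvPolynomial ι R)) : Prop :=
  ∀ p ∈ I, ∀ n, homogeneousComponent n p ∈ I

theorem isHom_bot : IsHom (⊥ : Ideal (MvPolynomial ι R)) := by
  intro p hp n
  rw [Ideal.mem_bot] at hp
  simp [hp]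

theorem isHom_span {f : MvPolynomial ι R} {m : ℕ} (hf : f.IsHomogeneous m) :
    IsHom (Ideal.span {f}) := by
  intro p hp n
  obtain ⟨g, rfl⟩ := Ideal.mem_span_singleton.mp hp
  rcases lt_or_ge n m with h | h
  · rw [homogeneousComponent_mul_of_lt hf g h]
    exact zero_mem _
  · obtain ⟨k, rfl⟩ := Nat.exists_eq_add_of_le' h
    rw [homogeneousComponent_mul_of_isHomogeneous hf]
    exact Ideal.mul_mem_right _ _ (Ideal.mem_span_singleton_self f)

theorem IsHom.sup {I J : Ideal (MvPolynomial ι R)} (hI : IsHom I) (hJ : IsHom J) :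
    IsHom (I ⊔ J) := by
  intro p hp n
  obtain ⟨a, ha, b, hb, rfl⟩ := Submodule.mem_sup.mp hp
  rw [map_add]
  exact Submodule.add_mem_sup (hI a ha n) (hJ b hb n)

/-- The ideal quotient `(I : f)`. -/
noncomputable def colonIdeal (I : Ideal (MvPolynomial ι R)) (f : MvPolynomial ι R) :
    Ideal (MvPolynomial ι R) :=
  Submodule.comap (LinearMap.mulLeft (MvPolynomial ι R) f) I

theorem mem_colonIdeal {I : Ideal (MvPolynomial ι R)} {f g : MvPolynomial ι R} :
    g ∈ colonIdeal I f ↔ f * g ∈ I := Iff.rfl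

theorem le_colonIdeal (I : Ideal (MvPolynomial ι R)) (f : MvPolynomial ι R) :
    I ≤ colonIdeal I f := fun _ hg => mem_colonIdeal.mpr (Ideal.mul_mem_left _ _ hg)

theorem IsHom.colon {I : Ideal (MvPolynomial ι R)} (hI : IsHom I) {f : MvPolynomial ι R} {m : ℕ}
    (hf : f.IsHomogeneous m) : IsHom (colonIdeal I f) := by
  intro p hp n
  rw [mem_colonIdeal] at hp ⊢
  rw [← homogeneousComponent_mul_of_isHomogeneous hf]
  exact hI _ hp _

/-- The largest homogeneous ideal contained in `M`. -/
noncomputable def homCore (M : Ideal (MvPolynomial ι R)) : Ideal (MvPolynomial ι R) where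
  carrier := {p | ∀ n, homogeneousComponent n p ∈ M}
  add_mem' ha hb n := by
    rw [map_add]
    exact add_mem (ha n) (hb n)
  zero_mem' n := by simp
  smul_mem' c p hp n := by
    rw [smul_eq_mul, homogeneousComponent_mul]
    refine sum_mem fun i _ => ?_
    split_ifs
    · exact Ideal.mul_mem_left _ _ (hp _)
    · exact zero_mem _

theorem mem_homCore_of_isHomogeneous {M : Ideal (MvPolynomial ι R)} {p : MvPolynomial ι R} {n : ℕ}
    (hp : p.IsHomogeneous n) : p ∈ homCore M ↔ p ∈ M := by
  refine ⟨fun h => ?_, fun h k => ?_⟩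
  · simpa [homogeneousComponent_eq_self hp] using h n
  · rw [homogeneousComponent_of_mem hp]
    split_ifs
    · exact h
    · exact zero_mem _

theorem isHom_homCore (M : Ideal (MvPolynomial ι R)) : IsHom (homCore M) := fun p hp n =>
  (mem_homCore_of_isHomogeneous (homogeneousComponent_isHomogeneous n p)).mpr (hp n)

theorem homCore_le (M : Ideal (MvPolynomial ι R)) : homCore M ≤ M := by
  intro p hp
  rw [← sum_homogeneousComponent p]
  exact sum_mem fun i _ => hp i

theorem IsHom.le_homCore {I M : Ideal (MvPolynomial ι R)} (hI : IsHom I) (h : I ≤ M) :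
    I ≤ homCore M := fun p hp n => h (hI p hp n)

/-- A homogeneous ideal that is strictly larger contains a homogeneous witness. -/
theorem IsHom.exists_isHomogeneous_notMem {I J : Ideal (MvPolynomial ι R)} (hJ : IsHom J)
    (h : ¬ J ≤ I) : ∃ (m : ℕ) (f : MvPolynomial ι R), f.IsHomogeneous m ∧ f ∈ J ∧ f ∉ I := by
  obtain ⟨p, hpJ, hpI⟩ := Set.not_subset.mp h
  by_contra! hc
  refine hpI ?_
  rw [← sum_homogeneousComponent p]
  exact sum_mem fun i _ => hc i _ (homogeneousComponent_isHomogeneous i p) (hJ p hpJ i)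

/-- A homogeneous element of `J ⊔ (f)` is a sum of homogeneous pieces. -/
theorem IsHom.exists_eq_add_mul {J : Ideal (MvPolynomial ι R)} (hJ : IsHom J)
    {f x : MvPolynomial ι R} {m n : ℕ} (hf : f.IsHomogeneous m) (hx : x.IsHomogeneous (n + m))
    (hxJ : x ∈ J ⊔ Ideal.span {f}) : ∃ j g : MvPolynomial ι R, j ∈ J ∧
      j.IsHomogeneous (n + m) ∧ g.IsHomogeneous n ∧ x = j + f * g := by
  obtain ⟨a, ha, b, hb, rfl⟩ := Submodule.mem_sup.mp hxJ
  obtain ⟨g, rfl⟩ := Ideal.mem_span_singleton.mp hb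
  refine ⟨homogeneousComponent (n + m) a, homogeneousComponent n g, hJ a ha _,
    homogeneousComponent_isHomogeneous _ _, homogeneousComponent_isHomogeneous _ _, ?_⟩
  rw [← homogeneousComponent_mul_of_isHomogeneous hf, ← map_add]
  exact (homogeneousComponent_eq_self hx).symm

end HomogeneousIdeals

/-- A graded family of additive subgroups of a polynomial ring over a number field, of full rank in
each degree, together with a submultiplicative seminorm on a real algebra to which the polynomial
ring maps. -/
structure SectionNorm (K ι V : Type) [Field K] [NumberField K] [CommRing V] [Algebra ℝ V] where
  lat : ℕ → AddSubgroup (MvPolynomial ι K)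
  toReal : MvPolynomial ι K →+* V
  norm : Seminorm ℝ V
  isHomogeneous : ∀ {n x}, x ∈ lat n → x.IsHomogeneous n
  one_mem : 1 ∈ lat 0
  mul_mem : ∀ {m n x y}, x ∈ lat m → y ∈ lat n → x * y ∈ lat (m + n)
  exists_nsmul_mem : ∀ {n x}, x.IsHomogeneous n → ∃ c : ℕ, c ≠ 0 ∧ c • x ∈ lat n
  norm_mul_le : ∀ x y, norm (x * y) ≤ norm x * norm y

namespace SectionNorm

variable {K ι V : Type} [Field K] [NumberField K] [CommRing V] [Algebra ℝ V]
  (D : SectionNorm K ι V) {I J Q : Ideal (MvPolynomial ι K)} {m n : ℕ}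

theorem toReal_rat_smul (q : ℚ) (x : MvPolynomial ι K) :
    D.toReal (q • x) = (q : ℝ) • D.toReal x := by
  have h : (D.toReal.comp (algebraMap ℚ (MvPolynomial ι K))) =
      (algebraMap ℝ V).comp (algebraMap ℚ ℝ) := Subsingleton.elim _ _
  have h' := congrArg (fun f : ℚ →+* V => f q) h
  simp only [RingHom.comp_apply] at h'
  rw [Algebra.smul_def, map_mul, h', Algebra.smul_def]
  rfl

theorem pow_mem {s : MvPolynomial ι K} (hs : s ∈ D.lat m) (k : ℕ) : s ^ k ∈ D.lat (k * m) := by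
  induction k with
  | zero => simpa using D.one_mem
  | succ k ih =>
    rw [pow_succ, Nat.succ_mul]
    exact D.mul_mem ih hs

/-- The real span of the degree `n` elements of `I`. -/
def realSpan (I : Ideal (MvPolynomial ι K)) (n : ℕ) : Submodule ℝ V :=
  Submodule.span ℝ (D.toReal '' {x | x ∈ I ∧ x.IsHomogeneous n})

theorem toReal_mem_realSpan {x : MvPolynomial ι K} (hx : x ∈ I) (h : x.IsHomogeneous n) :
    D.toReal x ∈ D.realSpan I n :=
  Submodule.subset_span ⟨x, ⟨hx, h⟩, rfl⟩

theorem toReal_mem_realSpan_top {x : MvPolynomial ι K} (h : x.IsHomogeneous n) :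
    D.toReal x ∈ D.realSpan ⊤ n :=
  D.toReal_mem_realSpan Submodule.mem_top h

theorem realSpan_mono (h : I ≤ J) : D.realSpan I n ≤ D.realSpan J n :=
  Submodule.span_mono (Set.image_mono fun _ hx => ⟨h hx.1, hx.2⟩)

theorem realSpan_le_top : D.realSpan I n ≤ D.realSpan ⊤ n := D.realSpan_mono le_top

theorem mul_mem_realSpan_of_forall
    (hQ : ∀ x ∈ Q, ∀ y ∈ I, x.IsHomogeneous m → y.IsHomogeneous n → x * y ∈ J) {a b : V}
    (ha : a ∈ D.realSpan Q m) (hb : b ∈ D.realSpan I n) : a * b ∈ D.realSpan J (m + n) := by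
  induction ha using Submodule.span_induction with
  | mem a ha =>
    obtain ⟨x, ⟨hx, hx'⟩, rfl⟩ := ha
    induction hb using Submodule.span_induction with
    | mem b hb =>
      obtain ⟨y, ⟨hy, hy'⟩, rfl⟩ := hb
      rw [← map_mul]
      exact D.toReal_mem_realSpan (hQ x hx y hy hx' hy') (hx'.mul hy')
    | zero => simp
    | add b c _ _ h1 h2 =>
      rw [mul_add]
      exact add_mem h1 h2
    | smul r b _ h =>
      rw [mul_smul_comm]
      exact Submodule.smul_mem _ _ h
  | zero => simp
  | add a c _ _ h1 h2 =>
    rw [add_mul]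
    exact add_mem h1 h2
  | smul r a _ h =>
    rw [smul_mul_assoc]
    exact Submodule.smul_mem _ _ h

theorem mul_mem_realSpan {a b : V} (ha : a ∈ D.realSpan I m) (hb : b ∈ D.realSpan ⊤ n) :
    a * b ∈ D.realSpan I (m + n) :=
  D.mul_mem_realSpan_of_forall (fun _ hx _ _ _ _ => Ideal.mul_mem_right _ _ hx) ha hb

theorem toReal_mul_mem_realSpan {f : MvPolynomial ι K} (hf : f.IsHomogeneous m)
    (hfQ : ∀ q ∈ Q, f * q ∈ J) {a : V} (ha : a ∈ D.realSpan Q n) :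
    D.toReal f * a ∈ D.realSpan J (n + m) := by
  rw [mul_comm]
  refine D.mul_mem_realSpan_of_forall (I := Ideal.span {f}) (fun x hx y hy _ _ => ?_) ha
    (D.toReal_mem_realSpan (Ideal.mem_span_singleton_self f) hf)
  obtain ⟨g, rfl⟩ := Ideal.mem_span_singleton.mp hy
  rw [show x * (f * g) = f * x * g by ring]
  exact Ideal.mul_mem_right _ _ (hfQ x hx)

theorem exists_eq_add_of_mem_sup (hJ : IsHom J) {f : MvPolynomial ι K} (hf : f.IsHomogeneous m)
    {a : V} (ha : a ∈ D.realSpan (J ⊔ Ideal.span {f}) (n + m)) :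
    ∃ b ∈ D.realSpan J (n + m), ∃ c ∈ D.realSpan ⊤ n, a = b + D.toReal f * c := by
  induction ha using Submodule.span_induction with
  | mem a ha =>
    obtain ⟨x, ⟨hx, hx'⟩, rfl⟩ := ha
    obtain ⟨j, g, hj, hj', hg, rfl⟩ := hJ.exists_eq_add_mul hf hx' hx
    exact ⟨_, D.toReal_mem_realSpan hj hj', _, D.toReal_mem_realSpan_top hg, by simp⟩
  | zero => exact ⟨0, zero_mem _, 0, zero_mem _, by simp⟩
  | add a a' _ _ h1 h2 =>
    obtain ⟨b, hb, c, hc, rfl⟩ := h1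
    obtain ⟨b', hb', c', hc', rfl⟩ := h2
    exact ⟨_, add_mem hb hb', _, add_mem hc hc', by ring⟩
  | smul r a _ h =>
    obtain ⟨b, hb, c, hc, rfl⟩ := h
    exact ⟨_, Submodule.smul_mem _ r hb, _, Submodule.smul_mem _ r hc, by
      rw [smul_add, mul_smul_comm]⟩

/-- `f` is a lattice element of degree `n` whose class modulo `I` has norm at most `ρ`. -/
def Small (I : Ideal (MvPolynomial ι K)) (n : ℕ) (ρ : ℝ) (f : MvPolynomial ι K) : Prop :=
  f ∈ D.lat n ∧ ∃ a ∈ D.realSpan I n, D.norm (D.toReal f - a) ≤ ρ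

/-- Modulo `I`, every real element of degree `n` is within `ρ` of the lattice. -/
def Cov (I : Ideal (MvPolynomial ι K)) (n : ℕ) (ρ : ℝ) : Prop :=
  ∀ w ∈ D.realSpan ⊤ n, ∃ l ∈ D.lat n, ∃ a ∈ D.realSpan I n, D.norm (w - D.toReal l - a) ≤ ρ

/-- The covering radii modulo `I` grow at most like `exp (δ n)`. -/
def Good (I : Ideal (MvPolynomial ι K)) (δ : ℝ) : Prop :=
  ∀ ε > 0, ∀ᶠ n : ℕ in Filter.atTop, D.Cov I n (Real.exp ((δ + ε) * n))

variable {D}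

theorem Small.mono (h : I ≤ J) {ρ ρ' : ℝ} (hρ : ρ ≤ ρ') {f : MvPolynomial ι K}
    (hf : D.Small I n ρ f) : D.Small J n ρ' f := by
  obtain ⟨h1, a, ha, h2⟩ := hf
  exact ⟨h1, a, D.realSpan_mono h ha, h2.trans hρ⟩

theorem Cov.mono (h : I ≤ J) {ρ ρ' : ℝ} (hρ : ρ ≤ ρ') (hI : D.Cov I n ρ) : D.Cov J n ρ' := by
  intro w hw
  obtain ⟨l, hl, a, ha, h2⟩ := hI w hw
  exact ⟨l, hl, a, D.realSpan_mono h ha, h2.trans hρ⟩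

theorem Good.mono (h : I ≤ J) {δ δ' : ℝ} (hδ : δ ≤ δ') (hI : D.Good I δ) : D.Good J δ' := by
  intro ε hε
  filter_upwards [hI ε hε] with n hn
  refine hn.mono h ?_
  gcongr

theorem Small.norm_nonneg {ρ : ℝ} {f : MvPolynomial ι K} (hf : D.Small I n ρ f) : 0 ≤ ρ := by
  obtain ⟨-, a, -, h⟩ := hf
  exact (apply_nonneg _ _).trans h

theorem Small.mul {ρ ρ' : ℝ} {f g : MvPolynomial ι K} (hf : D.Small I m ρ f)
    (hg : D.Small I n ρ' g) : D.Small I (m + n) (ρ * ρ') (f * g) := by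
  have hρ := hf.norm_nonneg
  obtain ⟨hfl, a, ha, hfa⟩ := hf
  obtain ⟨hgl, b, hb, hgb⟩ := hg
  have hf' := D.toReal_mem_realSpan_top (D.isHomogeneous hfl)
  have hg' := D.toReal_mem_realSpan_top (D.isHomogeneous hgl)
  refine ⟨D.mul_mem hfl hgl, a * D.toReal g + (D.toReal f - a) * b, add_mem
    (D.mul_mem_realSpan ha hg') ?_, ?_⟩
  · rw [mul_comm, add_comm m n]
    exact D.mul_mem_realSpan hb (sub_mem hf' (D.realSpan_le_top ha))
  · rw [map_mul, show D.toReal f * D.toReal g - (a * D.toReal g + (D.toReal f - a) * b) =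
      (D.toReal f - a) * (D.toReal g - b) by ring]
    exact (D.norm_mul_le _ _).trans (mul_le_mul hfa hgb (apply_nonneg _ _) hρ)

theorem Small.pow {ρ : ℝ} {f : MvPolynomial ι K} (hf : D.Small I m ρ f) {k : ℕ} (hk : 0 < k) :
    D.Small I (k * m) (ρ ^ k) (f ^ k) := by
  induction k, hk using Nat.le_induction with
  | base => simpa using hf
  | succ k hk ih =>
    rw [pow_succ, pow_succ, Nat.succ_mul]
    exact ih.mul hf

/-- Covering radii add up along the filtration `J ⊂ J + (f)`. -/
theorem Cov.of_sup (hJ : IsHom J) {f : MvPolynomial ι K} {C ρ₁ ρ₂ : ℝ} (hf : D.Small J m C f)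
    (hQ : ∀ q ∈ Q, f * q ∈ J) (h1 : D.Cov (J ⊔ Ideal.span {f}) (n + m) ρ₁)
    (h2 : D.Cov Q n ρ₂) : D.Cov J (n + m) (ρ₁ + C * ρ₂) := by
  intro w hw
  have hC := hf.norm_nonneg
  obtain ⟨hfl, a₀, ha₀, hfa⟩ := hf
  have hfh := D.isHomogeneous hfl
  obtain ⟨l, hl, a, ha, hla⟩ := h1 w hw
  obtain ⟨b, hb, c, hc, rfl⟩ := D.exists_eq_add_of_mem_sup hJ hfh ha
  obtain ⟨l', hl', a', ha', hla'⟩ := h2 c hc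
  set e := c - D.toReal l' - a' with he
  have hee : e ∈ D.realSpan ⊤ n := sub_mem (sub_mem hc
    (D.toReal_mem_realSpan_top (D.isHomogeneous hl'))) (D.realSpan_le_top ha')
  refine ⟨l + f * l', add_mem hl ?_, b + D.toReal f * a' + a₀ * e, add_mem (add_mem hb
    (D.toReal_mul_mem_realSpan hfh hQ ha')) ?_, ?_⟩
  · rw [add_comm n m]
    exact D.mul_mem hfl hl'
  · rw [add_comm n m]
    exact D.mul_mem_realSpan ha₀ hee
  · have : w - D.toReal (l + f * l') - (b + D.toReal f * a' + a₀ * e) =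
        (w - D.toReal l - (b + D.toReal f * c)) + (D.toReal f - a₀) * e := by
      rw [map_add, map_mul, he]
      ring
    rw [this]
    refine (map_add_le_add _ _ _).trans (add_le_add hla ((D.norm_mul_le _ _).trans ?_))
    exact mul_le_mul hfa hla' (apply_nonneg _ _) hC

theorem Cov.mem_closure {ρ : ℝ} (h : D.Cov I n ρ) (hρ : 0 < ρ) {x : MvPolynomial ι K}
    (hx : x ∈ D.lat n) : x ∈ AddSubgroup.closure {f | D.Small I n (3 * ρ) f} := by
  obtain ⟨M, hM⟩ := exists_nat_gt (D.norm (D.toReal x) / ρ)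
  have hM0 : (0 : ℝ) < M := lt_of_le_of_lt (by positivity) hM
  rw [div_lt_iff₀ hρ] at hM
  have hw := D.toReal_mem_realSpan_top (D.isHomogeneous hx)
  choose l hl a ha hla using fun i : ℕ =>
    h (((i : ℝ) / M) • D.toReal x) (Submodule.smul_mem _ _ hw)
  have key : ∀ i, l i ∈ AddSubgroup.closure {f | D.Small I n (3 * ρ) f} := by
    intro i
    induction i with
    | zero =>
      refine AddSubgroup.subset_closure ⟨hl 0, -a 0, neg_mem (ha 0), ?_⟩
      have := hla 0
      rw [← map_neg_eq_map] at this
      simp only [Nat.cast_zero, zero_div, zero_smul, zero_sub] at this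
      rw [show -(-D.toReal (l 0) - a 0) = D.toReal (l 0) - -a 0 by ring] at this
      linarith
    | succ i ih =>
      rw [← sub_add_cancel (l (i + 1)) (l i)]
      refine add_mem (AddSubgroup.subset_closure ⟨sub_mem (hl _) (hl _), a i - a (i + 1),
        sub_mem (ha _) (ha _), ?_⟩) ih
      have e : D.toReal (l (i + 1) - l i) - (a i - a (i + 1)) =
          (((i : ℝ) / M) • D.toReal x - D.toReal (l i) - a i) -
          ((((i + 1 : ℕ) : ℝ) / M) • D.toReal x - D.toReal (l (i + 1)) - a (i + 1)) +
          (1 / (M : ℝ)) • D.toReal x := by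
        have : (((i + 1 : ℕ) : ℝ) / M) • D.toReal x =
            ((i : ℝ) / M) • D.toReal x + (1 / (M : ℝ)) • D.toReal x := by
          rw [← add_smul]
          congr 1
          push_cast
          ring
        rw [this, map_sub D.toReal]
        ring
      rw [e]
      refine (map_add_le_add _ _ _).trans ?_
      have h1 := map_sub_le_add D.norm
        (((i : ℝ) / M) • D.toReal x - D.toReal (l i) - a i)
        ((((i + 1 : ℕ) : ℝ) / M) • D.toReal x - D.toReal (l (i + 1)) - a (i + 1))
      have h2 : D.norm ((1 / (M : ℝ)) • D.toReal x) ≤ ρ := by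
        rw [map_smul_eq_mul, Real.norm_of_nonneg (by positivity), one_div, inv_mul_le_iff₀ hM0]
        exact hM.le
      linarith [hla i, hla (i + 1)]
  rw [← sub_add_cancel x (l M)]
  refine add_mem (AddSubgroup.subset_closure ⟨sub_mem hx (hl M), a M, ha M, ?_⟩) (key M)
  have := hla M
  rw [div_self hM0.ne', one_smul] at this
  rw [map_sub D.toReal]
  linarith

end SectionNorm

section Hilbert

theorem finrank_map_of_injective {k V W : Type} [Field k] [AddCommGroup V] [Module k V]
    [AddCommGroup W] [Module k W] {f : V →ₗ[k] W} (hf : Function.Injective f)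
    (p : Submodule k V) : Module.finrank k (p.map f) = Module.finrank k p :=
  (Submodule.equivMapOfInjective f hf p).finrank_eq.symm

variable {K ι : Type} [Field K] [NumberField K]

/-- The degree `n` part of the quotient by `I`, as a rational vector space. -/
noncomputable def gradedPart (I : Ideal (MvPolynomial ι K)) (n : ℕ) :
    Submodule ℚ (MvPolynomial ι K ⧸ I) :=
  ((homogeneousSubmodule ι K n).restrictScalars ℚ).map (Ideal.Quotient.mkₐ ℚ I).toLinearMap

theorem mem_gradedPart {I : Ideal (MvPolynomial ι K)} {n : ℕ} {z : MvPolynomial ι K ⧸ I} :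
    z ∈ gradedPart I n ↔ ∃ x : MvPolynomial ι K, x.IsHomogeneous n ∧ Ideal.Quotient.mk I x = z :=
  Iff.rfl

theorem mk_mem_gradedPart (I : Ideal (MvPolynomial ι K)) {n : ℕ} {x : MvPolynomial ι K}
    (hx : x.IsHomogeneous n) : Ideal.Quotient.mk I x ∈ gradedPart I n :=
  mem_gradedPart.mpr ⟨x, hx, rfl⟩

/-- The dimension over `ℚ` of the degree `n` part of the quotient by `I`. -/
noncomputable def hilb (I : Ideal (MvPolynomial ι K)) (n : ℕ) : ℕ :=
  Module.finrank ℚ (gradedPart I n)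

theorem homogeneousSubmodule_le_span [Fintype ι] (n : ℕ) :
    homogeneousSubmodule ι K n ≤ Submodule.span K (Set.range fun d : ι → Fin (n + 1) =>
      monomial (Finsupp.equivFunOnFinite.symm fun i => (d i : ℕ)) (1 : K)) := by
  intro x hx
  rw [x.as_sum]
  refine sum_mem fun d hd => ?_
  have hdeg : d.degree = n := by
    have := hx (mem_support_iff.mp hd)
    rwa [Finsupp.degree_eq_weight_one]
  have h : monomial d (coeff d x) = coeff d x • monomial d (1 : K) := by
    rw [smul_monomial, smul_eq_mul, mul_one]
  rw [h]
  refine Submodule.smul_mem _ _ (Submodule.subset_span ⟨fun i => ⟨d i, ?_⟩, ?_⟩)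
  · have := Finsupp.le_degree i d
    omega
  · exact congrArg (fun e => monomial e (1 : K)) (Finsupp.ext fun _ => rfl)

theorem finite_homogeneousSubmodule [Fintype ι] (n : ℕ) :
    Module.Finite K (homogeneousSubmodule ι K n) := by
  have := Module.Finite.span_of_finite K (Set.finite_range fun d : ι → Fin (n + 1) =>
    monomial (Finsupp.equivFunOnFinite.symm fun i => (d i : ℕ)) (1 : K))
  exact Submodule.finiteDimensional_of_le (homogeneousSubmodule_le_span n)

theorem finrank_homogeneousSubmodule_le [Fintype ι] (n : ℕ) :
    Module.finrank K (homogeneousSubmodule ι K n) ≤ (n + 1) ^ Fintype.card ι := by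
  have := Module.Finite.span_of_finite K (Set.finite_range fun d : ι → Fin (n + 1) =>
    monomial (Finsupp.equivFunOnFinite.symm fun i => (d i : ℕ)) (1 : K))
  refine (Submodule.finrank_mono (homogeneousSubmodule_le_span n)).trans ?_
  refine (finrank_range_le_card _).trans ?_
  simp

variable (I : Ideal (MvPolynomial ι K)) (n : ℕ)

theorem finite_homogeneousSubmodule_rat [Fintype ι] :
    Module.Finite ℚ ((homogeneousSubmodule ι K n).restrictScalars ℚ) := by
  have := finite_homogeneousSubmodule (K := K) (ι := ι) n
  exact Module.Finite.trans (R := ℚ) K (homogeneousSubmodule ι K n)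

instance finite_gradedPart [Fintype ι] : Module.Finite ℚ (gradedPart I n) := by
  have := finite_homogeneousSubmodule_rat (K := K) (ι := ι) n
  unfold gradedPart
  infer_instance

theorem hilb_le [Fintype ι] : hilb I n ≤ Module.finrank ℚ K * (n + 1) ^ Fintype.card ι := by
  have := finite_homogeneousSubmodule_rat (K := K) (ι := ι) n
  refine (Submodule.finrank_map_le _ _).trans ?_
  refine le_trans (le_of_eq ?_)
    (Nat.mul_le_mul_left _ (finrank_homogeneousSubmodule_le (K := K) (ι := ι) n))
  exact (Module.finrank_mul_finrank ℚ K (homogeneousSubmodule ι K n)).symm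

/-- Multiplication by `f` on the quotient by `I`. -/
noncomputable def mulQuot (f : MvPolynomial ι K) :
    (MvPolynomial ι K ⧸ I) →ₗ[ℚ] (MvPolynomial ι K ⧸ I) :=
  LinearMap.mulLeft ℚ (Ideal.Quotient.mk I f)

variable {I n}

theorem hilb_le_hilb_sup_add [Fintype ι] {f : MvPolynomial ι K} {m : ℕ} (hI : IsHom I)
    (hf : f.IsHomogeneous m) :
    hilb I (n + m) ≤ hilb (I ⊔ Ideal.span {f}) (n + m) + hilb I n := by
  set J := I ⊔ Ideal.span {f} with hJ
  let π : (MvPolynomial ι K ⧸ I) →ₗ[ℚ] (MvPolynomial ι K ⧸ J) :=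
    (Ideal.Quotient.factorₐ ℚ (le_sup_left : I ≤ J)).toLinearMap
  have hπ : ∀ x, π (Ideal.Quotient.mk I x) = Ideal.Quotient.mk J x := fun x => rfl
  have h := LinearMap.finrank_range_add_finrank_ker (π.domRestrict (gradedPart I (n + m)))
  have h1 : LinearMap.range (π.domRestrict (gradedPart I (n + m))) ≤ gradedPart J (n + m) := by
    rintro _ ⟨⟨z, hz⟩, rfl⟩
    obtain ⟨x, hx, rfl⟩ := mem_gradedPart.mp hz
    exact mk_mem_gradedPart J hx
  have h2 : (LinearMap.ker (π.domRestrict (gradedPart I (n + m)))).map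
      (gradedPart I (n + m)).subtype ≤ (gradedPart I n).map (mulQuot I f) := by
    rintro _ ⟨⟨z, hz⟩, hz', rfl⟩
    obtain ⟨x, hx, rfl⟩ := mem_gradedPart.mp hz
    have hxJ : x ∈ J := Ideal.Quotient.eq_zero_iff_mem.mp hz'
    obtain ⟨j, g, hj, -, hg, rfl⟩ := hI.exists_eq_add_mul hf hx hxJ
    refine ⟨Ideal.Quotient.mk I g, mk_mem_gradedPart I hg, ?_⟩
    simp [mulQuot, Ideal.Quotient.eq_zero_iff_mem.mpr hj]
  have h3 := (Submodule.finrank_mono h2).trans (Submodule.finrank_map_le _ _)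
  rw [finrank_map_of_injective (Submodule.injective_subtype _)] at h3
  have h4 := Submodule.finrank_mono h1
  unfold hilb
  omega

theorem map_mulQuot_le {f : MvPolynomial ι K} {m : ℕ} (hf : f.IsHomogeneous m) :
    (gradedPart I n).map (mulQuot I f) ≤ gradedPart I (n + m) := by
  rintro _ ⟨z, hz, rfl⟩
  obtain ⟨x, hx, rfl⟩ := mem_gradedPart.mp hz
  rw [add_comm]
  exact mem_gradedPart.mpr ⟨f * x, hf.mul hx, by simp [mulQuot]⟩

theorem mulQuot_injective {f : MvPolynomial ι K} (hf : colonIdeal I f = I) :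
    Function.Injective (mulQuot I f) := by
  rw [injective_iff_map_eq_zero]
  intro z hz
  obtain ⟨x, rfl⟩ := Ideal.Quotient.mk_surjective z
  rw [Ideal.Quotient.eq_zero_iff_mem, ← hf, mem_colonIdeal, ← Ideal.Quotient.eq_zero_iff_mem]
  simpa [mulQuot] using hz

theorem hilb_mono [Fintype ι] {f : MvPolynomial ι K} {m : ℕ} (hf : f.IsHomogeneous m)
    (hfI : colonIdeal I f = I) : hilb I n ≤ hilb I (n + m) := by
  have h := Submodule.finrank_mono (map_mulQuot_le (I := I) (n := n) hf)
  rwa [finrank_map_of_injective (mulQuot_injective hfI)] at h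

theorem hilb_lt [Fintype ι] {f x : MvPolynomial ι K} {m : ℕ} (hf : f.IsHomogeneous m)
    (hfI : colonIdeal I f = I) (hx : x.IsHomogeneous (n + m)) (hxf : x ∉ I ⊔ Ideal.span {f}) :
    hilb I n < hilb I (n + m) := by
  have h := Submodule.finrank_lt_finrank_of_lt
    (lt_of_le_of_ne (map_mulQuot_le (I := I) (n := n) hf) ?_)
  · rwa [finrank_map_of_injective (mulQuot_injective hfI)] at h
  · intro e
    have hx' := mk_mem_gradedPart I hx
    rw [← e] at hx'
    obtain ⟨z, hz, hzx⟩ := hx'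
    obtain ⟨g, hg, rfl⟩ := mem_gradedPart.mp hz
    refine hxf ?_
    have : x - f * g ∈ I := by
      rw [← Ideal.Quotient.eq_zero_iff_mem, map_sub, ← hzx]
      simp [mulQuot]
    rw [← sub_add_cancel x (f * g)]
    exact Submodule.add_mem_sup this (Ideal.mul_mem_right _ _ (Ideal.mem_span_singleton_self f))

end Hilbert

namespace SectionNorm

variable {K ι V : Type} [Field K] [NumberField K] [CommRing V] [Algebra ℝ V]
  {D : SectionNorm K ι V} {I J Q : Ideal (MvPolynomial ι K)} {m n : ℕ}

theorem Cov.exists_basis [Fintype ι] {ρ : ℝ} (h : D.Cov I n ρ) (hρ : 0 < ρ) :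
    ∃ u : Fin (hilb I n) → MvPolynomial ι K, (∀ i, D.Small I n (3 * ρ) (u i)) ∧
      LinearIndependent ℚ (fun i => Ideal.Quotient.mk I (u i)) ∧
      ∀ y : MvPolynomial ι K, y.IsHomogeneous n →
        Ideal.Quotient.mk I y ∈ Submodule.span ℚ (Set.range fun i => Ideal.Quotient.mk I (u i)) := by
  set G : Set (MvPolynomial ι K ⧸ I) := Ideal.Quotient.mk I '' {f | D.Small I n (3 * ρ) f} with hG
  have hspan : Submodule.span ℚ G = gradedPart I n := by
    apply le_antisymm
    · rw [Submodule.span_le]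
      rintro _ ⟨f, hf, rfl⟩
      exact mk_mem_gradedPart I (D.isHomogeneous hf.1)
    · intro z hz
      obtain ⟨x, hx, rfl⟩ := mem_gradedPart.mp hz
      obtain ⟨c, hc, hcx⟩ := D.exists_nsmul_mem hx
      have h1 : Ideal.Quotient.mk I (c • x) ∈ Submodule.span ℚ G := by
        have hcl := h.mem_closure hρ hcx
        generalize c • x = x' at hcl ⊢
        induction hcl using AddSubgroup.closure_induction with
        | mem y hy => exact Submodule.subset_span ⟨y, hy, rfl⟩
        | zero => simp
        | add a b _ _ ha hb =>
          rw [map_add]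
          exact add_mem ha hb
        | neg a _ ha =>
          rw [map_neg]
          exact neg_mem ha
      have h2 := Submodule.smul_mem _ ((c : ℚ)⁻¹) h1
      rw [map_nsmul, ← Nat.cast_smul_eq_nsmul ℚ, smul_smul, inv_mul_cancel₀ (by exact_mod_cast hc),
        one_smul] at h2
      exact h2
  obtain ⟨b, hbG, hb, hbi⟩ := exists_linearIndependent ℚ G
  have hbm : ∀ z : b, (z : MvPolynomial ι K ⧸ I) ∈ gradedPart I n := fun z => by
    rw [← hspan]
    exact Submodule.subset_span (hbG z.2)
  have hbfin : Finite b := by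
    have : LinearIndependent ℚ (fun z : b => (⟨z, hbm z⟩ : gradedPart I n)) :=
      LinearIndependent.of_comp (gradedPart I n).subtype hbi
    exact this.finite
  have := Fintype.ofFinite b
  have hcard : Fintype.card b = hilb I n := by
    rw [hilb, ← hspan, ← hb]
    have := finrank_span_eq_card hbi
    rw [Subtype.range_coe] at this
    exact this.symm
  let e := Fintype.equivFinOfCardEq hcard
  choose u hu hu' using fun z : b => hbG z.2
  have hu'' : (fun i => Ideal.Quotient.mk I (u (e.symm i))) = (fun z : b => (z : _ ⧸ I)) ∘ e.symm :=
    funext fun i => hu' _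
  refine ⟨fun i => u (e.symm i), fun i => hu _, ?_, fun y hy => ?_⟩
  · rw [hu'']
    exact hbi.comp _ e.symm.injective
  · rw [hu'', e.symm.surjective.range_comp, Subtype.range_coe, hb, hspan]
    exact mk_mem_gradedPart I hy

variable (D)

theorem exists_sum_of_mem_realSpan {κ : Type} [Fintype κ] {u : κ → MvPolynomial ι K}
    (hu : ∀ i, (u i).IsHomogeneous n)
    (hspan : ∀ y : MvPolynomial ι K, y.IsHomogeneous n →
      Ideal.Quotient.mk I y ∈ Submodule.span ℚ (Set.range fun i => Ideal.Quotient.mk I (u i)))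
    {c : V} (hc : c ∈ D.realSpan ⊤ n) :
    ∃ r : κ → ℝ, c - ∑ i, r i • D.toReal (u i) ∈ D.realSpan I n := by
  induction hc using Submodule.span_induction with
  | mem c hc =>
    obtain ⟨y, ⟨-, hy⟩, rfl⟩ := hc
    obtain ⟨q, hq⟩ := (Submodule.mem_span_range_iff_exists_fun ℚ).mp (hspan y hy)
    refine ⟨fun i => q i, ?_⟩
    have h1 : y - ∑ i, q i • u i ∈ I := by
      rw [← Ideal.Quotient.eq_zero_iff_mem, map_sub, map_sum, ← hq, sub_eq_zero]
      exact Finset.sum_congr rfl fun i _ => (map_rat_smul (Ideal.Quotient.mk I) _ _).symm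
    have h2 : (y - ∑ i, q i • u i).IsHomogeneous n := by
      refine hy.sub (IsHomogeneous.sum _ _ _ fun i _ => ?_)
      rw [← mem_homogeneousSubmodule]
      exact Submodule.smul_of_tower_mem _ (q i) (hu i)
    have h3 := D.toReal_mem_realSpan h1 h2
    rw [map_sub, map_sum] at h3
    simpa only [D.toReal_rat_smul] using h3
  | zero => exact ⟨0, by simp⟩
  | add c c' _ _ h1 h2 =>
    obtain ⟨r, hr⟩ := h1
    obtain ⟨r', hr'⟩ := h2
    refine ⟨r + r', ?_⟩
    have := add_mem hr hr'
    simp only [Pi.add_apply, add_smul, Finset.sum_add_distrib]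
    rwa [show c + c' - (∑ i, r i • D.toReal (u i) + ∑ i, r' i • D.toReal (u i)) =
      c - ∑ i, r i • D.toReal (u i) + (c' - ∑ i, r' i • D.toReal (u i)) by ring]
  | smul s c _ h =>
    obtain ⟨r, hr⟩ := h
    refine ⟨s • r, ?_⟩
    have := Submodule.smul_mem _ s hr
    rw [smul_sub, Finset.smul_sum] at this
    simpa only [Pi.smul_apply, smul_assoc] using this

end SectionNorm

theorem eventually_mul_pow_le_exp (C : ℝ) (k : ℕ) {ε : ℝ} (hε : 0 < ε) :
    ∀ᶠ n : ℕ in Filter.atTop, C * ((n : ℝ) + 1) ^ k ≤ Real.exp (ε * n) := by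
  have h := (isLittleO_pow_exp_pos_mul_atTop k hε).comp_tendsto
    (Filter.tendsto_atTop_add_const_right Filter.atTop (1 : ℝ) tendsto_natCast_atTop_atTop)
  have hC : 0 < Real.exp (-ε) / (|C| + 1) := by positivity
  filter_upwards [h.def hC] with n hn
  simp only [Function.comp_apply, norm_pow, Real.norm_eq_abs, Real.abs_exp] at hn
  rw [abs_of_pos (by positivity : (0 : ℝ) < n + 1)] at hn
  calc C * ((n : ℝ) + 1) ^ k ≤ (|C| + 1) * ((n : ℝ) + 1) ^ k := by
        gcongr
        linarith [le_abs_self C]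
    _ ≤ (|C| + 1) * (Real.exp (-ε) / (|C| + 1) * Real.exp (ε * (n + 1))) := by gcongr
    _ = Real.exp (-ε) * Real.exp (ε * (n + 1)) := by
        field_simp
    _ = Real.exp (ε * n) := by
        rw [← Real.exp_add]
        ring_nf

/-- Simultaneous approximation: a nonzero bounded integer combination of the rows of `r` that is
close to an integer vector. -/
theorem exists_int_combination {p q L : ℕ} (hp : 0 < p) (hL : 0 < L) (hq : q ≤ 3 * p)
    (r : Fin p → Fin q → ℝ) : ∃ x : Fin p → ℤ, x ≠ 0 ∧ (∀ i, |(x i : ℝ)| ≤ (L : ℝ) ^ 3) ∧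
      ∃ t : Fin q → ℤ, ∀ l, |∑ i, x i * r i l - t l| ≤ 1 / L := by
  let S : (Fin p → Fin (L ^ 3 + 1)) → Fin q → ℝ := fun x l => ∑ i, (x i : ℕ) * r i l
  have hL' : (0 : ℝ) < L := by exact_mod_cast hL
  have hfl : ∀ y : ℝ, ⌊L * Int.fract y⌋₊ < L := fun y => by
    rw [Nat.floor_lt (by positivity [Int.fract_nonneg y])]
    nlinarith [Int.fract_lt_one y]
  let c : (Fin p → Fin (L ^ 3 + 1)) → Fin q → Fin L := fun x l => ⟨_, hfl (S x l)⟩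
  have hcard : Fintype.card (Fin q → Fin L) < Fintype.card (Fin p → Fin (L ^ 3 + 1)) := by
    simp only [Fintype.card_fun, Fintype.card_fin]
    calc L ^ q ≤ L ^ (3 * p) := Nat.pow_le_pow_right hL hq
      _ = (L ^ 3) ^ p := pow_mul _ _ _
      _ < (L ^ 3 + 1) ^ p := Nat.pow_lt_pow_left (Nat.lt_succ_self _) hp.ne'
  obtain ⟨x, y, hxy, hc⟩ := Fintype.exists_ne_map_eq_of_card_lt c hcard
  refine ⟨fun i => (x i : ℤ) - (y i : ℤ), fun h => hxy ?_, fun i => ?_,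
    fun l => ⌊S x l⌋ - ⌊S y l⌋, fun l => ?_⟩
  · funext i
    have := congrFun h i
    simp only [Pi.zero_apply] at this
    ext
    omega
  · have hx : ((x i : ℕ) : ℝ) ≤ (L : ℝ) ^ 3 := by exact_mod_cast Nat.lt_succ_iff.mp (x i).2
    have hy : ((y i : ℕ) : ℝ) ≤ (L : ℝ) ^ 3 := by exact_mod_cast Nat.lt_succ_iff.mp (y i).2
    have hx0 : (0 : ℝ) ≤ ((x i : ℕ) : ℝ) := Nat.cast_nonneg _
    have hy0 : (0 : ℝ) ≤ ((y i : ℕ) : ℝ) := Nat.cast_nonneg _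
    push_cast
    rw [abs_le]
    constructor <;> linarith
  · have h1 : ⌊L * Int.fract (S x l)⌋₊ = ⌊L * Int.fract (S y l)⌋₊ :=
      congrArg Fin.val (congrFun hc l)
    have h2 : |L * Int.fract (S x l) - L * Int.fract (S y l)| ≤ 1 := by
      have a1 := Nat.floor_le (a := L * Int.fract (S x l)) (by positivity [Int.fract_nonneg (S x l)])
      have a2 := Nat.lt_floor_add_one (L * Int.fract (S x l))
      have a3 := Nat.floor_le (a := L * Int.fract (S y l)) (by positivity [Int.fract_nonneg (S y l)])
      have a4 := Nat.lt_floor_add_one (L * Int.fract (S y l))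
      rw [h1] at a1 a2
      rw [abs_le]
      constructor <;> linarith
    have h3 : ∑ i, (((x i : ℤ) - (y i : ℤ) : ℤ) : ℝ) * r i l - ((⌊S x l⌋ - ⌊S y l⌋ : ℤ) : ℝ) =
        Int.fract (S x l) - Int.fract (S y l) := by
      have : ∑ i, (((x i : ℤ) - (y i : ℤ) : ℤ) : ℝ) * r i l = S x l - S y l := by
        simp only [S, ← Finset.sum_sub_distrib]
        refine Finset.sum_congr rfl fun i _ => ?_
        push_cast
        ring
      rw [this, Int.fract, Int.fract]
      push_cast
      ring
    rw [h3, le_div_iff₀ hL', mul_comm]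
    rwa [← mul_sub, abs_mul, abs_of_pos hL'] at h2

namespace SectionNorm

variable {K ι V : Type} [Field K] [NumberField K] [CommRing V] [Algebra ℝ V]
  {D : SectionNorm K ι V} {I J Q : Ideal (MvPolynomial ι K)} {m n : ℕ}

theorem Good.of_sup (hI : IsHom I) {f : MvPolynomial ι K} (hf : f.IsHomogeneous m)
    (hQ : ∀ q ∈ Q, f * q ∈ I) (h1 : D.Good (I ⊔ Ideal.span {f}) 0) (h2 : D.Good Q 0) :
    D.Good I 0 := by
  obtain ⟨c, hc, hcf⟩ := D.exists_nsmul_mem hf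
  have hcK : ((c : K)) ≠ 0 := by exact_mod_cast hc
  have hspan : f ∈ Ideal.span {c • f} := by
    rw [Ideal.mem_span_singleton]
    refine ⟨C ((c : K)⁻¹), ?_⟩
    rw [nsmul_eq_mul, mul_right_comm, ← C_eq_coe_nat, ← map_mul, mul_inv_cancel₀ hcK]
    simp
  have hcQ : ∀ q ∈ Q, (c • f) * q ∈ I := fun q hq => by
    rw [smul_mul_assoc]
    exact Submodule.smul_of_tower_mem _ _ (hQ q hq)
  have hsmall : D.Small I m (D.norm (D.toReal (c • f))) (c • f) :=
    ⟨hcf, 0, zero_mem _, by simp⟩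
  intro ε hε
  have hC := eventually_mul_pow_le_exp (1 + D.norm (D.toReal (c • f))) 0 (half_pos hε)
  filter_upwards [h1 (ε / 2) (half_pos hε), Filter.eventually_ge_atTop m, hC,
    (Filter.tendsto_sub_atTop_nat m).eventually (h2 (ε / 2) (half_pos hε))] with n h1 hnm hC h2
  obtain ⟨k, rfl⟩ := Nat.exists_eq_add_of_le' hnm
  rw [Nat.add_sub_cancel] at h2
  refine (Cov.of_sup hI hsmall hcQ (h1.mono (sup_le_sup_left
    ((Ideal.span_singleton_le_iff_mem _).mpr hspan) I) le_rfl) h2).mono le_rfl ?_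
  have h3 : Real.exp ((0 + ε / 2) * k) ≤ Real.exp ((0 + ε / 2) * (k + m : ℕ)) := by
    gcongr
    simp
  have h4 : 0 ≤ D.norm (D.toReal (c • f)) := apply_nonneg _ _
  calc _ ≤ Real.exp ((0 + ε / 2) * (k + m : ℕ)) +
        D.norm (D.toReal (c • f)) * Real.exp ((0 + ε / 2) * (k + m : ℕ)) := by gcongr
    _ = (1 + D.norm (D.toReal (c • f))) * Real.exp ((0 + ε / 2) * (k + m : ℕ)) := by ring
    _ ≤ Real.exp (ε / 2 * (k + m : ℕ)) * Real.exp ((0 + ε / 2) * (k + m : ℕ)) := by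
        gcongr
        simpa using hC
    _ = Real.exp ((0 + ε) * (k + m : ℕ)) := by
        rw [← Real.exp_add]
        ring_nf

/-- A small nonzerodivisor modulo `I` improves the growth rate of the covering radii. -/
theorem Good.of_small (hI : IsHom I) {s : MvPolynomial ι K} (hm : 0 < m) {δ δ' : ℝ} (hδ' : 0 < δ')
    (hs : D.Small I m (Real.exp (δ' * m)) s)
    (h1 : D.Good (I ⊔ Ideal.span {s}) 0) (h2 : D.Good I δ) : D.Good I δ' := by
  obtain ⟨n₁, hn₁⟩ := Filter.eventually_atTop.mp (h1 δ' hδ')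
  obtain ⟨n₂, hn₂⟩ := Filter.eventually_atTop.mp (h2 1 one_pos)
  set N := max n₁ n₂ with hN
  obtain ⟨R, hR⟩ : ∃ R : ℝ, ∀ j ≤ N + m, Real.exp ((δ + 1) * j) ≤ R := by
    refine ⟨∑ j ∈ Finset.range (N + m + 1), Real.exp ((δ + 1) * j), fun j hj => ?_⟩
    exact Finset.single_le_sum (f := fun j : ℕ => Real.exp ((δ + 1) * j))
      (fun i _ => (Real.exp_pos _).le) (Finset.mem_range.mpr (by omega))
  have hR0 : 0 ≤ R := (Real.exp_pos _).le.trans (hR 0 (by omega))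
  have key : ∀ n ≥ N, D.Cov I n ((R + n) * Real.exp (δ' * n)) := by
    intro n
    induction n using Nat.strong_induction_on with
    | _ n ih =>
      intro hn
      rcases lt_or_ge n (N + m) with h | h
      · refine (hn₂ n (by omega)).mono le_rfl ((hR n h.le).trans ?_)
        have : 1 ≤ Real.exp (δ' * n) := Real.one_le_exp (by positivity)
        nlinarith [Nat.cast_nonneg (α := ℝ) n]
      · obtain ⟨k, rfl⟩ := Nat.exists_eq_add_of_le' (show m ≤ n by omega)
        have hk := ih k (by omega) (by omega)
        refine (Cov.of_sup hI hs (Q := I) (fun q hq => Ideal.mul_mem_left _ _ hq)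
          (hn₁ (k + m) (by omega)) hk).mono le_rfl ?_
        have e : Real.exp (δ' * m) * ((R + k) * Real.exp (δ' * k)) =
            (R + k) * Real.exp (δ' * (k + m : ℕ)) := by
          rw [mul_left_comm, ← Real.exp_add]
          push_cast
          ring_nf
        rw [e, zero_add]
        have hm' : (1 : ℝ) ≤ m := by exact_mod_cast hm
        have := Real.exp_pos (δ' * (k + m : ℕ))
        push_cast at this ⊢
        nlinarith
  intro ε hε
  filter_upwards [Filter.eventually_ge_atTop N, eventually_mul_pow_le_exp (R + 1) 1 hε]
    with n hn h
  refine (key n hn).mono le_rfl ?_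
  calc (R + n) * Real.exp (δ' * n) ≤ ((R + 1) * ((n : ℝ) + 1) ^ 1) * Real.exp (δ' * n) := by
        gcongr
        nlinarith [Nat.cast_nonneg (α := ℝ) n]
    _ ≤ Real.exp (ε * n) * Real.exp (δ' * n) := by gcongr
    _ = Real.exp ((δ' + ε) * n) := by
        rw [← Real.exp_add]
        ring_nf

/-- Covering radii modulo the powers of a small element. -/
theorem Cov.sup_span_pow (hI : IsHom I) {s : MvPolynomial ι K} {C ε : ℝ} (hC : 1 ≤ C)
    (hε : 0 ≤ ε) (hs : D.Small I m C s) {n₁ : ℕ}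
    (h : ∀ n ≥ n₁, D.Cov (I ⊔ Ideal.span {s}) n (Real.exp (ε * n))) (j : ℕ) :
    ∀ n ≥ n₁ + j * m, D.Cov (I ⊔ Ideal.span {s ^ (j + 1)}) n
      ((j + 1) * C ^ j * Real.exp (ε * n)) := by
  induction j with
  | zero => simpa using h
  | succ j ih =>
    intro n hn
    rw [Nat.succ_mul] at hn
    obtain ⟨k, rfl⟩ := Nat.exists_eq_add_of_le' (show m ≤ n by omega)
    have hk := ih k (by omega)
    have hsh := D.isHomogeneous hs.1
    have hJ : IsHom (I ⊔ Ideal.span {s ^ (j + 1 + 1)}) := hI.sup (isHom_span (hsh.pow _))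
    have hJs : I ⊔ Ideal.span {s} ≤ (I ⊔ Ideal.span {s ^ (j + 1 + 1)}) ⊔ Ideal.span {s} :=
      sup_le_sup_right le_sup_left _
    refine (Cov.of_sup (Q := I ⊔ Ideal.span {s ^ (j + 1)}) hJ (hs.mono le_sup_left le_rfl) ?_
      ((h (k + m) (by omega)).mono hJs le_rfl) hk).mono le_rfl ?_
    · intro q hq
      obtain ⟨a, ha, b, hb, rfl⟩ := Submodule.mem_sup.mp hq
      obtain ⟨g, rfl⟩ := Ideal.mem_span_singleton.mp hb
      rw [mul_add]
      refine Submodule.add_mem_sup (Ideal.mul_mem_left _ _ ha) ?_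
      rw [← mul_assoc, ← pow_succ']
      exact Ideal.mul_mem_right _ _ (Ideal.mem_span_singleton_self _)
    · have h1 : Real.exp (ε * k) ≤ Real.exp (ε * (k + m : ℕ)) := by
        gcongr
        simp
      have h2 : 1 ≤ C ^ (j + 1) := one_le_pow₀ hC
      have h3 : C * ((j + 1) * C ^ j * Real.exp (ε * k)) ≤
          (j + 1) * C ^ (j + 1) * Real.exp (ε * (k + m : ℕ)) := by
        rw [show C * ((j + 1) * C ^ j * Real.exp (ε * k)) =
          (j + 1) * C ^ (j + 1) * Real.exp (ε * k) by ring]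
        gcongr
      have h4 := Real.exp_pos (ε * (k + m : ℕ))
      push_cast at h3 h4 ⊢
      nlinarith

theorem norm_sum_smul_le {κ : Type} [Fintype κ] (N : Seminorm ℝ V) (c : κ → ℝ) (v : κ → V) :
    N (∑ i, c i • v i) ≤ ∑ i, |c i| * N (v i) := by
  refine (Finset.le_sum_of_subadditive N (map_zero N).le (map_add_le_add N) _ _).trans_eq ?_
  simp [map_smul_eq_mul]

/-- Combining lattice elements that are small modulo `I + (f)` into one that is small modulo
`I`. -/
theorem exists_small_of_approx {p q L N : ℕ} (hp : 0 < p) (hL : 0 < L) (hq : q ≤ 3 * p) {R₁ R₂ : ℝ}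
    {u : Fin p → MvPolynomial ι K} {w : Fin q → MvPolynomial ι K}
    (hw : ∀ l, D.Small I N R₂ (w l)) (hu : ∀ i, u i ∈ D.lat N)
    (huw : ∀ i, ∃ r : Fin q → ℝ, ∃ a ∈ D.realSpan I N,
      D.norm (D.toReal (u i) - ∑ l, r l • D.toReal (w l) - a) ≤ R₁)
    (hwJ : ∀ l, w l ∈ J) (hIJ : I ≤ J)
    (hli : LinearIndependent ℚ (fun i => Ideal.Quotient.mk J (u i))) :
    ∃ y, y ∉ I ∧ D.Small I N (p * (L : ℝ) ^ 3 * R₁ + q * (R₂ / L)) y := by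
  choose r a ha hra using huw
  have hwl := fun l => (hw l).1
  choose b hb hwb using fun l => (hw l).2
  obtain ⟨x, hx0, hx, t, ht⟩ := exists_int_combination hp hL hq r
  have hR₁ : 0 ≤ R₁ := (apply_nonneg _ _).trans (hra ⟨0, hp⟩)
  refine ⟨∑ i, x i • u i - ∑ l, t l • w l, fun hy => hx0 ?_, ?_,
    ∑ i, (x i : ℝ) • a i + ∑ l, (∑ i, x i * r i l - t l) • b l, ?_, ?_⟩
  · have h1 : ∑ i, x i • u i ∈ J := by
      rw [← sub_add_cancel (∑ i, x i • u i) (∑ l, t l • w l)]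
      exact add_mem (hIJ hy) (sum_mem fun l _ => zsmul_mem (hwJ l) _)
    rw [← Ideal.Quotient.eq_zero_iff_mem, map_sum] at h1
    have h2 := Fintype.linearIndependent_iff.mp hli (fun i => (x i : ℚ)) (by
      rw [← h1]
      exact Finset.sum_congr rfl fun i _ => by rw [map_zsmul, Int.cast_smul_eq_zsmul])
    funext i
    exact_mod_cast h2 i
  · exact sub_mem (sum_mem fun i _ => zsmul_mem (hu i) _) (sum_mem fun l _ => zsmul_mem (hwl l) _)
  · exact add_mem (sum_mem fun i _ => Submodule.smul_mem _ _ (ha i))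
      (sum_mem fun l _ => Submodule.smul_mem _ _ (hb l))
  · have e : D.toReal (∑ i, x i • u i - ∑ l, t l • w l) -
        (∑ i, (x i : ℝ) • a i + ∑ l, (∑ i, x i * r i l - t l) • b l) =
        ∑ i, (x i : ℝ) • (D.toReal (u i) - ∑ l, r i l • D.toReal (w l) - a i) +
        ∑ l, (∑ i, x i * r i l - t l) • (D.toReal (w l) - b l) := by
      have e1 : ∑ i, (x i : ℝ) • ∑ l, r i l • D.toReal (w l) =
          ∑ l, (∑ i, x i * r i l) • D.toReal (w l) := by
        simp_rw [Finset.smul_sum, Finset.sum_smul, smul_smul]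
        exact Finset.sum_comm
      simp only [map_sub, map_sum, map_zsmul, ← Int.cast_smul_eq_zsmul ℝ, smul_sub, sub_smul,
        Finset.sum_sub_distrib, e1]
      abel
    rw [e]
    refine (map_add_le_add _ _ _).trans (add_le_add ?_ ?_)
    · refine (norm_sum_smul_le _ _ _).trans ((Finset.sum_le_sum fun i _ =>
        mul_le_mul (hx i) (hra i) (apply_nonneg _ _) (by positivity)).trans_eq ?_)
      simp [mul_assoc]
    · refine (norm_sum_smul_le _ _ _).trans ((Finset.sum_le_sum fun l _ =>
        mul_le_mul (ht l) (hwb l) (apply_nonneg _ _) (by positivity)).trans_eq ?_)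
      simp only [Finset.sum_const, Finset.card_univ, Fintype.card_fin, nsmul_eq_mul]
      ring

end SectionNorm

theorem frequently_four_mul_le {h : ℕ → ℕ} {m : ℕ} (hlin : ∀ n, h n < h (n + m)) :
    ∃ᶠ n in Filter.atTop, 4 * h n ≤ 3 * h (2 * n) := by
  by_contra hc
  rw [Filter.not_frequently] at hc
  obtain ⟨n₀, hn₀⟩ := Filter.eventually_atTop.mp hc
  have hm : 0 < m := Nat.pos_of_ne_zero fun h0 => by
    have := hlin 0
    simp [h0] at this
  have hge : ∀ n, n ≤ h (n * m) := fun n => by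
    induction n with
    | zero => exact Nat.zero_le _
    | succ n ih =>
      have := hlin (n * m)
      rw [Nat.succ_mul]
      omega
  set a := (n₀ + 1) * m with ha
  have ha0 : n₀ ≤ a := by nlinarith
  have hk : ∀ k : ℕ, 3 ^ k * h (2 ^ k * a) ≤ 4 ^ k * h a := fun k => by
    induction k with
    | zero => simp
    | succ k ih =>
      have h1 := hn₀ (2 ^ k * a) (ha0.trans (Nat.le_mul_of_pos_left _ (by positivity)))
      have e : 2 ^ (k + 1) * a = 2 * (2 ^ k * a) := by ring
      rw [e]
      calc 3 ^ (k + 1) * h (2 * (2 ^ k * a)) = 3 ^ k * (3 * h (2 * (2 ^ k * a))) := by ring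
        _ ≤ 3 ^ k * (4 * h (2 ^ k * a)) := Nat.mul_le_mul_left _ (by omega)
        _ = 4 * (3 ^ k * h (2 ^ k * a)) := by ring
        _ ≤ 4 * (4 ^ k * h a) := Nat.mul_le_mul_left _ ih
        _ = 4 ^ (k + 1) * h a := by ring
  have hk' : ∀ k : ℕ, ((3 : ℝ) / 2) ^ k ≤ h a := fun k => by
    have h1 : 2 ^ k ≤ h (2 ^ k * a) := by
      have := hge (2 ^ k * (n₀ + 1))
      rw [mul_assoc] at this
      exact le_trans (Nat.le_mul_of_pos_right _ (Nat.succ_pos _)) this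
    have h2 : 3 ^ k * 2 ^ k ≤ 4 ^ k * h a := (Nat.mul_le_mul_left _ h1).trans (hk k)
    have h3 : (3 : ℝ) ^ k * 2 ^ k ≤ 4 ^ k * h a := by exact_mod_cast h2
    have h4 : (4 : ℝ) ^ k = 2 ^ k * 2 ^ k := by
      rw [← mul_pow]
      norm_num
    rw [h4, mul_comm, mul_assoc] at h3
    have h5 := le_of_mul_le_mul_left h3 (by positivity)
    rwa [div_pow, div_le_iff₀ (by positivity), mul_comm]
  obtain ⟨k, hk1⟩ := pow_unbounded_of_one_lt (h a : ℝ) (by norm_num : (1 : ℝ) < 3 / 2)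
  exact absurd (hk' k) (not_le.mpr hk1)

/-- If `X i - 1` generates the unit ideal modulo `I`, then a power of `X i` lies in `I`. -/
theorem exists_X_pow_mem {R ι : Type} [CommRing R] {I : Ideal (MvPolynomial ι R)} (hI : IsHom I)
    (i : ι) (h : I ⊔ Ideal.span {X i - 1} = ⊤) : ∃ n : ℕ, (X i : MvPolynomial ι R) ^ n ∈ I := by
  obtain ⟨a, ha, b, hb, hab⟩ := Submodule.mem_sup.mp ((Ideal.eq_top_iff_one _).mp h)
  obtain ⟨g, rfl⟩ := Ideal.mem_span_singleton.mp hb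
  have ha' : a = 1 + g - X i * g := by
    linear_combination hab
  have key : ∀ n, X i ^ n + homogeneousComponent n g ∈ I := fun n => by
    induction n with
    | zero =>
      have h0 := hI a ha 0
      rw [ha', map_sub, map_add,
        homogeneousComponent_mul_of_lt (isHomogeneous_X R i) g one_pos,
        homogeneousComponent_eq_self (isHomogeneous_one ι R), sub_zero] at h0
      simpa using h0
    | succ n ih =>
      have h0 := hI a ha (n + 1)
      rw [ha', map_sub, map_add,
        homogeneousComponent_mul_of_isHomogeneous (isHomogeneous_X R i) g n,
        homogeneousComponent_of_mem (isHomogeneous_one ι R), if_neg (Nat.succ_ne_zero n),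
        zero_add] at h0
      have h1 := add_mem h0 (Ideal.mul_mem_left _ (X i) ih)
      convert h1 using 1
      ring
  refine ⟨g.totalDegree + 1, ?_⟩
  have := key (g.totalDegree + 1)
  rwa [homogeneousComponent_eq_zero _ _ (Nat.lt_succ_self _), add_zero] at this

namespace SectionNorm

variable {K ι V : Type} [Field K] [NumberField K] [Fintype ι] [CommRing V] [Algebra ℝ V]
  {D : SectionNorm K ι V} {I : Ideal (MvPolynomial ι K)} {m n : ℕ}

/-- If the quotients of the graded ring modulo `I` have linearly growing dimension, an exponential
growth of the covering radii forces the existence of a lattice element that is strictly smaller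
than predicted. -/
theorem Good.exists_small_lt (hI : IsHom I) {δ : ℝ} (hδ : 0 < δ) (hgood : D.Good I δ)
    (hmono : Monotone (hilb I)) {m₁ : ℕ} (hlin : ∀ n, hilb I n < hilb I (n + m₁))
    (hJ : ∀ J, IsHom J → I < J → D.Good J 0) :
    ∃ (m : ℕ) (s : MvPolynomial ι K) (δ' : ℝ), 0 < m ∧ s ∉ I ∧ 0 < δ' ∧ δ' < δ ∧
      D.Small I m (Real.exp (δ' * m)) s := by
  obtain ⟨ε, rfl⟩ : ∃ ε, δ = 100 * ε := ⟨δ / 100, by ring⟩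
  have hε : 0 < ε := by linarith
  have hhpos : ∀ n ≥ m₁, 0 < hilb I n := fun n hn =>
    lt_of_lt_of_le (lt_of_le_of_lt (Nat.zero_le _) (hlin 0)) (hmono (by omega))
  -- an element of large degree that is almost of the expected size
  obtain ⟨m₀, hcov₀, hm₀3, hm₀⟩ := ((hgood ε hε).and ((eventually_mul_pow_le_exp 3 0 hε).and
    (Filter.eventually_ge_atTop (m₁ + 1)))).exists
  obtain ⟨u₀, hu₀, hli₀, -⟩ := hcov₀.exists_basis (Real.exp_pos _)
  set s := u₀ ⟨0, hhpos m₀ (by omega)⟩ with hs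
  have hsI : s ∉ I := fun h => hli₀.ne_zero ⟨0, hhpos m₀ (by omega)⟩
    (Ideal.Quotient.eq_zero_iff_mem.mpr h)
  set C₀ := Real.exp (102 * ε * m₀) with hC₀
  have hC₀1 : 1 ≤ C₀ := Real.one_le_exp (by positivity)
  have hsS : D.Small I m₀ C₀ s := by
    refine (hu₀ _).mono le_rfl ?_
    rw [pow_zero, mul_one] at hm₀3
    calc 3 * Real.exp ((100 * ε + ε) * m₀) ≤
        Real.exp (ε * m₀) * Real.exp ((100 * ε + ε) * m₀) := by gcongr
      _ = C₀ := by
        rw [hC₀, ← Real.exp_add]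
        ring_nf
  have hsh := D.isHomogeneous hsS.1
  have hlt : I < I ⊔ Ideal.span {s} := left_lt_sup.mpr fun h =>
    hsI (h (Ideal.mem_span_singleton_self s))
  obtain ⟨n₁, hn₁⟩ := Filter.eventually_atTop.mp (hJ _ (hI.sup (isHom_span hsh)) hlt ε hε)
  simp only [zero_add] at hn₁
  obtain ⟨n₃, hn₃⟩ := Filter.eventually_atTop.mp (hgood ε hε)
  obtain ⟨n, hfreq, hn, hnE, hnP⟩ := ((frequently_four_mul_le hlin).and_eventually
    ((Filter.eventually_ge_atTop (n₁ + n₃ + m₀ + m₁)).and ((eventually_mul_pow_le_exp 1 1 hε).and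
    (eventually_mul_pow_le_exp (27 * (Module.finrank ℚ K * 2 ^ Fintype.card ι)) (Fintype.card ι)
      (by positivity : 0 < 2 * ε))))).exists
  set E := Real.exp (ε * n) with hE
  have hE1 : 1 ≤ E := Real.one_le_exp (by positivity)
  have hEpow : ∀ k : ℕ, Real.exp (k * (ε * n)) = E ^ k := fun k => Real.exp_nat_mul _ _
  -- the number of factors
  set j := (n - 1) / m₀ with hj
  have hj1 : j * m₀ ≤ n - 1 := Nat.div_mul_le_self _ _
  have hj2 : n - 1 < (j + 1) * m₀ := by
    rw [mul_comm]
    exact Nat.lt_mul_div_succ _ (by omega)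
  have hj3 : j ≤ n := (Nat.div_le_self _ _).trans (Nat.sub_le _ _)
  have hj4 : (j + 1) * m₀ = j * m₀ + m₀ := Nat.succ_mul _ _
  obtain ⟨n', hn'⟩ : ∃ n', 2 * n = n' + (j + 1) * m₀ := ⟨2 * n - (j + 1) * m₀, by omega⟩
  set f := s ^ (j + 1) with hf
  have hfl : f ∈ D.lat ((j + 1) * m₀) := D.pow_mem hsS.1 _
  have hfh := D.isHomogeneous hfl
  set J := I ⊔ Ideal.span {f} with hJdef
  have hcovJ : D.Cov J (n' + (j + 1) * m₀) (E ^ 105) := by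
    rw [← hn']
    refine (Cov.sup_span_pow hI hC₀1 hε.le hsS hn₁ j (2 * n) (by omega)).mono le_rfl ?_
    have h1 : (j : ℝ) + 1 ≤ E := by
      rw [one_mul, pow_one] at hnE
      have : (j : ℝ) ≤ n := by exact_mod_cast hj3
      linarith
    have h2 : C₀ ^ j ≤ E ^ 102 := by
      rw [← hEpow, hC₀, ← Real.exp_nat_mul]
      have : ((j * m₀ : ℕ) : ℝ) ≤ n := by exact_mod_cast (show j * m₀ ≤ n by omega)
      push_cast at this ⊢
      apply Real.exp_le_exp.mpr
      calc (j : ℝ) * (102 * ε * m₀) = 102 * ε * (j * m₀) := by ring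
        _ ≤ 102 * ε * n := by gcongr
        _ = 102 * (ε * n) := by ring
    have h3 : Real.exp (ε * (2 * n : ℕ)) = E ^ 2 := by
      rw [← hEpow]
      push_cast
      ring_nf
    calc (j + 1) * C₀ ^ j * Real.exp (ε * (2 * n : ℕ)) ≤ E * E ^ 102 * E ^ 2 := by
          rw [h3]
          gcongr
      _ = E ^ 105 := by ring
  have hcovI := hn₃ n' (by omega)
  set p := hilb J (n' + (j + 1) * m₀) with hp
  set q := hilb I n' with hq
  obtain ⟨u, hu, hli, -⟩ := hcovJ.exists_basis (by positivity)
  obtain ⟨v, hv, -, hvspan⟩ := hcovI.exists_basis (Real.exp_pos _)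
  have hpq : hilb I (2 * n) ≤ p + q := by
    rw [hn']
    exact hilb_le_hilb_sup_add hI hfh
  have hqn : q ≤ hilb I n := hmono (by omega)
  have hpos2 := hhpos (2 * n) (by omega)
  set L := ⌈E ^ 8⌉₊ with hL
  have hL0 : 0 < L := Nat.ceil_pos.mpr (by positivity)
  have hw : ∀ l, D.Small I (n' + (j + 1) * m₀) (3 * E ^ 204) (f * v l) := fun l => by
    rw [add_comm]
    refine ((hsS.pow (Nat.succ_pos j)).mul (hv l)).mono le_rfl ?_
    have h1 : C₀ ^ (j + 1) * Real.exp ((100 * ε + ε) * n') ≤ E ^ 204 := by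
      rw [← hEpow, hC₀, ← Real.exp_nat_mul, ← Real.exp_add]
      have : (2 * n : ℝ) = n' + (j + 1) * m₀ := by exact_mod_cast hn'
      have h0 : (0 : ℝ) ≤ ε * n' := by positivity
      push_cast
      apply Real.exp_le_exp.mpr
      nlinarith
    calc C₀ ^ (j + 1) * (3 * Real.exp ((100 * ε + ε) * n')) =
          3 * (C₀ ^ (j + 1) * Real.exp ((100 * ε + ε) * n')) := by ring
      _ ≤ 3 * E ^ 204 := by gcongr
  have huw : ∀ i, ∃ r : Fin q → ℝ, ∃ a ∈ D.realSpan I (n' + (j + 1) * m₀),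
      D.norm (D.toReal (u i) - ∑ l, r l • D.toReal (f * v l) - a) ≤ 3 * E ^ 105 := fun i => by
    obtain ⟨-, a, ha, hua⟩ := hu i
    obtain ⟨b, hb, c, hc, rfl⟩ := D.exists_eq_add_of_mem_sup hI hfh ha
    obtain ⟨r, hr⟩ := D.exists_sum_of_mem_realSpan (fun l => D.isHomogeneous (hv l).1) hvspan hc
    refine ⟨r, b + D.toReal f * (c - ∑ l, r l • D.toReal (v l)), add_mem hb
      (D.toReal_mul_mem_realSpan hfh (fun x hx => Ideal.mul_mem_left _ _ hx) hr), ?_⟩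
    convert hua using 2
    simp only [map_mul, mul_sub, Finset.mul_sum, mul_smul_comm]
    ring
  obtain ⟨y, hyI, hy⟩ := exists_small_of_approx (J := J) (by omega) hL0 (by omega) hw
    (fun i => (hu i).1) huw (fun l => Ideal.mul_mem_right _ _
      (Submodule.mem_sup_right (Ideal.mem_span_singleton_self f))) le_sup_left hli
  refine ⟨n' + (j + 1) * m₀, y, 99 * ε, by omega, hyI, by positivity, by linarith,
    hy.mono le_rfl ?_⟩
  have hR : Real.exp (99 * ε * (n' + (j + 1) * m₀ : ℕ)) = E ^ 198 := by
    rw [← hn', ← hEpow]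
    push_cast
    ring_nf
  rw [hR]
  set P : ℝ := (Module.finrank ℚ K * 2 ^ Fintype.card ι) * ((n : ℝ) + 1) ^ Fintype.card ι with hP
  have hbound : ∀ (I' : Ideal (MvPolynomial ι K)) (k : ℕ), k ≤ 2 * n → (hilb I' k : ℝ) ≤ P := by
    intro I' k hk
    have h1 : (hilb I' k : ℝ) ≤ Module.finrank ℚ K * ((k : ℝ) + 1) ^ Fintype.card ι := by
      exact_mod_cast hilb_le I' k
    refine h1.trans ?_
    rw [hP, mul_assoc, ← mul_pow]
    have : (k : ℝ) ≤ 2 * n := by exact_mod_cast hk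
    gcongr
    linarith
  have hpP : (p : ℝ) ≤ P := hbound _ _ hn'.ge
  have hqP : (q : ℝ) ≤ P := hbound _ _ (by omega)
  have hP2 : 27 * P ≤ E ^ 2 := by
    rw [← hEpow, hP]
    push_cast
    calc _ = 27 * (Module.finrank ℚ K * 2 ^ Fintype.card ι : ℝ) *
          ((n : ℝ) + 1) ^ Fintype.card ι := by ring
      _ ≤ _ := hnP
      _ = _ := by ring_nf
  have hLub : (L : ℝ) ≤ 2 * E ^ 8 := by
    have h1 := (Nat.ceil_lt_add_one (by positivity : 0 ≤ E ^ 8)).le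
    have h2 : 1 ≤ E ^ 8 := one_le_pow₀ hE1
    linarith
  have hLlb : E ^ 8 ≤ L := Nat.le_ceil _
  have hP0 : 0 ≤ P := by positivity
  have h1 : (p : ℝ) * (L : ℝ) ^ 3 * (3 * E ^ 105) ≤ 24 * P * E ^ 196 := by
    calc (p : ℝ) * (L : ℝ) ^ 3 * (3 * E ^ 105) ≤ P * (2 * E ^ 8) ^ 3 * (3 * E ^ 105) := by gcongr
      _ = 24 * P * E ^ 129 := by ring
      _ ≤ 24 * P * E ^ 196 := by
        exact mul_le_mul_of_nonneg_left (pow_le_pow_right₀ hE1 (by norm_num)) (by positivity)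
  have h2 : (q : ℝ) * (3 * E ^ 204 / L) ≤ 3 * P * E ^ 196 := by
    have hLpos : (0 : ℝ) < L := by exact_mod_cast hL0
    calc (q : ℝ) * (3 * E ^ 204 / L) ≤ P * (3 * E ^ 204 / E ^ 8) := by gcongr
      _ = 3 * P * E ^ 196 := by
        have : E ^ 8 ≠ 0 := by positivity
        field_simp
  calc _ ≤ 24 * P * E ^ 196 + 3 * P * E ^ 196 := add_le_add h1 h2
    _ = 27 * P * E ^ 196 := by ring
    _ ≤ E ^ 2 * E ^ 196 := by gcongr
    _ = E ^ 198 := by ring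

theorem good_of_X_mem (hI : ∀ i, X i ∈ I) : D.Good I 0 := by
  intro ε hε
  filter_upwards [Filter.eventually_ge_atTop 1] with n hn w hw
  have hle : D.realSpan ⊤ n ≤ D.realSpan I n := by
    refine Submodule.span_mono (Set.image_mono ?_)
    rintro x ⟨-, hx⟩
    refine ⟨?_, hx⟩
    rw [x.as_sum]
    refine sum_mem fun d hd => ?_
    have hd0 : d ≠ 0 := by
      rintro rfl
      have := hx (mem_support_iff.mp hd)
      simp at this
      omega
    obtain ⟨i, hi⟩ := Finsupp.ne_iff.mp hd0
    obtain ⟨g, hg⟩ := (X_dvd_monomial (i := i) (j := d) (r := coeff d x)).mpr (Or.inr hi)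
    rw [hg]
    exact Ideal.mul_mem_right _ _ (hI i)
  exact ⟨0, zero_mem _, w, hle hw, by simpa using (Real.exp_pos _).le⟩

/-- Subexponential covering radii modulo closed points propagate to all homogeneous ideals. -/
theorem good_zero_of_points (hbase : ∃ δ, D.Good ⊥ δ)
    (hpoint : ∀ (M : Ideal (MvPolynomial ι K)) (i : ι), M.IsMaximal → X i - 1 ∈ M →
      D.Good (homCore M) 0) (I : Ideal (MvPolynomial ι K)) (hI : IsHom I) : D.Good I 0 := by
  induction I using WellFoundedGT.induction with
  | _ I ih =>
  have ih' : ∀ J, IsHom J → I < J → D.Good J 0 := fun J hJ h => ih J h hJ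
  by_cases hX : ∀ i, X i ∈ I
  · exact good_of_X_mem hX
  obtain ⟨i, hXi⟩ := not_forall.mp hX
  have hsup : ∀ {f}, f ∉ I → I < I ⊔ Ideal.span {f} := fun {f} hf =>
    left_lt_sup.mpr fun h => hf (h (Ideal.mem_span_singleton_self f))
  by_cases hcol : ∃ (m : ℕ) (f : MvPolynomial ι K), f.IsHomogeneous m ∧ f ∉ I ∧ colonIdeal I f ≠ I
  · obtain ⟨m, f, hf, hfI, hcol⟩ := hcol
    exact Good.of_sup hI hf (Q := colonIdeal I f) (fun q hq => hq)
      (ih' _ (hI.sup (isHom_span hf)) (hsup hfI))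
      (ih' _ (hI.colon hf) (lt_of_le_of_ne (le_colonIdeal I f) hcol.symm))
  push Not at hcol
  have hpow : ∀ d : ℕ, (X i : MvPolynomial ι K) ^ d ∉ I := fun d => by
    induction d with
    | zero =>
      intro h
      exact hXi ((Ideal.eq_top_iff_one I).mpr (by simpa using h) ▸ Submodule.mem_top)
    | succ d ih =>
      intro h
      rw [pow_succ', ← mem_colonIdeal, hcol 1 _ (isHomogeneous_X K i) hXi] at h
      exact ih h
  have htop : I ⊔ Ideal.span {X i - 1} ≠ ⊤ := fun h => by
    obtain ⟨d, hd⟩ := exists_X_pow_mem hI i h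
    exact hpow d hd
  obtain ⟨M, hM, hIM⟩ := Ideal.exists_le_maximal _ htop
  have hXM : X i - 1 ∈ M := hIM (Submodule.mem_sup_right (Ideal.mem_span_singleton_self _))
  have hIJ : I ≤ homCore M := hI.le_homCore (le_sup_left.trans hIM)
  rcases hIJ.eq_or_lt with h | h
  · rw [h]
    exact hpoint M i hM hXM
  obtain ⟨m₁, f₀, hf₀, hf₀J, hf₀I⟩ := (isHom_homCore M).exists_isHomogeneous_notMem h.not_ge
  have hlin : ∀ n, hilb I n < hilb I (n + m₁) := fun n => by
    refine hilb_lt hf₀ (hcol _ _ hf₀ hf₀I) (isHomogeneous_X_pow i (n + m₁)) fun hx => ?_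
    have h1 : (X i : MvPolynomial ι K) ^ (n + m₁) ∈ M := homCore_le M
      ((sup_le hIJ ((Ideal.span_singleton_le_iff_mem _).mpr hf₀J)) hx)
    have h2 := hM.isPrime.mem_of_pow_mem _ h1
    refine hM.ne_top ((Ideal.eq_top_iff_one M).mpr ?_)
    have := sub_mem h2 hXM
    simpa using this
  have hmono : Monotone (hilb I) := monotone_nat_of_le_succ fun n =>
    hilb_mono (isHomogeneous_X K i) (hcol 1 _ (isHomogeneous_X K i) hXi)
  set A : Set ℝ := {δ | 0 ≤ δ ∧ D.Good I δ} with hA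
  have hAne : A.Nonempty := by
    obtain ⟨δ, hδ⟩ := hbase
    exact ⟨max δ 0, le_max_right _ _, hδ.mono bot_le (le_max_left _ _)⟩
  have hAbdd : BddBelow A := ⟨0, fun δ hδ => hδ.1⟩
  have hinf : D.Good I (sInf A) := by
    intro ε hε
    obtain ⟨δ, hδA, hδ⟩ := exists_lt_of_csInf_lt hAne (lt_add_of_pos_right (sInf A) (half_pos hε))
    filter_upwards [hδA.2 (ε / 2) (half_pos hε)] with n hn
    exact hn.mono le_rfl (Real.exp_le_exp.mpr
      (mul_le_mul_of_nonneg_right (by linarith) n.cast_nonneg))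
  rcases le_or_gt (sInf A) 0 with h0 | h0
  · exact hinf.mono le_rfl h0
  obtain ⟨m, s, δ', hm, hsI, hδ', hlt, hs⟩ := hinf.exists_small_lt hI h0 hmono hlin ih'
  have := Good.of_small hI hm hδ' hs (ih' _ (hI.sup (isHom_span (D.isHomogeneous hs.1)))
    (hsup hsI)) hinf
  exact absurd (csInf_le hAbdd ⟨hδ'.le, this⟩) (not_le.mpr hlt)

end SectionNorm

section l1

variable {ι : Type}

/-- The `ℓ¹`-norm of the coefficients of a complex polynomial. -/
noncomputable def l1 : Seminorm ℝ (MvPolynomial ι ℂ) :=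
  Seminorm.of (fun F => ∑ d ∈ F.support, ‖coeff d F‖)
    (fun F G => by
      have h := fun P : MvPolynomial ι ℂ => fun hP : P.support ⊆ F.support ∪ G.support =>
        Finset.sum_subset (f := fun d => ‖coeff d P‖) hP fun d _ hd => by
          rw [notMem_support_iff.mp hd, norm_zero]
      change ∑ d ∈ (F + G).support, ‖coeff d (F + G)‖ ≤
        ∑ d ∈ F.support, ‖coeff d F‖ + ∑ d ∈ G.support, ‖coeff d G‖
      rw [h _ support_add, h F Finset.subset_union_left, h G Finset.subset_union_right,
        ← Finset.sum_add_distrib]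
      exact Finset.sum_le_sum fun d _ => by
        rw [coeff_add]
        exact norm_add_le _ _)
    (fun c F => by
      change ∑ d ∈ (c • F).support, ‖coeff d (c • F)‖ = ‖c‖ * ∑ d ∈ F.support, ‖coeff d F‖
      rw [Finset.sum_subset (f := fun d => ‖coeff d (c • F)‖) (support_smul (f := F) (a := c))
        fun d _ hd => by rw [notMem_support_iff.mp hd, norm_zero], Finset.mul_sum]
      exact Finset.sum_congr rfl fun d _ => by rw [coeff_smul, norm_smul])

theorem l1_apply (F : MvPolynomial ι ℂ) : l1 F = ∑ d ∈ F.support, ‖coeff d F‖ := rfl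

theorem l1_monomial (d : ι →₀ ℕ) (a : ℂ) : l1 (monomial d a) = ‖a‖ := by
  rw [l1_apply]
  by_cases ha : a = 0
  · simp [ha]
  · rw [support_monomial, if_neg ha, Finset.sum_singleton, coeff_monomial, if_pos rfl]

theorem sum_norm_coeff_le (F : MvPolynomial ι ℂ) (s : Finset (ι →₀ ℕ)) :
    ∑ d ∈ s, ‖coeff d F‖ ≤ l1 F := by
  rw [l1_apply, ← Finset.sum_filter_add_sum_filter_not s (· ∈ F.support)]
  rw [Finset.sum_eq_zero (s := s.filter (· ∉ F.support)), add_zero]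
  · exact Finset.sum_le_sum_of_subset_of_nonneg (fun d hd => (Finset.mem_filter.mp hd).2)
      fun _ _ _ => norm_nonneg _
  · intro d hd
    rw [notMem_support_iff.mp (Finset.mem_filter.mp hd).2, norm_zero]

theorem l1_sum_le {α : Type*} (s : Finset α) (f : α → MvPolynomial ι ℂ) :
    l1 (∑ a ∈ s, f a) ≤ ∑ a ∈ s, l1 (f a) :=
  Finset.le_sum_of_subadditive _ (map_zero l1).le (map_add_le_add _) _ _

theorem l1_mul_le (F G : MvPolynomial ι ℂ) : l1 (F * G) ≤ l1 F * l1 G := by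
  conv_lhs => rw [F.as_sum, G.as_sum, Finset.sum_mul_sum]
  refine (l1_sum_le _ _).trans ?_
  rw [l1_apply F, l1_apply G, Finset.sum_mul_sum]
  refine Finset.sum_le_sum fun d _ => (l1_sum_le _ _).trans (Finset.sum_le_sum fun e _ => ?_)
  rw [monomial_mul, l1_monomial, norm_mul]

end l1

section linForm

variable (R : Type*) [CommSemiring R] {ι : Type} [Fintype ι]

/-- The linear form with given coefficients. -/
noncomputable def linForm : (ι → R) →ₗ[R] MvPolynomial ι R := Fintype.linearCombination R X

variable {R}

theorem linForm_apply (v : ι → R) : linForm R v = ∑ i, C (v i) * X i := by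
  simp [linForm, Fintype.linearCombination_apply, smul_eq_C_mul]

theorem linForm_isHomogeneous (v : ι → R) : (linForm R v).IsHomogeneous 1 := by
  rw [linForm_apply]
  exact IsHomogeneous.sum _ _ _ fun i _ => by
    simpa using (isHomogeneous_C ι (v i)).mul (isHomogeneous_X R i)

theorem map_linForm {R' : Type*} [CommSemiring R'] (f : R →+* R') (v : ι → R) :
    map f (linForm R v) = linForm R' (fun i => f (v i)) := by
  simp [linForm_apply]

theorem linForm_single (i : ι) : linForm R (Pi.single i 1) = X i := by
  simp [linForm_apply, Pi.single_apply]

theorem aeval_linForm {A : Type*} [CommSemiring A] [Algebra R A] (p : ι → A) (v : ι → R) :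
    aeval p (linForm R v) = ∑ i, v i • p i := by
  simp [linForm_apply, Algebra.smul_def]

/-- Substitution of the linear forms given by the rows of `T`. -/
noncomputable def subst {R : Type*} [CommSemiring R] (T : Matrix ι ι R) :
    MvPolynomial ι R →ₐ[R] MvPolynomial ι R :=
  aeval fun j => linForm R (T j)

theorem subst_linForm (T : Matrix ι ι R) (v : ι → R) :
    subst T (linForm R v) = linForm R (Matrix.vecMul v T) := by
  rw [subst, aeval_linForm]
  simp only [← map_smul, ← map_sum]
  congr 1
  ext k
  simp [Matrix.vecMul, dotProduct]

theorem subst_isHomogeneous (T : Matrix ι ι R) {F : MvPolynomial ι R} {n : ℕ}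
    (h : F.IsHomogeneous n) : (subst T F).IsHomogeneous n := by
  have := h.aeval (fun j => linForm R (T j)) fun j => linForm_isHomogeneous (T j)
  simpa [subst] using this

theorem l1_linForm_le (v : ι → ℂ) : l1 (linForm ℂ v) ≤ ∑ i, ‖v i‖ := by
  rw [linForm_apply]
  refine (l1_sum_le _ _).trans (Finset.sum_le_sum fun i _ => ?_)
  rw [X, C_mul_monomial, l1_monomial, mul_one]

end linForm

open scoped MatrixOrder Matrix.Norms.L2Operator in
theorem exists_eq_conjTranspose_mul_self {ι : Type} [Fintype ι] {M : Matrix ι ι ℂ}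
    (hM : M.PosSemidef) : ∃ B : Matrix ι ι ℂ, M = B.conjTranspose * B :=
  CStarAlgebra.nonneg_iff_eq_star_mul_self.mp hM.nonneg

/-- The `ℓ¹`-norm in suitably scaled orthonormal coordinates is bounded by the hermitian norm. -/
theorem exists_matrix_of_posDef {ι : Type} [Fintype ι] [DecidableEq ι] [Nonempty ι]
    {M : Matrix ι ι ℂ} (hM : M.PosDef) : ∃ T : Matrix ι ι ℂ,
      (∀ e, l1 (subst T (linForm ℂ e)) ≤ Real.sqrt (cForm M e e).re) ∧
      ‖T.det‖ ^ 2 * (Fintype.card ι : ℝ) ^ Fintype.card ι = M.det.re := by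
  obtain ⟨B, rfl⟩ := exists_eq_conjTranspose_mul_self hM.posSemidef
  set r : ℝ := (Fintype.card ι : ℝ) with hr
  have hr0 : 0 < r := by
    rw [hr]
    exact_mod_cast Fintype.card_pos
  have hsq : Real.sqrt r * Real.sqrt r = r := Real.mul_self_sqrt hr0.le
  have hs0 : 0 < Real.sqrt r := Real.sqrt_pos.mpr hr0
  refine ⟨((Real.sqrt r)⁻¹ : ℂ) • B.transpose, fun e => ?_, ?_⟩
  · rw [subst_linForm]
    refine (l1_linForm_le _).trans ?_
    have hc : (cForm (B.conjTranspose * B) e e).re = ∑ k, ‖B.mulVec e k‖ ^ 2 := by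
      have : cForm (B.conjTranspose * B) e e = ((∑ k, ‖B.mulVec e k‖ ^ 2 : ℝ) : ℂ) := by
        have h1 : cForm (B.conjTranspose * B) e e =
            dotProduct (star e) ((B.conjTranspose * B).mulVec e) := by
          simp [cForm, dotProduct, Matrix.mulVec, Finset.mul_sum, mul_assoc]
        rw [h1, ← Matrix.mulVec_mulVec, Matrix.dotProduct_mulVec, ← Matrix.star_mulVec]
        push_cast
        simp [dotProduct, ← Complex.conj_mul']
      rw [this, Complex.ofReal_re]
    rw [hc]
    refine Real.le_sqrt_of_sq_le ?_
    have h2 : ∀ k, ‖Matrix.vecMul e (((Real.sqrt r)⁻¹ : ℂ) • B.transpose) k‖ =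
        (Real.sqrt r)⁻¹ * ‖B.mulVec e k‖ := fun k => by
      rw [Matrix.vecMul_smul, Matrix.vecMul_transpose, Pi.smul_apply, norm_smul, norm_inv,
        Complex.norm_real, Real.norm_of_nonneg hs0.le]
    simp only [h2]
    rw [← Finset.mul_sum, mul_pow, inv_pow, sq (Real.sqrt r), hsq, inv_mul_le_iff₀ hr0]
    simpa [hr] using sq_sum_le_card_mul_sum_sq (s := Finset.univ) (f := fun k => ‖B.mulVec e k‖)
  · rw [Matrix.det_smul, Matrix.det_transpose, Matrix.det_mul, Matrix.det_conjTranspose,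
      norm_mul, norm_pow, norm_inv, Complex.norm_real, Real.norm_of_nonneg hs0.le]
    have : star B.det * B.det = ((‖B.det‖ ^ 2 : ℝ) : ℂ) := by
      push_cast
      exact Complex.conj_mul' _
    rw [this, Complex.ofReal_re, mul_pow, ← pow_mul, mul_comm _ 2, pow_mul, inv_pow, sq √r, hsq,
      inv_pow]
    have : r ^ Fintype.card ι ≠ 0 := by positivity
    field_simp

section pow

variable {R A : Type*} [CommSemiring R] [CommSemiring A] [Algebra R A] {M : Submodule R A} {m n : ℕ}

theorem one_mem_pow_zero : (1 : A) ∈ M ^ 0 := by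
  rw [pow_zero]
  exact Submodule.one_le.mp le_rfl

theorem mem_pow_one {x : A} (hx : x ∈ M) : x ∈ M ^ 1 := by rwa [pow_one]

theorem mul_mem_pow_add {x y : A} (hx : x ∈ M ^ m) (hy : y ∈ M ^ n) : x * y ∈ M ^ (m + n) := by
  rw [pow_add]
  exact Submodule.mul_mem_mul hx hy

theorem pow_le_of_forall_mul_mem {P : ℕ → Submodule R A} (h1 : 1 ∈ P 0)
    (hmul : ∀ n, ∀ x ∈ P n, ∀ y ∈ M, x * y ∈ P (n + 1)) (n : ℕ) : M ^ n ≤ P n := by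
  induction n with
  | zero => rwa [pow_zero, Submodule.one_le]
  | succ n ih =>
    rw [pow_succ, Submodule.mul_le]
    exact fun x hx y hy => hmul n x (ih hx) y hy

theorem pow_le_span_range {α : Type*} {s : α → A} (hs : M ≤ Submodule.span R (Set.range s)) (n : ℕ) :
    M ^ n ≤ Submodule.span R (Set.range fun w : Fin n → α => ∏ i, s (w i)) := by
  refine pow_le_of_forall_mul_mem
    (P := fun n => Submodule.span R (Set.range fun w : Fin n → α => ∏ i, s (w i)))
    (Submodule.subset_span ⟨Fin.elim0, by simp⟩) (fun n x hx y hy => ?_) n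
  have h := Submodule.mul_mem_mul hx (hs hy)
  rw [Submodule.span_mul_span] at h
  refine Submodule.span_mono ?_ h
  rintro - ⟨-, ⟨w, rfl⟩, -, ⟨a, rfl⟩, rfl⟩
  exact ⟨Fin.snoc w a, by simp [Fin.prod_univ_castSucc]⟩

end pow

section symLattice

variable {K ι : Type} [Field K] [Fintype ι]

/-- The degree `n` part of the symmetric algebra of the lattice `E`, as a lattice of homogeneous
polynomials. -/
noncomputable def symLattice (E : Submodule (𝓞 K) (ι → K)) (n : ℕ) :
    Submodule (𝓞 K) (MvPolynomial ι K) :=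
  (E.map ((linForm K).restrictScalars (𝓞 K))) ^ n

variable {E : Submodule (𝓞 K) (ι → K)} {n : ℕ}

theorem linForm_mem_symLattice {v : ι → K} (hv : v ∈ E) : linForm K v ∈ symLattice E 1 :=
  mem_pow_one (M := E.map ((linForm K).restrictScalars (𝓞 K))) ⟨v, hv, rfl⟩

theorem one_mem_symLattice : 1 ∈ symLattice E 0 := one_mem_pow_zero

theorem mul_mem_symLattice {m : ℕ} {x y : MvPolynomial ι K} (hx : x ∈ symLattice E m)
    (hy : y ∈ symLattice E n) : x * y ∈ symLattice E (m + n) :=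
  mul_mem_pow_add hx hy

theorem symLattice_le {P : ℕ → Submodule (𝓞 K) (MvPolynomial ι K)} (h1 : 1 ∈ P 0)
    (hmul : ∀ n, ∀ x ∈ P n, ∀ v ∈ E, x * linForm K v ∈ P (n + 1)) (n : ℕ) :
    symLattice E n ≤ P n :=
  pow_le_of_forall_mul_mem (M := E.map ((linForm K).restrictScalars (𝓞 K))) h1
    (fun n x hx y hy => by
      obtain ⟨v, hv, rfl⟩ := hy
      exact hmul n x hx v hv) n

theorem isHomogeneous_of_mem_symLattice {x : MvPolynomial ι K} (hx : x ∈ symLattice E n) :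
    x.IsHomogeneous n :=
  symLattice_le (P := fun n => (homogeneousSubmodule ι K n).restrictScalars (𝓞 K))
    (isHomogeneous_one ι K) (fun _ _ hx v _ => IsHomogeneous.mul hx (linForm_isHomogeneous v)) n hx

theorem exists_nsmul_smul_mem [NumberField K] {M : Type*} [AddCommGroup M] [Module K M] [Module (𝓞 K) M]
    [IsScalarTower (𝓞 K) K M] (N : Submodule (𝓞 K) M) {x : M}
    (hx : ∃ c : ℕ, c ≠ 0 ∧ c • x ∈ N) (a : K) : ∃ c : ℕ, c ≠ 0 ∧ c • a • x ∈ N := by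
  obtain ⟨c, hc, hcx⟩ := hx
  obtain ⟨y, hy0, hy⟩ := IsAlgebraic.exists_integral_multiple
    ((IsFractionRing.isAlgebraic_iff ℤ ℚ K).mpr (Algebra.IsAlgebraic.isAlgebraic (R := ℚ) a))
  have hy' : IsIntegral ℤ ((y.natAbs : ℤ) • a) := by
    rcases Int.natAbs_eq y with h | h
    · rwa [← h]
    · rw [h, neg_smul] at hy
      simpa using hy.neg
  refine ⟨c * y.natAbs, mul_ne_zero hc (Int.natAbs_ne_zero.mpr hy0), ?_⟩
  obtain ⟨z, hz⟩ : ∃ z : 𝓞 K, algebraMap (𝓞 K) K z = (y.natAbs : ℤ) • a := ⟨⟨_, hy'⟩, rfl⟩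
  have : (c * y.natAbs) • a • x = z • (c • x) := by
    rw [mul_comm, mul_smul]
    conv_lhs => rw [smul_comm c a x, ← smul_assoc, ← natCast_zsmul a]
    rw [← IsScalarTower.algebraMap_smul K z (c • x), hz]
  rw [this]
  exact Submodule.smul_mem _ _ hcx

theorem exists_nsmul_add_mem {M : Type*} [AddCommGroup M] [Module (𝓞 K) M]
    (N : Submodule (𝓞 K) M) {x y : M} (hx : ∃ c : ℕ, c ≠ 0 ∧ c • x ∈ N)
    (hy : ∃ c : ℕ, c ≠ 0 ∧ c • y ∈ N) : ∃ c : ℕ, c ≠ 0 ∧ c • (x + y) ∈ N := by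
  obtain ⟨c, hc, hcx⟩ := hx
  obtain ⟨d, hd, hdy⟩ := hy
  refine ⟨c * d, mul_ne_zero hc hd, ?_⟩
  rw [smul_add, mul_comm c d, mul_smul, mul_comm d c, mul_smul]
  exact add_mem (Submodule.smul_of_tower_mem _ _ hcx) (Submodule.smul_of_tower_mem _ _ hdy)

theorem exists_nsmul_mem_of_mem_span [NumberField K] {M : Type*} [AddCommGroup M] [Module K M] [Module (𝓞 K) M]
    [IsScalarTower (𝓞 K) K M] (N : Submodule (𝓞 K) M) {x : M}
    (hx : x ∈ Submodule.span K (N : Set M)) : ∃ c : ℕ, c ≠ 0 ∧ c • x ∈ N := by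
  induction hx using Submodule.span_induction with
  | mem x hx => exact ⟨1, one_ne_zero, by rwa [one_smul]⟩
  | zero => exact ⟨1, one_ne_zero, by simp⟩
  | add x y _ _ h1 h2 => exact exists_nsmul_add_mem N h1 h2
  | smul a x _ h => exact exists_nsmul_smul_mem N h a

theorem exists_nsmul_mul_mem {m : ℕ} {x y : MvPolynomial ι K}
    (hx : ∃ c : ℕ, c ≠ 0 ∧ c • x ∈ symLattice E m)
    (hy : ∃ c : ℕ, c ≠ 0 ∧ c • y ∈ symLattice E n) :
    ∃ c : ℕ, c ≠ 0 ∧ c • (x * y) ∈ symLattice E (m + n) := by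
  obtain ⟨c, hc, hcx⟩ := hx
  obtain ⟨d, hd, hdy⟩ := hy
  refine ⟨c * d, mul_ne_zero hc hd, ?_⟩
  rw [← smul_mul_smul_comm]
  exact mul_mem_symLattice hcx hdy

theorem exists_nsmul_mem_symLattice [NumberField K]
    (hfull : Submodule.span K (E : Set (ι → K)) = ⊤)
    {x : MvPolynomial ι K} (hx : x.IsHomogeneous n) :
    ∃ c : ℕ, c ≠ 0 ∧ c • x ∈ symLattice E n := by
  have hX : ∀ i, ∃ c : ℕ, c ≠ 0 ∧ c • (X i : MvPolynomial ι K) ∈ symLattice E 1 := fun i => by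
    obtain ⟨c, hc, h⟩ := exists_nsmul_mem_of_mem_span (K := K) E (x := Pi.single i 1)
      (hfull ▸ Submodule.mem_top)
    refine ⟨c, hc, ?_⟩
    rw [← linForm_single, ← map_nsmul]
    exact linForm_mem_symLattice h
  have hXd : ∀ i d, ∃ c : ℕ, c ≠ 0 ∧ c • (X i : MvPolynomial ι K) ^ d ∈ symLattice E d :=
    fun i d => by
    induction d with
    | zero => exact ⟨1, one_ne_zero, by simpa using one_mem_symLattice⟩
    | succ d ih =>
      rw [pow_succ]
      exact exists_nsmul_mul_mem ih (hX i)
  have hmon : ∀ d : ι →₀ ℕ, ∃ c : ℕ, c ≠ 0 ∧ c • (monomial d (1 : K)) ∈ symLattice E d.degree := by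
    intro d
    rw [monomial_eq, C_1, one_mul, Finsupp.prod, Finsupp.degree_apply]
    induction d.support using Finset.induction_on with
    | empty => exact ⟨1, one_ne_zero, by simpa using one_mem_symLattice⟩
    | insert i s hi ih =>
      rw [Finset.prod_insert hi, Finset.sum_insert hi]
      exact exists_nsmul_mul_mem (hXd i _) ih
  have hmem : x ∈ Submodule.span K (symLattice E n : Set (MvPolynomial ι K)) := by
    rw [x.as_sum]
    refine sum_mem fun d hd => ?_
    obtain ⟨c, hc, h⟩ := hmon d
    have hdn : d.degree = n := by
      have := hx (mem_support_iff.mp hd)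
      rwa [Finsupp.degree_eq_weight_one]
    rw [hdn] at h
    have := Submodule.smul_mem _ (coeff d x * (c : K)⁻¹) (Submodule.subset_span (R := K) h)
    convert this using 1
    have hc' : (c : K) ≠ 0 := by exact_mod_cast hc
    rw [← Nat.cast_smul_eq_nsmul K, smul_smul, mul_assoc, inv_mul_cancel₀ hc', mul_one,
      smul_monomial, smul_eq_mul, mul_one]
  exact exists_nsmul_mem_of_mem_span _ hmem

end symLattice

section sectionNorm

variable {K ι : Type} [Field K] [Fintype ι]

/-- Evaluation at the complex embedding `σ`, or at its conjugate followed by conjugation, in the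
coordinates given by `T σ`. -/
noncomputable def realization (T : (K →+* ℂ) → Matrix ι ι ℂ) (k : (K →+* ℂ) × Bool) :
    ((K →+* ℂ) → MvPolynomial ι ℂ) →ₐ[ℝ] MvPolynomial ι ℂ :=
  ((subst (T k.1)).restrictScalars ℝ).comp
    (if k.2 then (mapAlgHom (Complex.conjAe : ℂ →ₐ[ℝ] ℂ)).comp
      (Pi.evalAlgHom ℝ (fun _ : K →+* ℂ => MvPolynomial ι ℂ) ((starRingEnd ℂ).comp k.1))
    else Pi.evalAlgHom ℝ (fun _ : K →+* ℂ => MvPolynomial ι ℂ) k.1)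

theorem realization_false (T : (K →+* ℂ) → Matrix ι ι ℂ) (σ : K →+* ℂ)
    (h : (K →+* ℂ) → MvPolynomial ι ℂ) : realization T (σ, false) h = subst (T σ) (h σ) := rfl

theorem realization_true (T : (K →+* ℂ) → Matrix ι ι ℂ) (σ : K →+* ℂ)
    (h : (K →+* ℂ) → MvPolynomial ι ℂ) : realization T (σ, true) h =
      subst (T σ) (map (starRingEnd ℂ) (h ((starRingEnd ℂ).comp σ))) := rfl

variable [NumberField K]

/-- The supremum over all complex embeddings of the coefficient norms. -/
noncomputable def supNorm (T : (K →+* ℂ) → Matrix ι ι ℂ) :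
    Seminorm ℝ ((K →+* ℂ) → MvPolynomial ι ℂ) :=
  Finset.univ.sup fun k => l1.comp (realization T k).toLinearMap

theorem supNorm_le_iff {T : (K →+* ℂ) → Matrix ι ι ℂ} {h : (K →+* ℂ) → MvPolynomial ι ℂ} {a : ℝ}
    (ha : 0 ≤ a) : supNorm T h ≤ a ↔ ∀ k, l1 (realization T k h) ≤ a := by
  simp only [supNorm, Seminorm.finset_sup_apply]
  lift a to NNReal using ha
  rw [NNReal.coe_le_coe, Finset.sup_le_iff]
  exact ⟨fun H k => H k (Finset.mem_univ k), fun H k _ => H k⟩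

theorem l1_realization_le (T : (K →+* ℂ) → Matrix ι ι ℂ) (h : (K →+* ℂ) → MvPolynomial ι ℂ)
    (k : (K →+* ℂ) × Bool) : l1 (realization T k h) ≤ supNorm T h :=
  (supNorm_le_iff (apply_nonneg _ _)).mp le_rfl k

theorem supNorm_mul_le (T : (K →+* ℂ) → Matrix ι ι ℂ) (x y : (K →+* ℂ) → MvPolynomial ι ℂ) :
    supNorm T (x * y) ≤ supNorm T x * supNorm T y := by
  rw [supNorm_le_iff (mul_nonneg (apply_nonneg _ _) (apply_nonneg _ _))]
  intro k
  rw [map_mul]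
  exact (l1_mul_le _ _).trans (mul_le_mul (l1_realization_le _ _ _) (l1_realization_le _ _ _)
    (apply_nonneg _ _) (apply_nonneg _ _))

/-- The symmetric algebra of a hermitian lattice. -/
noncomputable def sections (E : Submodule (𝓞 K) (ι → K))
    (hfull : Submodule.span K (E : Set (ι → K)) = ⊤) (T : (K →+* ℂ) → Matrix ι ι ℂ) :
    SectionNorm K ι ((K →+* ℂ) → MvPolynomial ι ℂ) where
  lat n := (symLattice E n).toAddSubgroup
  toReal := RingHom.pi fun σ => map σ
  norm := supNorm T
  isHomogeneous hx := isHomogeneous_of_mem_symLattice hx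
  one_mem := one_mem_symLattice (E := E)
  mul_mem hx hy := mul_mem_symLattice hx hy
  exists_nsmul_mem hx := exists_nsmul_mem_symLattice hfull hx
  norm_mul_le := supNorm_mul_le T

variable {E : Submodule (𝓞 K) (ι → K)} {hfull : Submodule.span K (E : Set (ι → K)) = ⊤}
  {T : (K →+* ℂ) → Matrix ι ι ℂ}

theorem sections_toReal_apply (x : MvPolynomial ι K) (σ : K →+* ℂ) :
    (sections E hfull T).toReal x σ = map σ x := rfl

theorem sections_norm : (sections E hfull T).norm = supNorm T := rfl

end sectionNorm

namespace SectionNorm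

variable {K ι V : Type} [Field K] [NumberField K] [CommRing V] [Algebra ℝ V]
  {D : SectionNorm K ι V}

theorem realSpan_le_span_lat (I : Ideal (MvPolynomial ι K)) (n : ℕ) :
    D.realSpan I n ≤ Submodule.span ℝ (D.toReal '' D.lat n) := by
  refine Submodule.span_le.mpr ?_
  rintro - ⟨x, ⟨-, hx⟩, rfl⟩
  obtain ⟨c, hc, h⟩ := D.exists_nsmul_mem hx
  have := Submodule.smul_mem _ (c : ℝ)⁻¹ (Submodule.subset_span (R := ℝ)
    (Set.mem_image_of_mem D.toReal h))
  have hc' : (c : ℝ) ≠ 0 := by exact_mod_cast hc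
  rwa [map_nsmul, ← Nat.cast_smul_eq_nsmul ℝ, smul_smul, inv_mul_cancel₀ hc', one_smul] at this

/-- Rounding coefficients bounds the covering radius. -/
theorem cov_of_family {I : Ideal (MvPolynomial ι K)} {n : ℕ} {α : Type*} [Fintype α]
    (g : α → MvPolynomial ι K) (hg : ∀ i, g i ∈ D.lat n)
    (hspan : ∀ w ∈ D.realSpan ⊤ n, ∃ r : α → ℝ, w - ∑ i, r i • D.toReal (g i) ∈ D.realSpan I n)
    {ρ : α → ℝ} (hρ : ∀ i, D.Small I n (ρ i) (g i)) : D.Cov I n (∑ i, ρ i) := by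
  intro w hw
  obtain ⟨r, hr⟩ := hspan w hw
  choose _ a ha hga using hρ
  refine ⟨∑ i, ⌊r i⌋ • g i, sum_mem fun i _ => zsmul_mem (hg i) _,
    (w - ∑ i, r i • D.toReal (g i)) + ∑ i, Int.fract (r i) • a i,
    add_mem hr (sum_mem fun i _ => Submodule.smul_mem _ _ (ha i)), ?_⟩
  have : w - D.toReal (∑ i, ⌊r i⌋ • g i) -
      ((w - ∑ i, r i • D.toReal (g i)) + ∑ i, Int.fract (r i) • a i) =
      ∑ i, Int.fract (r i) • (D.toReal (g i) - a i) := by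
    have h : ∀ i, r i • D.toReal (g i) =
        ⌊r i⌋ • D.toReal (g i) + Int.fract (r i) • D.toReal (g i) := fun i => by
      rw [← Int.cast_smul_eq_zsmul ℝ, ← add_smul, Int.floor_add_fract]
    simp only [h, smul_sub, Finset.sum_sub_distrib, Finset.sum_add_distrib, map_sum, map_zsmul]
    abel
  rw [this]
  refine (Finset.le_sum_of_subadditive _ (map_zero D.norm).le (map_add_le_add _) _ _).trans
    (Finset.sum_le_sum fun i _ => ?_)
  rw [map_smul_eq_mul, Real.norm_of_nonneg (Int.fract_nonneg _)]
  exact (mul_le_of_le_one_left (apply_nonneg _ _) (Int.fract_lt_one _).le).trans (hga i)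

end SectionNorm

theorem map_span_le_of_forall {R M N : Type*} [CommSemiring R] [AddCommMonoid M] [AddCommMonoid N]
    [Module R M] [Module R N] (f : M →ₗ[R] N) {s : Set M} {P : Submodule R N}
    (h : ∀ v ∈ s, f v ∈ P) : (Submodule.span R s).map f ≤ P := by
  rw [Submodule.map_span, Submodule.span_le]
  rintro - ⟨v, hv, rfl⟩
  exact h v hv

theorem map_mul_mem_span_range {R A V α κ : Type*} [CommRing R] [CommRing A] [Algebra R A]
    [CommRing V] [Algebra ℝ V] [Fintype κ] (b : Module.Basis κ ℤ R) (F : A →+* V) {g : α → A}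
    {x : A} (hx : x ∈ Submodule.span R (Set.range g)) (a : R) : F (algebraMap R A a * x) ∈
      Submodule.span ℝ (Set.range fun p : κ × α => F (algebraMap R A (b p.1) * g p.2)) := by
  induction hx using Submodule.span_induction generalizing a with
  | mem x hx =>
    obtain ⟨w, rfl⟩ := hx
    rw [← b.sum_repr a, map_sum, Finset.sum_mul, map_sum]
    refine sum_mem fun j _ => ?_
    rw [map_zsmul, smul_mul_assoc, map_zsmul, ← Int.cast_smul_eq_zsmul ℝ]
    exact Submodule.smul_mem _ _ (Submodule.subset_span ⟨(j, w), rfl⟩)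
  | zero =>
    rw [mul_zero, map_zero]
    exact zero_mem _
  | add x y _ _ h1 h2 =>
    rw [mul_add, map_add]
    exact add_mem (h1 a) (h2 a)
  | smul a' x _ h =>
    rw [Algebra.smul_def, ← mul_assoc, ← map_mul]
    exact h _

theorem map_mem_span_range {R A V α κ : Type*} [CommRing R] [CommRing A] [Algebra R A]
    [CommRing V] [Algebra ℝ V] [Fintype κ] (b : Module.Basis κ ℤ R) (F : A →+* V) {g : α → A}
    {x : A} (hx : x ∈ Submodule.span R (Set.range g)) : F x ∈
      Submodule.span ℝ (Set.range fun p : κ × α => F (algebraMap R A (b p.1) * g p.2)) := by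
  simpa using map_mul_mem_span_range b F hx 1

theorem algebraMap_mul_mem {R A : Type*} [CommSemiring R] [Semiring A] [Algebra R A]
    (N : Submodule R A) {x : A} (hx : x ∈ N) (a : R) : algebraMap R A a * x ∈ N := by
  rw [← Algebra.smul_def]
  exact N.smul_mem a hx

section

variable {K ι : Type} [Field K] [NumberField K]

theorem SectionNorm.toReal_mem_span_range {V : Type} [CommRing V] [Algebra ℝ V]
    (D : SectionNorm K ι V) {α : Type*} {g : α → MvPolynomial ι K} {x : MvPolynomial ι K}
    (hx : x ∈ Submodule.span (𝓞 K) (Set.range g)) : D.toReal x ∈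
      Submodule.span ℝ (Set.range fun p : _ × α =>
        D.toReal (algebraMap (𝓞 K) (MvPolynomial ι K) (NumberField.RingOfIntegers.basis K p.1) *
          g p.2)) :=
  map_mem_span_range (NumberField.RingOfIntegers.basis K) D.toReal hx

/-- If the lattices are generated in degree one, their covering radii grow at most exponentially. -/
theorem SectionNorm.exists_good_bot {V : Type} [CommRing V] [Algebra ℝ V]
    (D : SectionNorm K ι V) {α : Type*} [Fintype α] {s : α → MvPolynomial ι K}
    (hmul : ∀ {n x}, x ∈ D.lat n → ∀ a, algebraMap (𝓞 K) (MvPolynomial ι K) a * x ∈ D.lat n)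
    (hprod : ∀ n (w : Fin n → α), ∏ i, s (w i) ∈ D.lat n)
    (hspan : ∀ n, ∀ x ∈ D.lat n, x ∈ Submodule.span (𝓞 K)
      (Set.range fun w : Fin n → α => ∏ i, s (w i))) : ∃ δ, D.Good ⊥ δ := by
  set A : ℝ := ∑ v, D.norm (D.toReal (s v)) with hA
  have hA0 : 0 ≤ A := Finset.sum_nonneg fun _ _ => apply_nonneg _ _
  set B : ℝ := ∑ j, D.norm (D.toReal (algebraMap (𝓞 K) (MvPolynomial ι K)
    (NumberField.RingOfIntegers.basis K j))) with hB
  have hB0 : 0 ≤ B := Finset.sum_nonneg fun _ _ => apply_nonneg _ _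
  have hnorm : ∀ (n : ℕ) (w : Fin n → α), D.norm (D.toReal (∏ i, s (w i))) ≤
      D.norm 1 * ∏ i, D.norm (D.toReal (s (w i))) := by
    intro n
    induction n with
    | zero =>
      intro w
      simp
    | succ n ih =>
      intro w
      rw [Fin.prod_univ_castSucc, Fin.prod_univ_castSucc, map_mul, ← mul_assoc]
      exact (D.norm_mul_le _ _).trans (mul_le_mul_of_nonneg_right (ih _) (apply_nonneg _ _))
  have hcov : ∀ n, D.Cov ⊥ n (B * D.norm 1 * A ^ n) := by
    intro n
    have h1 : B * D.norm 1 * A ^ n = ∑ p : _ × (Fin n → α),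
        D.norm (D.toReal (algebraMap (𝓞 K) (MvPolynomial ι K)
          (NumberField.RingOfIntegers.basis K p.1))) *
          (D.norm 1 * ∏ i, D.norm (D.toReal (s (p.2 i)))) := by
      rw [Fintype.sum_prod_type]
      dsimp only
      rw [← Finset.sum_mul_sum, ← Finset.mul_sum, hA, Finset.sum_pow', mul_assoc,
        Fintype.piFinset_univ]
    rw [h1]
    refine SectionNorm.cov_of_family (fun p : _ × (Fin n → α) =>
      algebraMap (𝓞 K) (MvPolynomial ι K) (NumberField.RingOfIntegers.basis K p.1) *
        ∏ i, s (p.2 i)) (fun p => hmul (hprod n p.2) _)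
      (fun w hw => ?_) fun p => ⟨hmul (hprod n p.2) _, 0, zero_mem _, ?_⟩
    · have hle := (D.realSpan_le_span_lat ⊤ n).trans (Submodule.span_le.mpr
          (Set.image_subset_iff.mpr fun x hx => D.toReal_mem_span_range (hspan n x hx)))
      obtain ⟨r, hr⟩ := (Submodule.mem_span_range_iff_exists_fun ℝ).mp (hle hw)
      exact ⟨r, by rw [hr, sub_self]; exact zero_mem _⟩
    · rw [sub_zero, map_mul]
      exact (D.norm_mul_le _ _).trans (mul_le_mul_of_nonneg_left (hnorm n _) (apply_nonneg _ _))
  refine ⟨Real.log (max A 1), fun ε hε => ?_⟩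
  filter_upwards [eventually_mul_pow_le_exp (B * D.norm 1) 0 hε] with n hn
  refine (hcov n).mono le_rfl ?_
  rw [pow_zero, mul_one] at hn
  rw [add_mul, Real.exp_add, mul_comm (Real.log _), Real.exp_nat_mul,
    Real.exp_log (lt_max_of_lt_right one_pos), mul_comm (_ ^ n)]
  exact mul_le_mul hn (pow_le_pow_left₀ hA0 (le_max_left _ _) _) (pow_nonneg hA0 _)
    (Real.exp_pos _).le

end

/-- Covering radii of the symmetric powers grow at most exponentially. -/
theorem exists_good_bot {K ι : Type} [Field K] [NumberField K] [Fintype ι]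
    {E : Submodule (𝓞 K) (ι → K)} (hfg : E.FG)
    (hfull : Submodule.span K (E : Set (ι → K)) = ⊤) (T : (K →+* ℂ) → Matrix ι ι ℂ) :
    ∃ δ, (sections E hfull T).Good ⊥ δ := by
  obtain ⟨S, hS⟩ := hfg
  have hvE : ∀ v : S, v.1 ∈ E := fun v => hS ▸ Submodule.subset_span v.2
  refine SectionNorm.exists_good_bot _ (s := fun v : S => linForm K v.1)
    (fun {n x} hx a => algebraMap_mul_mem (symLattice E n) hx a) ?_ fun n => ?_
  · intro n
    induction n with
    | zero =>
      intro w
      simpa using (sections E hfull T).one_mem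
    | succ n ih =>
      intro w
      rw [Fin.prod_univ_castSucc]
      exact mul_mem_symLattice (ih _) (linForm_mem_symLattice (hvE _))
  · refine pow_le_span_range (M := E.map ((linForm K).restrictScalars (𝓞 K)))
      (s := fun v : S => linForm K v.1) ?_ n
    rw [← hS]
    refine map_span_le_of_forall ((linForm K).restrictScalars (𝓞 K)) fun v hv => ?_
    exact Submodule.subset_span ⟨⟨v, hv⟩, rfl⟩

section

variable {K : Type} [Field K] [NumberField K]

theorem exists_real_coords {z : (K →+* ℂ) → ℂ}
    (hz : ∀ σ, z ((starRingEnd ℂ).comp σ) = (starRingEnd ℂ) (z σ)) :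
    ∃ r : Module.Free.ChooseBasisIndex ℤ (𝓞 K) → ℝ,
      ∀ σ, z σ = ∑ j, (r j : ℂ) * σ (NumberField.integralBasis K j) := by
  set B := NumberField.canonicalEmbedding.latticeBasis K
  have hB : ∀ j σ, B j σ = σ (NumberField.integralBasis K j) := fun j σ => by
    rw [NumberField.canonicalEmbedding.latticeBasis_apply]
    rfl
  have hsum : ∀ σ, z σ = ∑ j, B.repr z j * σ (NumberField.integralBasis K j) := fun σ => by
    conv_lhs => rw [← B.sum_repr z]
    simp [hB]
  have hreal : ∀ j, (starRingEnd ℂ) (B.repr z j) = B.repr z j := by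
    have : z = ∑ j, (starRingEnd ℂ) (B.repr z j) • B j := by
      funext σ
      have h1 := congrArg (starRingEnd ℂ) (hsum ((starRingEnd ℂ).comp σ))
      rw [hz, Complex.conj_conj, map_sum] at h1
      rw [h1]
      simp [hB]
    intro j
    conv_rhs => rw [this]
    rw [B.repr_sum_self]
  refine ⟨fun j => (B.repr z j).re, fun σ => ?_⟩
  rw [hsum]
  refine Finset.sum_congr rfl fun j _ => ?_
  rw [Complex.conj_eq_iff_re.mp (hreal j)]

variable {ι : Type} [Fintype ι] {E : Submodule (𝓞 K) (ι → K)}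
  {hfull : Submodule.span K (E : Set (ι → K)) = ⊤} {T : (K →+* ℂ) → Matrix ι ι ℂ}
  {h : (K →+* ℂ) → MvPolynomial ι ℂ} {n : ℕ}

theorem mem_realSpan_top_of_conj (hh : ∀ σ, (h σ).IsHomogeneous n)
    (hc : ∀ σ, h ((starRingEnd ℂ).comp σ) = map (starRingEnd ℂ) (h σ)) :
    h ∈ (sections E hfull T).realSpan ⊤ n := by
  have hz : ∀ d : ι →₀ ℕ, ∃ r : Module.Free.ChooseBasisIndex ℤ (𝓞 K) → ℝ,
      ∀ σ, coeff d (h σ) = ∑ j, (r j : ℂ) * σ (NumberField.integralBasis K j) := fun d =>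
    exists_real_coords fun σ => by rw [hc, coeff_map]
  choose r hr using hz
  set s : Finset (ι →₀ ℕ) := Finset.univ.biUnion fun σ => (h σ).support
  have key : h = ∑ d ∈ s, ∑ j, r d j •
      (sections E hfull T).toReal (monomial d (NumberField.integralBasis K j)) := by
    funext σ
    ext e
    simp only [Finset.sum_apply, Pi.smul_apply, sections_toReal_apply, map_monomial, coeff_sum,
      coeff_smul, coeff_monomial]
    by_cases he : e ∈ s
    · rw [Finset.sum_eq_single_of_mem e he]
      · simp [hr e σ]
      · intro d _ hd
        simp [hd]
    · rw [Finset.sum_eq_zero]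
      · by_contra hne
        exact he (Finset.mem_biUnion.mpr ⟨σ, Finset.mem_univ _, mem_support_iff.mpr hne⟩)
      · intro d hd
        simp [show d ≠ e from fun hde => he (hde ▸ hd)]
  rw [key]
  refine sum_mem fun d hd => sum_mem fun j _ => Submodule.smul_mem _ _
    (SectionNorm.toReal_mem_realSpan_top _ (isHomogeneous_monomial _ ?_))
  obtain ⟨σ, -, hσ⟩ := Finset.mem_biUnion.mp hd
  have := hh σ (mem_support_iff.mp hσ)
  rwa [Finsupp.degree_eq_weight_one]

theorem supNorm_conj_le : supNorm T (fun σ => map (starRingEnd ℂ) (h ((starRingEnd ℂ).comp σ))) ≤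
    supNorm T h := by
  rw [supNorm_le_iff (apply_nonneg _ _)]
  rintro ⟨σ, b⟩
  cases b with
  | false => exact l1_realization_le T h (σ, true)
  | true =>
    have h1 : (starRingEnd ℂ).comp ((starRingEnd ℂ).comp σ) = σ := by
      ext x
      simp
    have h2 : realization T (σ, true)
        (fun σ => map (starRingEnd ℂ) (h ((starRingEnd ℂ).comp σ))) =
        realization T (σ, false) h := by
      rw [realization_true, realization_false, h1, map_map]
      have : (starRingEnd ℂ).comp (starRingEnd ℂ) = RingHom.id ℂ := by
        ext x
        simp
      rw [this, map_id]
    rw [h2]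
    exact l1_realization_le T h (σ, false)

theorem l1_smul_le (z : ℂ) (F : MvPolynomial ι ℂ) : l1 (z • F) ≤ ‖z‖ * l1 F := by
  rw [smul_eq_C_mul]
  refine (l1_mul_le _ _).trans_eq ?_
  rw [C_apply, l1_monomial]

theorem supNorm_smul_le (z : ℂ) : supNorm T (z • h) ≤ ‖z‖ * supNorm T h := by
  rw [supNorm_le_iff (mul_nonneg (norm_nonneg _) (apply_nonneg _ _))]
  rintro ⟨σ, b⟩
  cases b with
  | false =>
    rw [realization_false, Pi.smul_apply, map_smul]
    exact (l1_smul_le _ _).trans (mul_le_mul_of_nonneg_left (l1_realization_le T h (σ, false))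
      (norm_nonneg _))
  | true =>
    rw [realization_true, Pi.smul_apply, smul_eq_C_mul, map_mul, map_C, ← smul_eq_C_mul, map_smul]
    refine (l1_smul_le _ _).trans ?_
    rw [RCLike.norm_conj]
    exact mul_le_mul_of_nonneg_left (l1_realization_le T h (σ, true)) (norm_nonneg _)

theorem supNorm_mul_pow_le (q e : (K →+* ℂ) → MvPolynomial ι ℂ) (m : ℕ) :
    supNorm T (q * e ^ m) ≤ supNorm T q * supNorm T e ^ m := by
  induction m with
  | zero => simp
  | succ m ih =>
    rw [pow_succ, ← mul_assoc, pow_succ, ← mul_assoc]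
    exact (supNorm_mul_le _ _ _).trans (mul_le_mul_of_nonneg_right ih (apply_nonneg _ _))

/-- Evaluation at a conjugate of a point with coordinates in an extension of `K`. -/
noncomputable def pointEval {K' : Type} [Field K'] [Algebra K K'] (ev : MvPolynomial ι K →ₐ[K] K')
    (σ' : K' →+* ℂ) : ((K →+* ℂ) → MvPolynomial ι ℂ) →ₐ[ℂ] ℂ :=
  (aeval fun i => σ' (ev (X i))).comp
    (Pi.evalAlgHom ℂ (fun _ : K →+* ℂ => MvPolynomial ι ℂ) (σ'.comp (algebraMap K K')))

variable {K' : Type} [Field K'] [Algebra K K'] (ev : MvPolynomial ι K →ₐ[K] K') (σ' : K' →+* ℂ)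

theorem pointEval_apply : pointEval ev σ' h =
    aeval (fun i => σ' (ev (X i))) (h (σ'.comp (algebraMap K K'))) := rfl

theorem pointEval_toReal (f : MvPolynomial ι K) :
    pointEval ev σ' ((sections E hfull T).toReal f) = σ' (ev f) := by
  rw [pointEval_apply, sections_toReal_apply]
  have : ((aeval fun i => σ' (ev (X i)) : MvPolynomial ι ℂ →ₐ[ℂ] ℂ) :
      MvPolynomial ι ℂ →+* ℂ).comp
      (map (σ'.comp (algebraMap K K'))) = σ'.comp (ev : MvPolynomial ι K →+* K') := by
    ext
    · simp
    · simp
  exact congrArg (fun F : MvPolynomial ι K →+* ℂ => F f) this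

theorem pointEval_conj :
    pointEval ev σ' (fun σ => map (starRingEnd ℂ) (h ((starRingEnd ℂ).comp σ))) =
      (starRingEnd ℂ) (pointEval ev ((starRingEnd ℂ).comp σ') h) := by
  rw [pointEval_apply, pointEval_apply]
  generalize h ((starRingEnd ℂ).comp (σ'.comp (algebraMap K K'))) = F
  have : ((aeval fun i => σ' (ev (X i)) : MvPolynomial ι ℂ →ₐ[ℂ] ℂ) :
      MvPolynomial ι ℂ →+* ℂ).comp
      (map (starRingEnd ℂ)) = (starRingEnd ℂ).comp
      ((aeval fun i => ((starRingEnd ℂ).comp σ') (ev (X i)) : MvPolynomial ι ℂ →ₐ[ℂ] ℂ) :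
        MvPolynomial ι ℂ →+* ℂ) := by
    ext
    · simp
    · simp
  exact congrArg (fun G : MvPolynomial ι ℂ →+* ℂ => G F) this

end

section

variable {K ι : Type} [Field K] [NumberField K] [Fintype ι] {E : Submodule (𝓞 K) (ι → K)}
  {hfull : Submodule.span K (E : Set (ι → K)) = ⊤} {T : (K →+* ℂ) → Matrix ι ι ℂ}
  {K' : Type} [Field K'] [Algebra K K'] {ev : MvPolynomial ι K →ₐ[K] K'} {i₀ : ι}

theorem exists_homogeneous_lift (h1 : ev (X i₀) = 1) (f : MvPolynomial ι K) :
    ∃ N, ∀ n ≥ N, ∃ F : MvPolynomial ι K, F.IsHomogeneous n ∧ ev F = ev f := by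
  induction f using MvPolynomial.induction_on with
  | C a =>
    refine ⟨0, fun n _ => ⟨C a * X i₀ ^ n, ?_, by simp [h1]⟩⟩
    simpa using (isHomogeneous_C ι a).mul ((isHomogeneous_X K i₀).pow n)
  | add p q hp hq =>
    obtain ⟨N, hN⟩ := hp
    obtain ⟨N', hN'⟩ := hq
    refine ⟨max N N', fun n hn => ?_⟩
    obtain ⟨F, hF, hF'⟩ := hN n (le_of_max_le_left hn)
    obtain ⟨G, hG, hG'⟩ := hN' n (le_of_max_le_right hn)
    exact ⟨F + G, hF.add hG, by rw [map_add, map_add, hF', hG']⟩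
  | mul_X p i hp =>
    obtain ⟨N, hN⟩ := hp
    refine ⟨N + 1, fun n hn => ?_⟩
    obtain ⟨F, hF, hF'⟩ := hN (n - 1) (by omega)
    refine ⟨F * X i, ?_, by rw [map_mul, map_mul, hF']⟩
    have := hF.mul (isHomogeneous_X K i)
    rwa [show n - 1 + 1 = n by omega] at this

theorem mem_homCore_ker {f : MvPolynomial ι K} {n : ℕ} (hf : f.IsHomogeneous n) :
    f ∈ homCore (RingHom.ker ev) ↔ ev f = 0 := by
  rw [mem_homCore_of_isHomogeneous hf, RingHom.mem_ker]

variable [NumberField K']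

theorem exists_basis_lift (h1 : ev (X i₀) = 1) (hev : Function.Surjective ev) :
    ∃ n, ∃ F : Module.Free.ChooseBasisIndex ℤ (𝓞 K') → MvPolynomial ι K,
      (∀ j, (F j).IsHomogeneous n) ∧ ∀ j, ev (F j) = NumberField.integralBasis K' j := by
  choose f hf using fun j => hev (NumberField.integralBasis K' j)
  choose N hN using fun j => exists_homogeneous_lift h1 (f j)
  choose F hF hF' using fun j => hN j (Finset.univ.sup N) (Finset.le_sup (Finset.mem_univ j))
  exact ⟨_, F, hF, fun j => (hF' j).trans (hf j)⟩

theorem exists_lattice_lift {n : ℕ} {F : Module.Free.ChooseBasisIndex ℤ (𝓞 K') → MvPolynomial ι K}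
    (hF : ∀ j, (F j).IsHomogeneous n) (hF' : ∀ j, ev (F j) = NumberField.integralBasis K' j)
    (hfull : Submodule.span K (E : Set (ι → K)) = ⊤) :
    ∃ c : ℕ, c ≠ 0 ∧ ∀ m, ∀ y ∈ Submodule.span (𝓞 K') ((fun v => ev (linForm K v)) '' E) ^ m,
      ∀ a : 𝓞 K', ∃ l ∈ symLattice E (n + m), ev l = c * (a * y) := by
  choose c hc hcF using fun j => exists_nsmul_mem_symLattice hfull (hF j)
  refine ⟨∏ j, c j, Finset.prod_ne_zero_iff.mpr fun j _ => hc j, fun m => ?_⟩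
  have hbase : ∀ a : 𝓞 K', ∃ l ∈ symLattice E n, ev l = (∏ j, c j : ℕ) * (a : K') := by
    intro a
    have hj : ∀ j, (∏ j, c j) • F j ∈ symLattice E n := fun j => by
      obtain ⟨d, hd⟩ := Finset.dvd_prod_of_mem c (Finset.mem_univ j)
      rw [hd, mul_comm, mul_smul]
      exact nsmul_mem (hcF j) d
    refine ⟨∑ j, (NumberField.RingOfIntegers.basis K').repr a j • ((∏ j, c j) • F j),
      sum_mem fun j _ => zsmul_mem (hj j) _, ?_⟩
    conv_rhs => rw [← (NumberField.RingOfIntegers.basis K').sum_repr a]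
    simp only [map_sum, map_zsmul, map_nsmul, hF', Finset.mul_sum,
      NumberField.integralBasis_apply]
    refine Finset.sum_congr rfl fun j _ => ?_
    rw [zsmul_eq_mul, zsmul_eq_mul, nsmul_eq_mul]
    ring
  let P : ℕ → Submodule (𝓞 K') K' := fun m =>
    { carrier := {y | ∀ a : 𝓞 K', ∃ l ∈ symLattice E (n + m), ev l = (∏ j, c j : ℕ) * (a * y)}
      add_mem' := fun {x y} hx hy a => by
        obtain ⟨l, hl, h⟩ := hx a
        obtain ⟨l', hl', h'⟩ := hy a
        exact ⟨l + l', add_mem hl hl', by rw [map_add, h, h']; ring⟩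
      zero_mem' := fun a => ⟨0, zero_mem _, by simp⟩
      smul_mem' := fun b x hx a => by
        obtain ⟨l, hl, h⟩ := hx (a * b)
        refine ⟨l, hl, h.trans ?_⟩
        rw [Algebra.smul_def, show ((a * b : 𝓞 K') : K') = a * algebraMap (𝓞 K') K' b from map_mul _ _ _]
        ring }
  refine fun y hy => pow_le_of_forall_mul_mem (P := P) (fun a => ?_) (fun m x hx z hz => ?_) m hy
  · obtain ⟨l, hl, h⟩ := hbase a
    exact ⟨l, hl, by rw [h, mul_one]⟩
  · induction hz using Submodule.span_induction with
    | mem z hz =>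
      obtain ⟨v, hv, rfl⟩ := hz
      intro a
      obtain ⟨l, hl, h⟩ : ∃ l ∈ symLattice E (n + m), ev l = (∏ j, c j : ℕ) * (a * x) := hx a
      have hlv : l * linForm K v ∈ symLattice E (n + m + 1) :=
        mul_mem_symLattice hl (linForm_mem_symLattice hv)
      refine ⟨l * linForm K v, hlv, ?_⟩
      rw [map_mul, h]
      ring
    | zero =>
      rw [mul_zero]
      exact zero_mem _
    | add z z' _ _ h h' =>
      rw [mul_add]
      exact add_mem h h'
    | smul b z _ h =>
      rw [mul_smul_comm]
      exact Submodule.smul_mem _ _ h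

/-- Modulo the ideal of a point, forms are spanned by lifts of a basis of the residue field. -/
theorem exists_sub_sum_mem_realSpan {n : ℕ} {y : K'} (hy : y ≠ 0)
    {u : Module.Free.ChooseBasisIndex ℤ (𝓞 K') → MvPolynomial ι K}
    (hu : ∀ j, (u j).IsHomogeneous n) (hu' : ∀ j, ev (u j) = NumberField.integralBasis K' j * y)
    {w : (K →+* ℂ) → MvPolynomial ι ℂ} (hw : w ∈ (sections E hfull T).realSpan ⊤ n) :
    ∃ r : Module.Free.ChooseBasisIndex ℤ (𝓞 K') → ℝ,
      w - ∑ j, r j • (sections E hfull T).toReal (u j) ∈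
        (sections E hfull T).realSpan (homCore (RingHom.ker ev)) n := by
  induction hw using Submodule.span_induction with
  | mem w hw =>
    obtain ⟨f, ⟨-, hf⟩, rfl⟩ := hw
    set q := (NumberField.integralBasis K').repr (ev f / y) with hq
    refine ⟨fun j => (q j : ℝ), ?_⟩
    simp_rw [← SectionNorm.toReal_rat_smul]
    rw [← map_sum, ← map_sub]
    have hh : (f - ∑ j, q j • u j).IsHomogeneous n :=
      hf.sub (IsHomogeneous.sum _ _ _ fun j _ => by
        rw [← algebraMap_smul K, smul_eq_C_mul]
        simpa using (isHomogeneous_C ι _).mul (hu j))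
    refine SectionNorm.toReal_mem_realSpan _ ((mem_homCore_ker hh).mpr ?_) hh
    have : ev f / y * y = (∑ j, q j • NumberField.integralBasis K' j) * y := by
      rw [hq, (NumberField.integralBasis K').sum_repr]
    rw [div_mul_cancel₀ _ hy] at this
    rw [map_sub, this, map_sum, Finset.sum_mul, sub_eq_zero]
    refine Finset.sum_congr rfl fun j _ => ?_
    rw [map_rat_smul, hu', smul_mul_assoc]
  | zero => exact ⟨0, by simp⟩
  | add w w' _ _ h h' =>
    obtain ⟨r, hr⟩ := h
    obtain ⟨r', hr'⟩ := h'
    refine ⟨r + r', ?_⟩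
    have := add_mem hr hr'
    simp only [Pi.add_apply, add_smul, Finset.sum_add_distrib]
    convert this using 1
    abel
  | smul a w _ h =>
    obtain ⟨r, hr⟩ := h
    refine ⟨a • r, ?_⟩
    have := Submodule.smul_mem _ a hr
    simpa only [smul_sub, Finset.smul_sum, Pi.smul_apply, smul_smul, smul_eq_mul] using this

theorem pointEval_eq_zero_of_mem_realSpan {n : ℕ} {w : (K →+* ℂ) → MvPolynomial ι ℂ}
    (hw : w ∈ (sections E hfull T).realSpan (homCore (RingHom.ker ev)) n) (σ' : K' →+* ℂ) :
    pointEval ev σ' w = 0 := by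
  induction hw using Submodule.span_induction with
  | mem w hw =>
    obtain ⟨f, ⟨hf, hf'⟩, rfl⟩ := hw
    rw [pointEval_toReal, (mem_homCore_ker hf').mp hf, map_zero]
  | zero => exact map_zero _
  | add w w' _ _ h h' => rw [map_add, h, h', add_zero]
  | smul a w _ h =>
    rw [← Complex.coe_smul, map_smul, h, smul_zero]

theorem mem_realSpan_of_pointEval_eq_zero {n : ℕ}
    {u : Module.Free.ChooseBasisIndex ℤ (𝓞 K') → MvPolynomial ι K}
    (hu : ∀ j, (u j).IsHomogeneous n) (hu' : ∀ j, ev (u j) = NumberField.integralBasis K' j)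
    {w : (K →+* ℂ) → MvPolynomial ι ℂ} (hw : w ∈ (sections E hfull T).realSpan ⊤ n)
    (h0 : ∀ σ' : K' →+* ℂ, pointEval ev σ' w = 0) :
    w ∈ (sections E hfull T).realSpan (homCore (RingHom.ker ev)) n := by
  obtain ⟨r, hr⟩ := exists_sub_sum_mem_realSpan (ev := ev) one_ne_zero hu
    (fun j => by rw [hu', mul_one]) hw
  have hsum : ∑ j, (r j : ℂ) • NumberField.canonicalEmbedding.latticeBasis K' j = 0 := by
    funext σ'
    have h1 := pointEval_eq_zero_of_mem_realSpan hr σ'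
    rw [map_sub, h0, zero_sub, neg_eq_zero, map_sum] at h1
    simp only [Finset.sum_apply, Pi.smul_apply, Pi.zero_apply,
      NumberField.canonicalEmbedding.latticeBasis_apply, NumberField.canonicalEmbedding.apply_at]
    rw [← h1]
    refine Finset.sum_congr rfl fun j _ => ?_
    rw [← Complex.coe_smul, map_smul, pointEval_toReal, hu']
  have hr0 : ∀ j, r j = 0 := fun j => by
    exact_mod_cast Fintype.linearIndependent_iff.mp
      (NumberField.canonicalEmbedding.latticeBasis K').linearIndependent _ hsum j
  simpa [hr0] using hr

theorem exists_dual_forms {n : ℕ}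
    {u : Module.Free.ChooseBasisIndex ℤ (𝓞 K') → MvPolynomial ι K}
    (hu : ∀ j, (u j).IsHomogeneous n) (hu' : ∀ j, ev (u j) = NumberField.integralBasis K' j) :
    ∃ Q : (K' →+* ℂ) → (K →+* ℂ) → MvPolynomial ι ℂ, (∀ σ' σ, (Q σ' σ).IsHomogeneous n) ∧
      ∀ σ' σ'', pointEval ev σ'' (Q σ') = if σ'' = σ' then 1 else 0 := by
  set B := NumberField.canonicalEmbedding.latticeBasis K'
  refine ⟨fun σ' => fun σ => ∑ j, B.repr (Pi.single σ' 1) j • map σ (u j), fun σ' σ =>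
    IsHomogeneous.sum _ _ _ fun j _ => ?_, fun σ' σ'' => ?_⟩
  · rw [smul_eq_C_mul]
    simpa using (isHomogeneous_C ι _).mul ((hu j).map σ)
  · have h1 : ∀ j, aeval (fun i => σ'' (ev (X i))) (map (σ''.comp (algebraMap K K')) (u j)) =
        σ'' (NumberField.integralBasis K' j) := fun j => by
      rw [← hu']
      refine Eq.trans ?_ (pointEval_toReal (E := ⊤) (hfull := by simp) (T := 0) ev σ'' (u j))
      rfl
    rw [pointEval_apply, map_sum]
    simp only [map_smul, h1]
    have h2 := congrFun (B.sum_repr (Pi.single σ' 1)) σ''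
    simp only [Finset.sum_apply, Pi.smul_apply, B,
      NumberField.canonicalEmbedding.latticeBasis_apply,
      NumberField.canonicalEmbedding.apply_at] at h2
    rw [h2, Pi.single_apply]

end

section

variable {K ι : Type} [Field K] [NumberField K] [Fintype ι] {E : Submodule (𝓞 K) (ι → K)}
  {hfull : Submodule.span K (E : Set (ι → K)) = ⊤} {T : (K →+* ℂ) → Matrix ι ι ℂ}
  {K' : Type} [Field K'] [NumberField K'] [Algebra K K'] {ev : MvPolynomial ι K →ₐ[K] K'} {i₀ : ι}

theorem small_of_pointEval_eq {n : ℕ}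
    {u : Module.Free.ChooseBasisIndex ℤ (𝓞 K') → MvPolynomial ι K}
    (hu : ∀ j, (u j).IsHomogeneous n) (hu' : ∀ j, ev (u j) = NumberField.integralBasis K' j)
    {l : MvPolynomial ι K} (hl : l ∈ symLattice E n) {h : (K →+* ℂ) → MvPolynomial ι ℂ}
    (hh : ∀ σ, (h σ).IsHomogeneous n) (hev : ∀ σ' : K' →+* ℂ, pointEval ev σ' h = σ' (ev l)) :
    (sections E hfull T).Small (homCore (RingHom.ker ev)) n (supNorm T h) l := by
  set h' : (K →+* ℂ) → MvPolynomial ι ℂ :=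
    fun σ => map (starRingEnd ℂ) (h ((starRingEnd ℂ).comp σ)) with hh'
  have hcc : ∀ σ : K →+* ℂ, (starRingEnd ℂ).comp ((starRingEnd ℂ).comp σ) = σ := fun σ => by
    ext x
    simp
  have hmap : ∀ F : MvPolynomial ι ℂ, map (starRingEnd ℂ) (map (starRingEnd ℂ) F) = F := fun F => by
    refine MvPolynomial.ext _ _ fun d => ?_
    rw [coeff_map, coeff_map, Complex.conj_conj]
  have hs : (1 / 2 : ℝ) • (h + h') ∈ (sections E hfull T).realSpan ⊤ n := by
    refine Submodule.smul_mem _ _ (mem_realSpan_top_of_conj (fun σ => (hh σ).add ((hh _).map _))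
      fun σ => ?_)
    simp only [Pi.add_apply, hh', hcc, map_add, hmap]
    rw [add_comm]
  have hev' : ∀ σ' : K' →+* ℂ, pointEval ev σ' ((1 / 2 : ℝ) • (h + h')) = σ' (ev l) := fun σ' => by
    rw [← Complex.coe_smul, map_smul, map_add, hh', pointEval_conj, hev, hev]
    simp
    ring
  refine ⟨hl, _, mem_realSpan_of_pointEval_eq_zero hu hu' (sub_mem
    ((sections E hfull T).toReal_mem_realSpan_top (isHomogeneous_of_mem_symLattice hl)) hs)
    fun σ' => ?_, ?_⟩
  · rw [map_sub, hev', pointEval_toReal, sub_self]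
  · rw [sub_sub_cancel, sections_norm, map_smul_eq_mul]
    have h1 := map_add_le_add (supNorm T) h h'
    have h2 : supNorm T h' ≤ supNorm T h := supNorm_conj_le
    rw [Real.norm_of_nonneg (by norm_num)]
    linarith

/-- At a point whose heights are controlled by small elements of the powers of the lattice of
values, the covering radii grow subexponentially. -/
theorem good_of_point (h1 : ev (X i₀) = 1) (hsurj : Function.Surjective ev)
    {g : (K' →+* ℂ) → ℝ}
    (hunit : ∀ σ', ∀ ε > 0, ∃ e : (K →+* ℂ) → MvPolynomial ι ℂ, (∀ σ, (e σ).IsHomogeneous 1) ∧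
      pointEval ev σ' e = 1 ∧ supNorm T e ≤ g σ' * Real.exp ε)
    (hmink : ∃ C : ℝ, ∀ m, ∃ y ∈ Submodule.span (𝓞 K') ((fun v => ev (linForm K v)) '' E) ^ m,
      y ≠ 0 ∧ ∀ σ' : K' →+* ℂ, ‖σ' y‖ * g σ' ^ m ≤ C) :
    (sections E hfull T).Good (homCore (RingHom.ker ev)) 0 := by
  obtain ⟨n₁, F, hF, hF'⟩ := exists_basis_lift h1 hsurj
  obtain ⟨c, hc, hlift⟩ := exists_lattice_lift hF hF' hfull
  obtain ⟨Q, hQ, hQ'⟩ := exists_dual_forms hF hF'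
  obtain ⟨C, hC⟩ := hmink
  intro ε hε
  choose e he he' heN using fun σ' => hunit σ' (ε / 2) (half_pos hε)
  set A : Module.Free.ChooseBasisIndex ℤ (𝓞 K') → ℝ := fun j =>
    ∑ σ' : K' →+* ℂ, ‖(c : ℂ) * σ' (NumberField.integralBasis K' j)‖ * supNorm T (Q σ') * C
  filter_upwards [eventually_mul_pow_le_exp (∑ j, A j) 0 (half_pos hε),
    Filter.eventually_ge_atTop n₁] with n hn hn₁
  obtain ⟨m, rfl⟩ := Nat.exists_eq_add_of_le hn₁
  obtain ⟨y, hy, hy0, hyC⟩ := hC m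
  choose l hl hl' using fun j => hlift m y hy (NumberField.RingOfIntegers.basis K' j)
  have hu : ∀ j, (F j * X i₀ ^ m).IsHomogeneous (n₁ + m) := fun j => by
    simpa using (hF j).mul ((isHomogeneous_X K i₀).pow m)
  have hu' : ∀ j, ev (F j * X i₀ ^ m) = NumberField.integralBasis K' j := fun j => by
    simp [h1, hF']
  have hcov := SectionNorm.cov_of_family (D := sections E hfull T)
    (I := homCore (RingHom.ker ev)) (n := n₁ + m) l hl
    (fun w hw => exists_sub_sum_mem_realSpan (y := c * y)
      (mul_ne_zero (Nat.cast_ne_zero.mpr hc) hy0)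
      (fun j => isHomogeneous_of_mem_symLattice (hl j))
      (fun j => by rw [hl', NumberField.integralBasis_apply]; ring) hw)
    (ρ := fun j => A j * Real.exp (ε / 2 * m)) fun j => by
      refine (small_of_pointEval_eq hu hu' (hl j)
        (h := ∑ σ' : K' →+* ℂ, σ' (ev (l j)) • (Q σ' * e σ' ^ m)) (fun σ => ?_)
        fun σ' => ?_).mono le_rfl ?_
      · rw [Finset.sum_apply]
        refine IsHomogeneous.sum _ _ _ fun σ' _ => ?_
        rw [Pi.smul_apply, smul_eq_C_mul]
        simpa using (isHomogeneous_C ι _).mul ((hQ σ' σ).mul ((he σ' σ).pow m))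
      · rw [map_sum, Finset.sum_eq_single σ']
        · rw [map_smul, map_mul, map_pow, hQ', he']
          simp
        · intro σ'' _ hne
          rw [map_smul, map_mul, map_pow, hQ', if_neg hne.symm]
          simp
        · simp
      · refine (Finset.le_sum_of_subadditive _ (map_zero (supNorm T)).le (map_add_le_add _) _ _).trans
          ?_
        rw [Finset.sum_mul]
        refine Finset.sum_le_sum fun σ' _ => ?_
        have hg : 0 ≤ g σ' := by
          have := (apply_nonneg (supNorm T) _).trans (heN σ')
          exact nonneg_of_mul_nonneg_left this (Real.exp_pos _)
        calc supNorm T (σ' (ev (l j)) • (Q σ' * e σ' ^ m))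
            ≤ ‖σ' (ev (l j))‖ * (supNorm T (Q σ') * (g σ' * Real.exp (ε / 2)) ^ m) := by
              refine (supNorm_smul_le _).trans (mul_le_mul_of_nonneg_left ?_ (norm_nonneg _))
              exact (supNorm_mul_pow_le _ _ _).trans (mul_le_mul_of_nonneg_left
                (pow_le_pow_left₀ (apply_nonneg _ _) (heN σ') _) (apply_nonneg _ _))
          _ = ‖(c : ℂ) * σ' (NumberField.integralBasis K' j)‖ * supNorm T (Q σ') *
              (‖σ' y‖ * g σ' ^ m) * Real.exp (ε / 2 * m) := by
              rw [hl', mul_comm (ε / 2), Real.exp_nat_mul, NumberField.integralBasis_apply]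
              simp only [map_mul, map_natCast, norm_mul]
              ring
          _ ≤ _ := by
              refine mul_le_mul_of_nonneg_right (mul_le_mul_of_nonneg_left (hyC σ')
                (mul_nonneg (norm_nonneg _) (apply_nonneg _ _))) (Real.exp_pos _).le
  refine hcov.mono le_rfl ?_
  rw [← Finset.sum_mul]
  rw [pow_zero, mul_one] at hn
  refine (mul_le_mul_of_nonneg_right hn (Real.exp_pos _).le).trans ?_
  rw [← Real.exp_add, Real.exp_le_exp]
  push_cast
  nlinarith [Nat.cast_nonneg (α := ℝ) n₁]

end

section

variable {K : Type} [Field K] [NumberField K]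

theorem prod_embeddings_eq_prod_infinitePlace {M : Type*} [CommMonoid M] (f : (K →+* ℂ) → M)
    (hf : ∀ σ, f ((starRingEnd ℂ).comp σ) = f σ) :
    ∏ σ, f σ = ∏ w : NumberField.InfinitePlace K, f w.embedding ^ w.mult := by
  rw [← Finset.prod_fiberwise Finset.univ (fun σ => NumberField.InfinitePlace.mk σ)]
  refine Finset.prod_congr rfl fun w _ => ?_
  rw [← NumberField.InfinitePlace.card_filter_mk_eq w]
  refine Finset.prod_eq_pow_card fun σ hσ => ?_
  rw [Finset.mem_filter] at hσ
  have h := hσ.2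
  rw [← NumberField.InfinitePlace.mk_embedding w, NumberField.InfinitePlace.mk_eq_iff] at h
  rcases h with h | h
  · rw [h]
  · rw [← h]
    exact (hf σ).symm

theorem prod_norm_embeddings (x : K) : ∏ σ : K →+* ℂ, ‖σ x‖ = |(Algebra.norm ℚ x : ℝ)| := by
  rw [prod_embeddings_eq_prod_infinitePlace (fun σ : K →+* ℂ => ‖σ x‖) (fun σ => by simp)]
  simp_rw [NumberField.InfinitePlace.norm_embedding_eq]
  rw [NumberField.InfinitePlace.prod_eq_abs_norm]
  simp

theorem absNorm_mul_card_quotient {I : FractionalIdeal (nonZeroDivisors (𝓞 K)) K}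
    {L : Submodule (𝓞 K) K} (hIL : (I : Submodule (𝓞 K) K) = L) {x : K} (hx : x ∈ L) :
    FractionalIdeal.absNorm I *
      Nat.card (↥L ⧸ Submodule.comap L.subtype (Submodule.span (𝓞 K) {x})) =
      |Algebra.norm ℚ x| := by
  subst hIL
  obtain ⟨a, ha, hax⟩ : ∃ a ∈ I.num, algebraMap (𝓞 K) K a = algebraMap (𝓞 K) K I.den * x := by
    obtain ⟨a, ha, h⟩ := (FractionalIdeal.den_mul_self_eq_num I).le
      (Submodule.smul_mem_pointwise_smul x I.den _ hx)
    exact ⟨a, ha, by rw [← Algebra.smul_def]; exact h⟩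
  have hd : algebraMap (𝓞 K) K I.den ≠ 0 := by
    simp
  have hcard : Nat.card (↥(I : Submodule (𝓞 K) K) ⧸ Submodule.comap
      (I : Submodule (𝓞 K) K).subtype (Submodule.span (𝓞 K) {x})) =
      (Submodule.span (𝓞 K) {x}).toAddSubgroup.relIndex (I : Submodule (𝓞 K) K).toAddSubgroup := rfl
  have h1 : (I : Submodule (𝓞 K) K).toAddSubgroup.map
      (AddMonoidHom.mulLeft (algebraMap (𝓞 K) K I.den)) =
      I.num.toAddSubgroup.map (algebraMap (𝓞 K) K).toAddMonoidHom := by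
    ext y
    have := SetLike.ext_iff.1 (FractionalIdeal.den_mul_self_eq_num I) y
    simp only [AddSubgroup.mem_map]
    refine Iff.trans ?_ this
    constructor
    · rintro ⟨z, hz, rfl⟩
      exact ⟨z, hz, Algebra.smul_def _ _⟩
    · rintro ⟨z, hz, rfl⟩
      exact ⟨z, hz, (Algebra.smul_def _ _).symm⟩
  have h2 : (Submodule.span (𝓞 K) {x}).toAddSubgroup.map
      (AddMonoidHom.mulLeft (algebraMap (𝓞 K) K I.den)) =
      (Ideal.span {a}).toAddSubgroup.map (algebraMap (𝓞 K) K).toAddMonoidHom := by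
    ext y
    simp only [Submodule.mem_toAddSubgroup, AddSubgroup.mem_map]
    constructor
    · rintro ⟨z, hz, rfl⟩
      obtain ⟨c, rfl⟩ := Submodule.mem_span_singleton.1 hz
      refine ⟨c * a, Ideal.mul_mem_left _ _ (Ideal.mem_span_singleton_self a), ?_⟩
      simp [hax, Algebra.smul_def]
      ring
    · rintro ⟨z, hz, rfl⟩
      obtain ⟨c, rfl⟩ := Ideal.mem_span_singleton'.1 hz
      refine ⟨c • x, Submodule.smul_mem _ _ (Submodule.mem_span_singleton_self x), ?_⟩
      simp [hax, Algebra.smul_def]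
      ring
  have hle : (Ideal.span {a}).toAddSubgroup ≤ I.num.toAddSubgroup := by
    have : Ideal.span {a} ≤ I.num := (Ideal.span_singleton_le_iff_mem _).2 ha
    exact this
  have h3 := AddSubgroup.relIndex_mul_index hle
  rw [← AddSubgroup.relIndex_map_map_of_injective (f := (algebraMap (𝓞 K) K).toAddMonoidHom) _ _
    (FaithfulSMul.algebraMap_injective (𝓞 K) K), ← h1, ← h2,
    AddSubgroup.relIndex_map_map_of_injective _ _ (mul_right_injective₀ hd), ← hcard,
    ← Ideal.absNorm_eq_index, ← Ideal.absNorm_eq_index, Ideal.absNorm_span_singleton] at h3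
  have h4 : (Algebra.norm ℤ a : ℚ) = Algebra.norm ℤ (I.den : 𝓞 K) * Algebra.norm ℚ x := by
    rw [Algebra.coe_norm_int, Algebra.coe_norm_int, ← map_mul]
    exact congrArg _ hax
  have hd' : (Algebra.norm ℤ (I.den : 𝓞 K) : ℚ) ≠ 0 := by
    rw [Algebra.coe_norm_int]
    exact Algebra.norm_ne_zero_iff.2 hd
  have h5 : (Nat.card (↥(I : Submodule (𝓞 K) K) ⧸ Submodule.comap
      (I : Submodule (𝓞 K) K).subtype (Submodule.span (𝓞 K) {x})) : ℚ) * Ideal.absNorm I.num =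
      |(Algebra.norm ℤ a : ℚ)| := by
    rw [← Nat.cast_mul, h3, Nat.cast_natAbs, Int.cast_abs]
  rw [FractionalIdeal.absNorm_eq, Int.cast_abs, div_mul_eq_mul_div, mul_comm, h5, h4, abs_mul,
    mul_div_cancel_left₀ _ (abs_ne_zero.2 hd')]

end

section

variable {K : Type} [Field K] [NumberField K]

theorem absNorm_mul_prod_sqrt_le_one {I : FractionalIdeal (nonZeroDivisors (𝓞 K)) K}
    {L : Submodule (𝓞 K) K} (hIL : (I : Submodule (𝓞 K) K) = L) (hL : L ≠ ⊥)
    {G : (K →+* ℂ) → ℝ} (hG : ∀ σ, 0 < G σ) (hdeg : 0 ≤ degLine K L G) :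
    (FractionalIdeal.absNorm I : ℝ) * ∏ σ, √(G σ) ≤ 1 := by
  have h : ∃ x : K, x ∈ L ∧ x ≠ 0 := (Submodule.ne_bot_iff L).1 hL
  rw [degLine, dif_pos h] at hdeg
  obtain ⟨hx, hx0⟩ := h.choose_spec
  set x := h.choose
  have hN := congrArg (Rat.cast : ℚ → ℝ) (absNorm_mul_card_quotient hIL hx)
  push_cast at hN
  set c := Nat.card (↥L ⧸ Submodule.comap L.subtype (Submodule.span (𝓞 K) {x}))
  have hN0 : 0 < |(Algebra.norm ℚ x : ℝ)| := by
    exact abs_pos.2 (Rat.cast_ne_zero.2 (Algebra.norm_ne_zero_iff.2 hx0))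
  have hc : (0 : ℝ) < c := by
    rcases (Nat.cast_nonneg (α := ℝ) c).eq_or_lt with h0 | h0
    · rw [← h0, mul_zero] at hN
      exact absurd hN hN0.ne
    · exact h0
  have hpos : ∀ σ : K →+* ℂ, 0 < √(G σ) * ‖σ x‖ := fun σ =>
    mul_pos (Real.sqrt_pos.2 (hG σ)) (norm_pos_iff.2 ((map_ne_zero σ).2 hx0))
  rw [finsum_eq_sum_of_fintype, sub_nonneg] at hdeg
  have h1 : ∀ σ : K →+* ℂ, √(G σ * Complex.normSq (σ x)) = √(G σ) * ‖σ x‖ := fun σ => by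
    rw [Real.sqrt_mul (hG σ).le]
    rfl
  simp_rw [h1] at hdeg
  rw [← Real.log_prod fun σ _ => (hpos σ).ne',
    Real.log_le_log_iff (Finset.prod_pos fun σ _ => hpos σ) hc, Finset.prod_mul_distrib,
    prod_norm_embeddings, ← hN] at hdeg
  have := FractionalIdeal.absNorm_nonneg I
  have h2 : (0 : ℝ) < FractionalIdeal.absNorm I := by
    refine pos_of_mul_pos_left (hN ▸ hN0) hc.le
  nlinarith [mul_comm ((∏ σ, √(G σ)) * FractionalIdeal.absNorm I) (c : ℝ)]

theorem exists_mem_pow_norm_mul_le {L : Submodule (𝓞 K) K} (hfg : L.FG) (hL : L ≠ ⊥)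
    {G : (K →+* ℂ) → ℝ} (hG : ∀ σ, 0 < G σ) (hconj : ∀ σ, G ((starRingEnd ℂ).comp σ) = G σ)
    (hdeg : 0 ≤ degLine K L G) :
    ∃ C : ℝ, ∀ m : ℕ, ∃ y ∈ L ^ m, y ≠ 0 ∧ ∀ σ : K →+* ℂ, ‖σ y‖ * √(G σ) ^ m ≤ C := by
  obtain ⟨I, hI⟩ : ∃ I : FractionalIdeal (nonZeroDivisors (𝓞 K)) K,
      (I : Submodule (𝓞 K) K) = L :=
    ⟨⟨L, FractionalIdeal.isFractional_of_fg hfg⟩, rfl⟩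
  have hI0 : I ≠ 0 := by
    rintro rfl
    exact hL (by rw [← hI, FractionalIdeal.coe_zero])
  have hle := absNorm_mul_prod_sqrt_le_one hI hL hG hdeg
  set u : (FractionalIdeal (nonZeroDivisors (𝓞 K)) K)ˣ := Units.mk0 I hI0
  have hfin := (NumberField.mixedEmbedding.minkowskiBound_lt_top K 1).ne
  set B := (NumberField.mixedEmbedding.minkowskiBound K 1).toNNReal with hB
  have hBK : NumberField.mixedEmbedding.minkowskiBound K 1 = (B : ENNReal) :=
    (ENNReal.coe_toNNReal hfin).symm
  set C : NNReal := B + 1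
  have hBC : B < C ^ Module.finrank ℚ K :=
    (lt_add_one B).trans_le (le_self_pow₀ (by simp) Module.finrank_pos.ne')
  set a : ℝ := ((FractionalIdeal.absNorm I : ℚ) : ℝ) with ha
  have ha0 : 0 < a := by
    have h1 : FractionalIdeal.absNorm I ≠ 0 := fun h => hI0 (FractionalIdeal.absNorm_eq_zero_iff.1 h)
    exact Rat.cast_pos.2 ((FractionalIdeal.absNorm_nonneg I).lt_of_ne' h1)
  refine ⟨C, fun m => ?_⟩
  set f : NumberField.InfinitePlace K → NNReal :=
    fun w => C * ((√(G w.embedding)).toNNReal ^ m)⁻¹ with hf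
  have hprod : ∏ w, (f w : ℝ) ^ w.mult =
      (C : ℝ) ^ Module.finrank ℚ K * ((∏ σ : K →+* ℂ, √(G σ)) ^ m)⁻¹ := by
    rw [prod_embeddings_eq_prod_infinitePlace (fun σ : K →+* ℂ => √(G σ))
      (fun σ => by rw [hconj]), ← NumberField.InfinitePlace.sum_mult_eq, ← Finset.prod_pow_eq_pow_sum,
      ← Finset.prod_pow, ← Finset.prod_inv_distrib, ← Finset.prod_mul_distrib]
    refine Finset.prod_congr rfl fun w _ => ?_
    simp only [hf, NNReal.coe_mul, NNReal.coe_inv, NNReal.coe_pow,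
      Real.coe_toNNReal _ (Real.sqrt_nonneg _), mul_pow, inv_pow]
    ring
  have hlt : NumberField.mixedEmbedding.minkowskiBound K (u ^ m) <
      MeasureTheory.volume (NumberField.mixedEmbedding.convexBodyLT K f) := by
    rw [NumberField.mixedEmbedding.convexBodyLT_volume]
    have h1 : NumberField.mixedEmbedding.minkowskiBound K (u ^ m) = ENNReal.ofReal (a ^ m * B) := by
      rw [ENNReal.ofReal_mul (by positivity), ENNReal.ofReal_coe_nnreal, ← hBK]
      simp only [NumberField.mixedEmbedding.minkowskiBound,
        NumberField.mixedEmbedding.volume_fundamentalDomain_fractionalIdealLatticeBasis]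
      simp [u, ha, mul_assoc]
    rw [h1]
    refine lt_of_lt_of_le (b := ENNReal.ofReal (∏ w, (f w : ℝ) ^ w.mult)) ?_ ?_
    · rw [hprod, ENNReal.ofReal_lt_ofReal_iff_of_nonneg (by positivity)]
      have hP : 0 < ∏ σ : K →+* ℂ, √(G σ) := Finset.prod_pos fun σ _ => Real.sqrt_pos.2 (hG σ)
      rw [mul_comm]
      refine mul_lt_mul (by exact_mod_cast hBC) ?_ (by positivity) (by positivity)
      rw [← inv_pow]
      refine pow_le_pow_left₀ ha0.le ?_ _
      rwa [le_inv_comm₀ ha0 hP, ← one_div, le_div_iff₀ ha0, mul_comm]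
    · rw [ENNReal.ofReal_prod_of_nonneg fun w _ => by positivity]
      simp_rw [ENNReal.ofReal_pow (NNReal.coe_nonneg _), ENNReal.ofReal_coe_nnreal]
      rw [ENNReal.ofNNReal_finsetProd]; simp_rw [ENNReal.coe_pow]
      refine le_mul_of_one_le_left' ?_
      exact_mod_cast NumberField.mixedEmbedding.one_le_convexBodyLTFactor K
  obtain ⟨y, hy, hy0, hyf⟩ := NumberField.mixedEmbedding.exists_ne_zero_mem_ideal_lt K (u ^ m) hlt
  refine ⟨y, ?_, hy0, fun σ => ?_⟩
  · rw [← hI, ← FractionalIdeal.coe_pow]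
    have hy' : y ∈ I ^ m := by simpa [u] using hy
    exact hy'
  · have h1 := (hyf (NumberField.InfinitePlace.mk σ)).le
    have h2 : G (NumberField.InfinitePlace.mk σ).embedding = G σ := by
      rcases NumberField.InfinitePlace.embedding_mk_eq σ with h | h
      · rw [h]
      · rw [h]
        exact hconj σ
    rw [NumberField.InfinitePlace.apply, hf] at h1
    simp only [NNReal.coe_mul, NNReal.coe_inv, NNReal.coe_pow,
      Real.coe_toNNReal _ (Real.sqrt_nonneg _), h2] at h1
    have h3 : 0 < √(G σ) ^ m := pow_pos (Real.sqrt_pos.2 (hG σ)) _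
    rwa [← div_eq_mul_inv, le_div_iff₀ h3] at h1

end

section

variable {ι : Type} [Fintype ι]

theorem sum_norm_le_l1_linForm (v : ι → ℂ) : ∑ i, ‖v i‖ ≤ l1 (linForm ℂ v) := by
  have h := sum_norm_coeff_le (linForm ℂ v) (Finset.univ.image fun i : ι => Finsupp.single i 1)
  rw [Finset.sum_image fun i _ j _ h => Finsupp.single_left_injective one_ne_zero h] at h
  refine le_trans (Finset.sum_le_sum fun i _ => ?_) h
  rw [linForm_apply, coeff_sum]
  simp [coeff_C_mul, coeff_X, Finsupp.single_left_inj]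

theorem cForm_conj (M : Matrix ι ι ℂ) (u v : ι → ℂ) :
    cForm (M.map (starRingEnd ℂ)) (fun i => starRingEnd ℂ (u i)) (fun i => starRingEnd ℂ (v i)) =
      starRingEnd ℂ (cForm M u v) := by
  simp [cForm]

/-- The infimum of a hermitian form on the affine hyperplane `∑ pᵢ eᵢ = 1`. -/
noncomputable def infForm (M : Matrix ι ι ℂ) (p : ι → ℂ) : ℝ :=
  sInf {t : ℝ | ∃ e : ι → ℂ, ∑ i, p i * e i = 1 ∧ t = (cForm M e e).re}

theorem infForm_conj (M : Matrix ι ι ℂ) (p : ι → ℂ) :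
    infForm (M.map (starRingEnd ℂ)) (fun i => starRingEnd ℂ (p i)) = infForm M p := by
  unfold infForm
  congr 1
  ext t
  constructor
  · rintro ⟨e, he, rfl⟩
    refine ⟨fun i => starRingEnd ℂ (e i), ?_, ?_⟩
    · simpa using congrArg (starRingEnd ℂ) he
    · rw [← Complex.conj_re, ← cForm_conj]
      simp [Function.comp_def]
  · rintro ⟨e, he, rfl⟩
    refine ⟨fun i => starRingEnd ℂ (e i), ?_, ?_⟩
    · simpa using congrArg (starRingEnd ℂ) he
    · rw [cForm_conj, Complex.conj_re]

variable [DecidableEq ι] {M T : Matrix ι ι ℂ}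

theorem exists_pos_le_of_sum_eq_one
    (hT : ∀ e, l1 (subst T (linForm ℂ e)) ≤ √(cForm M e e).re) (hdet : T.det ≠ 0)
    (p : ι → ℂ) : ∃ c > 0, ∀ e : ι → ℂ, ∑ i, p i * e i = 1 → c ≤ (cForm M e e).re := by
  have hu : IsUnit T.det := isUnit_iff_ne_zero.2 hdet
  set B : ℝ := 1 + ∑ i, ‖Matrix.mulVec T⁻¹ p i‖
  have hB : 0 < B := by positivity
  refine ⟨(B⁻¹) ^ 2, by positivity, fun e he => ?_⟩
  have h1 : 1 ≤ B * ∑ i, ‖Matrix.vecMul e T i‖ := by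
    have h2 : ∑ i, Matrix.vecMul e T i * Matrix.mulVec T⁻¹ p i = 1 := by
      have : Matrix.vecMul e T ⬝ᵥ Matrix.mulVec T⁻¹ p = 1 := by
        rw [Matrix.dotProduct_mulVec, Matrix.vecMul_vecMul, Matrix.mul_nonsing_inv _ hu,
          Matrix.vecMul_one, dotProduct_comm]
        exact he
      exact this
    calc (1 : ℝ) = ‖∑ i, Matrix.vecMul e T i * Matrix.mulVec T⁻¹ p i‖ := by rw [h2, norm_one]
      _ ≤ ∑ i, ‖Matrix.vecMul e T i‖ * B := by
        refine (norm_sum_le _ _).trans (Finset.sum_le_sum fun i _ => ?_)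
        rw [norm_mul]
        refine mul_le_mul_of_nonneg_left ?_ (norm_nonneg _)
        have := Finset.single_le_sum (f := fun i => ‖Matrix.mulVec T⁻¹ p i‖)
          (fun i _ => norm_nonneg _) (Finset.mem_univ i)
        simp only [B]
        linarith
      _ = _ := by rw [← Finset.sum_mul, mul_comm]
  have h3 := (sum_norm_le_l1_linForm (Matrix.vecMul e T)).trans ((subst_linForm T e) ▸ hT e)
  have h4 : B⁻¹ ≤ √(cForm M e e).re := by
    rw [inv_le_iff_one_le_mul₀' hB]
    exact h1.trans (mul_le_mul_of_nonneg_left h3 hB.le)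
  have h5 := Real.sqrt_pos.1 ((inv_pos.2 hB).trans_le h4)
  exact (Real.le_sqrt' (inv_pos.2 hB)).1 h4

theorem infForm_pos (hT : ∀ e, l1 (subst T (linForm ℂ e)) ≤ √(cForm M e e).re)
    (hdet : T.det ≠ 0) {p : ι → ℂ} {i₀ : ι} (hp : p i₀ ≠ 0) : 0 < infForm M p := by
  obtain ⟨c, hc, h⟩ := exists_pos_le_of_sum_eq_one hT hdet p
  refine hc.trans_le (le_csInf ⟨_, Pi.single i₀ (p i₀)⁻¹, ?_, rfl⟩ ?_)
  · simp [Pi.single_apply, hp]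
  · rintro _ ⟨e, he, rfl⟩
    exact h e he

theorem exists_sqrt_cForm_le {p : ι → ℂ} {i₀ : ι} (hp : p i₀ ≠ 0) (hpos : 0 < infForm M p)
    {ε : ℝ} (hε : 0 < ε) : ∃ e : ι → ℂ, ∑ i, p i * e i = 1 ∧
      √(cForm M e e).re ≤ √(infForm M p) * Real.exp ε := by
  have h1 : infForm M p < infForm M p * Real.exp ε ^ 2 :=
    lt_mul_of_one_lt_right hpos (one_lt_pow₀ (Real.one_lt_exp_iff.2 hε) two_ne_zero)
  have hne : {t : ℝ | ∃ e : ι → ℂ, ∑ i, p i * e i = 1 ∧ t = (cForm M e e).re}.Nonempty :=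
    ⟨_, Pi.single i₀ (p i₀)⁻¹, by simp [Pi.single_apply, hp], rfl⟩
  obtain ⟨_, ⟨e, he, rfl⟩, hlt⟩ := exists_lt_of_csInf_lt hne h1
  refine ⟨e, he, (Real.sqrt_le_sqrt hlt.le).trans ?_⟩
  rw [Real.sqrt_mul hpos.le, Real.sqrt_sq (Real.exp_pos _).le]

end

section

variable {K ι : Type} [Field K] [NumberField K] [Fintype ι] {E : Submodule (𝓞 K) (ι → K)}
  {T H : (K →+* ℂ) → Matrix ι ι ℂ}

theorem supNorm_single_linForm_le (hconj : ConjCompatible K H)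
    (hT : ∀ σ e, l1 (subst (T σ) (linForm ℂ e)) ≤ √(cForm (H σ) e e).re) (σ : K →+* ℂ)
    (e : ι → ℂ) : supNorm T (Pi.single σ (linForm ℂ e)) ≤ √(cForm (H σ) e e).re := by
  rw [supNorm_le_iff (Real.sqrt_nonneg _)]
  rintro ⟨τ, _ | _⟩
  · rw [realization_false]
    by_cases h : τ = σ
    · subst h
      rw [Pi.single_eq_same]
      exact hT _ _
    · rw [Pi.single_eq_of_ne h, map_zero, map_zero]
      exact Real.sqrt_nonneg _
  · rw [realization_true]
    by_cases h : (starRingEnd ℂ).comp τ = σ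
    · subst h
      rw [Pi.single_eq_same, map_linForm, hconj]
      refine (hT _ _).trans_eq ?_
      rw [← Complex.conj_re, ← cForm_conj]
      simp
    · rw [Pi.single_eq_of_ne h, map_zero, map_zero, map_zero]
      exact Real.sqrt_nonneg _

variable {K' : Type} [Field K'] [NumberField K'] [Algebra K K'] {ev : MvPolynomial ι K →ₐ[K] K'}
  {i₀ : ι}

theorem algHom_linForm (v : ι → K) : ev (linForm K v) = ∑ i, algebraMap K K' (v i) * ev (X i) := by
  rw [linForm_apply, map_sum]
  simp [algHom_C]

theorem fg_span_linForm (hfg : E.FG) :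
    (Submodule.span (𝓞 K') ((fun v => ev (linForm K v)) '' E)).FG := by
  obtain ⟨S, hS⟩ := hfg
  have : Submodule.span (𝓞 K') ((fun v => ev (linForm K v)) '' E) =
      Submodule.span (𝓞 K') ((fun v => ev (linForm K v)) '' S) := by
    refine le_antisymm (Submodule.span_le.2 ?_) (Submodule.span_mono (Set.image_mono ?_))
    · rintro _ ⟨v, hv, rfl⟩
      rw [← hS] at hv
      simp only [SetLike.mem_coe]
      induction hv using Submodule.span_induction with
      | mem v hv => exact Submodule.subset_span ⟨v, hv, rfl⟩
      | zero => rw [map_zero, map_zero]; exact zero_mem _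
      | add v w _ _ hv hw => rw [map_add, map_add]; exact add_mem hv hw
      | smul a v _ hv =>
        have h1 : ev (linForm K (a • v)) = algebraMap (𝓞 K) (𝓞 K') a • ev (linForm K v) := by
          rw [algHom_linForm, algHom_linForm, Finset.smul_sum]
          refine Finset.sum_congr rfl fun i _ => ?_
          rw [Algebra.smul_def, ← mul_assoc, Pi.smul_apply, Algebra.smul_def, map_mul]
          rfl
        rw [h1]
        exact Submodule.smul_mem _ _ hv
    · rw [← hS]
      exact Submodule.subset_span
  rw [this]
  exact Submodule.fg_span (S.finite_toSet.image _)

theorem span_linForm_ne_bot (hfull : Submodule.span K (E : Set (ι → K)) = ⊤)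
    (h1 : ev (X i₀) = 1) : Submodule.span (𝓞 K') ((fun v => ev (linForm K v)) '' E) ≠ ⊥ := by
  intro h
  have h2 : Submodule.span K (E : Set (ι → K)) ≤
      LinearMap.ker (ev.toLinearMap.comp (linForm K)) := by
    rw [Submodule.span_le]
    intro v hv
    have : ev (linForm K v) ∈ Submodule.span (𝓞 K') ((fun v => ev (linForm K v)) '' E) :=
      Submodule.subset_span ⟨v, hv, rfl⟩
    rw [h, Submodule.mem_bot] at this
    exact this
  rw [hfull] at h2
  have h3 : ev (linForm K (Pi.single i₀ 1)) = 0 := h2 (Submodule.mem_top (x := Pi.single i₀ 1))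
  rw [linForm_single, h1] at h3
  exact one_ne_zero h3

theorem good_of_isNef_of_algHom [DecidableEq ι] (hfg : E.FG)
    (hfull : Submodule.span K (E : Set (ι → K)) = ⊤) (hconj : ConjCompatible K H)
    (hnef : IsNef K H E)
    (hT : ∀ σ e, l1 (subst (T σ) (linForm ℂ e)) ≤ √(cForm (H σ) e e).re)
    (hdet : ∀ σ, (T σ).det ≠ 0) (h1 : ev (X i₀) = 1) (hsurj : Function.Surjective ev) :
    (sections E hfull T).Good (homCore (RingHom.ker ev)) 0 := by
  set ψ : (ι → K') →ₗ[K'] K' := Fintype.linearCombination K' (fun i => ev (X i)) with hψ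
  set L := Submodule.span (𝓞 K') ((fun v => ev (linForm K v)) '' E) with hL
  have hψs : ∀ i, ψ (Pi.single i 1) = ev (X i) := fun i => by
    simp [hψ, Fintype.linearCombination_apply, Pi.single_apply]
  have hmap : Submodule.map (ψ.restrictScalars (𝓞 K')) (baseChange K K' E) = L := by
    rw [baseChange, Submodule.map_span, Set.image_image, hL]
    congr 2
    ext v
    rw [algHom_linForm]
    simp [hψ, Fintype.linearCombination_apply]
  have hL0 : L ≠ ⊥ := span_linForm_ne_bot hfull h1
  have hdeg := hnef K' ψ (by rwa [hmap])
  rw [hmap] at hdeg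
  set G := quotMetric (baseChangeMetric K K' H) ψ
  have hG : ∀ σ' : K' →+* ℂ, G σ' = infForm (H (σ'.comp (algebraMap K K'))) (fun i => σ' (ev (X i))) :=
    fun σ' => by
      simp only [G, quotMetric, hψs]
      rfl
  have hp : ∀ σ' : K' →+* ℂ, σ' (ev (X i₀)) ≠ 0 := fun σ' => by
    rw [h1, map_one]
    exact one_ne_zero
  have hpos : ∀ σ' : K' →+* ℂ, 0 < infForm (H (σ'.comp (algebraMap K K'))) (fun i => σ' (ev (X i))) :=
    fun σ' => infForm_pos (i₀ := i₀) (hT _) (hdet _) (hp σ')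
  refine good_of_point h1 hsurj (g := fun σ' => √(G σ')) (fun σ' ε hε => ?_) ?_
  · obtain ⟨e, he, hle⟩ := exists_sqrt_cForm_le (i₀ := i₀) (hp σ') (hpos σ') hε
    refine ⟨Pi.single (σ'.comp (algebraMap K K')) (linForm ℂ e), fun σ => ?_, ?_, ?_⟩
    · by_cases h : σ = σ'.comp (algebraMap K K')
      · subst h
        rw [Pi.single_eq_same]
        exact linForm_isHomogeneous e
      · rw [Pi.single_eq_of_ne h]
        exact isHomogeneous_zero _ _ _
    · rw [pointEval_apply, Pi.single_eq_same, aeval_linForm, ← he]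
      exact Finset.sum_congr rfl fun i _ => mul_comm _ _
    · rw [hG]
      exact (supNorm_single_linForm_le hconj hT _ e).trans hle
  · refine exists_mem_pow_norm_mul_le (fg_span_linForm hfg) hL0 (fun σ' => (hG σ').symm ▸ hpos σ')
      (fun σ' => ?_) hdeg
    rw [hG, hG, ← infForm_conj (H (σ'.comp (algebraMap K K'))), ← hconj]
    rfl

theorem good_bot_of_isNef [DecidableEq ι] (hfg : E.FG)
    (hfull : Submodule.span K (E : Set (ι → K)) = ⊤) (hconj : ConjCompatible K H)
    (hnef : IsNef K H E)
    (hT : ∀ σ e, l1 (subst (T σ) (linForm ℂ e)) ≤ √(cForm (H σ) e e).re)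
    (hdet : ∀ σ, (T σ).det ≠ 0) : (sections E hfull T).Good ⊥ 0 := by
  refine SectionNorm.good_zero_of_points (exists_good_bot hfg hfull T) (fun M i hM hi => ?_) _
    isHom_bot
  let : Field (MvPolynomial ι K ⧸ M) := Ideal.Quotient.field M
  have hfin : Module.Finite K (MvPolynomial ι K ⧸ M) :=
    finite_of_finite_type_of_isJacobsonRing K _
  have : NumberField (MvPolynomial ι K ⧸ M) := NumberField.of_module_finite K _
  have h := good_of_isNef_of_algHom (ev := Ideal.Quotient.mkₐ K M) (i₀ := i) hfg hfull hconj hnef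
    hT hdet ?_ (Ideal.Quotient.mkₐ_surjective K M)
  · have hker : RingHom.ker (Ideal.Quotient.mkₐ K M) = M := Ideal.Quotient.mkₐ_ker K M
    rwa [hker] at h
  · have := Ideal.Quotient.eq.2 hi
    simpa using this

end

section

variable {K : Type} [Field K] [NumberField K]

/-- The standard lattice `𝒪_K ^ r`. -/
def stdLattice (K : Type) [Field K] (r : ℕ) : Submodule (𝓞 K) (Fin r → K) :=
  Submodule.pi Set.univ fun _ => (1 : Submodule (𝓞 K) K)

theorem mem_stdLattice {r : ℕ} {v : Fin r → K} :
    v ∈ stdLattice K r ↔ ∀ i, v i ∈ (1 : Submodule (𝓞 K) K) := by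
  simp [stdLattice]

/-- Extension of a vector by a zero coordinate at the front. -/
def consZero (K : Type) [Field K] (r : ℕ) : (Fin r → K) →ₗ[𝓞 K] (Fin (r + 1) → K) where
  toFun w := Fin.cons 0 w
  map_add' a b := by
    ext i
    refine Fin.cases ?_ (fun i => ?_) i <;> simp
  map_smul' c a := by
    ext i
    refine Fin.cases ?_ (fun i => ?_) i <;> simp

@[simp] theorem consZero_zero {r : ℕ} (w : Fin r → K) : consZero K r w 0 = 0 := rfl

@[simp] theorem consZero_succ {r : ℕ} (w : Fin r → K) (i : Fin r) : consZero K r w i.succ = w i := rfl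

theorem consZero_injective (r : ℕ) : Function.Injective (consZero K r) := fun _ _ h =>
  funext fun i => congrFun h i.succ

theorem single_zero_mem_stdLattice {r : ℕ} {a : K} (ha : a ∈ (1 : Submodule (𝓞 K) K)) :
    (Pi.single 0 a : Fin (r + 1) → K) ∈ stdLattice K (r + 1) := by
  refine mem_stdLattice.2 fun i => ?_
  by_cases h : i = 0
  · subst h
    simpa using ha
  · rw [Pi.single_eq_of_ne h]
    exact zero_mem _

theorem consZero_tail {r : ℕ} (v : Fin (r + 1) → K) :
    consZero K r (Fin.tail v) = v - Pi.single 0 (v 0) := by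
  ext i
  refine Fin.cases ?_ (fun i => ?_) i <;> simp [Fin.tail]

theorem relIndex_stdLattice_succ {r : ℕ} {E : Submodule (𝓞 K) (Fin (r + 1) → K)}
    (hO : stdLattice K (r + 1) ≤ E) :
    (stdLattice K r).toAddSubgroup.relIndex (E.comap (consZero K r)).toAddSubgroup *
      (1 : Submodule (𝓞 K) K).toAddSubgroup.relIndex (E.map (LinearMap.proj 0)).toAddSubgroup =
      (stdLattice K (r + 1)).toAddSubgroup.relIndex E.toAddSubgroup := by
  let p : (Fin (r + 1) → K) →+ K := (LinearMap.proj (R := 𝓞 K) (φ := fun _ => K) 0).toAddMonoidHom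
  let c : (Fin r → K) →+ (Fin (r + 1) → K) := (consZero K r).toAddMonoidHom
  set W := E.toAddSubgroup ⊓ (1 : Submodule (𝓞 K) K).toAddSubgroup.comap p with hW
  have hOW : (stdLattice K (r + 1)).toAddSubgroup ≤ W :=
    fun v hv => ⟨hO hv, mem_stdLattice.1 hv 0⟩
  have h1 : W.relIndex E.toAddSubgroup =
      (1 : Submodule (𝓞 K) K).toAddSubgroup.relIndex (E.map (LinearMap.proj 0)).toAddSubgroup := by
    rw [hW, AddSubgroup.inf_relIndex_left, AddSubgroup.relIndex_comap]
    rfl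
  have h2 : W = (E.comap (consZero K r)).toAddSubgroup.map c ⊔
      (stdLattice K (r + 1)).toAddSubgroup := by
    refine le_antisymm (fun v hv => ?_) (sup_le ?_ hOW)
    · have hs := single_zero_mem_stdLattice (r := r) hv.2
      rw [← sub_add_cancel v (Pi.single 0 (v 0))]
      refine AddSubgroup.add_mem_sup ⟨Fin.tail v, ?_, consZero_tail v⟩ hs
      change consZero K r (Fin.tail v) ∈ E
      rw [consZero_tail]
      exact sub_mem hv.1 (hO hs)
    · rintro - ⟨w, hw, rfl⟩
      exact ⟨hw, zero_mem (1 : Submodule (𝓞 K) K)⟩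
  have h3 : (stdLattice K (r + 1)).toAddSubgroup.relIndex W =
      (stdLattice K r).toAddSubgroup.relIndex (E.comap (consZero K r)).toAddSubgroup := by
    rw [h2, AddSubgroup.relIndex_sup_right, ← AddSubgroup.relIndex_comap]
    congr 1
    ext w
    change consZero K r w ∈ stdLattice K (r + 1) ↔ w ∈ stdLattice K r
    rw [mem_stdLattice, mem_stdLattice, Fin.forall_fin_succ]
    simp
  rw [← h1, ← h3]
  exact AddSubgroup.relIndex_mul_relIndex _ _ _ hOW inf_le_left

theorem exists_section_of_fractionalIdeal {V : Type} [AddCommGroup V] [Module K V] [Module (𝓞 K) V]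
    [IsScalarTower (𝓞 K) K V] {E : Submodule (𝓞 K) V} (p : V →ₗ[K] K)
    {J : FractionalIdeal (nonZeroDivisors (𝓞 K)) K} (hJ0 : J ≠ 0)
    (hJ : (J : Submodule (𝓞 K) K) = E.map (p.restrictScalars (𝓞 K))) :
    ∃ y : V, p y = 1 ∧ ∀ a ∈ J, a • y ∈ E := by
  have h1 : (1 : K) ∈ J * J⁻¹ := by
    rw [mul_inv_cancel₀ hJ0]
    exact FractionalIdeal.one_mem_one _
  refine FractionalIdeal.mul_induction_on (C := fun z => ∃ y : V, p y = z ∧ ∀ a ∈ J, a • y ∈ E)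
    h1 (fun i hi j hj => ?_) ?_
  · have hi' : i ∈ (J : Submodule (𝓞 K) K) := hi
    rw [hJ] at hi'
    obtain ⟨v, hv, rfl⟩ := hi'
    refine ⟨j • v, by simp [mul_comm], fun a ha => ?_⟩
    obtain ⟨b, hb⟩ := (FractionalIdeal.mem_one_iff _).1 ((FractionalIdeal.mem_inv_iff hJ0).1 hj a ha)
    rw [smul_smul, mul_comm, ← hb, algebraMap_smul]
    exact E.smul_mem _ hv
  · rintro x y ⟨u, rfl, hu⟩ ⟨v, rfl, hv⟩
    exact ⟨u + v, map_add _ _ _, fun a ha => by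
      rw [smul_add]
      exact add_mem (hu a ha) (hv a ha)⟩

theorem exists_unimodular (r : ℕ) (E : Submodule (𝓞 K) (Fin r → K)) (hfg : E.FG)
    (hO : stdLattice K r ≤ E) :
    ∃ (J : Fin r → FractionalIdeal (nonZeroDivisors (𝓞 K)) K) (U : Matrix (Fin r) (Fin r) K),
      U.det = 1 ∧ (∀ v ∈ E, ∀ k, Matrix.vecMul v U k ∈ J k) ∧
      (∏ k, FractionalIdeal.absNorm (J k)) *
        (stdLattice K r).toAddSubgroup.relIndex E.toAddSubgroup = 1 := by
  induction r with
  | zero =>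
    refine ⟨Fin.elim0, 1, by simp, fun v _ k => k.elim0, ?_⟩
    have : stdLattice K 0 = E := by
      ext v
      rw [Subsingleton.elim v 0]
      exact iff_of_true (zero_mem _) (zero_mem _)
    simp [this]
  | succ r ih =>
    have hE'' : (E.comap (consZero K r)).FG := by
      have : IsNoetherian (𝓞 K) E := isNoetherian_of_fg_of_noetherian _ hfg
      refine Submodule.fg_of_fg_map_injective (consZero K r) (consZero_injective r) ?_
      have h : Submodule.map (consZero K r) (E.comap (consZero K r)) ≤ E :=
        Submodule.map_comap_le _ _
      exact Submodule.FG.of_le hfg h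
    obtain ⟨J, U, hU, hEU, hJ⟩ := ih (E.comap (consZero K r)) hE'' fun w hw => hO <| by
      rw [mem_stdLattice] at hw ⊢
      rw [Fin.forall_fin_succ]
      exact ⟨zero_mem _, hw⟩
    let p : (Fin (r + 1) → K) →ₗ[K] K := LinearMap.proj 0
    let J₀ : FractionalIdeal (nonZeroDivisors (𝓞 K)) K :=
      ⟨E.map (p.restrictScalars (𝓞 K)), FractionalIdeal.isFractional_of_fg (hfg.map _)⟩
    have h1 : (1 : K) ∈ E.map (p.restrictScalars (𝓞 K)) :=
      ⟨Pi.single 0 1, hO (single_zero_mem_stdLattice (Submodule.one_le.1 le_rfl)), by simp [p]⟩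
    have hJ₀ : J₀ ≠ 0 := fun h => one_ne_zero ((FractionalIdeal.mem_zero_iff _).1 (h ▸ h1 : (1 : K) ∈ (0 : FractionalIdeal (nonZeroDivisors (𝓞 K)) K)))
    obtain ⟨y, hy, hyE⟩ := exists_section_of_fractionalIdeal (E := E) p hJ₀ rfl
    replace hy : y 0 = 1 := hy
    refine ⟨Fin.cons J₀ J, Matrix.of (Fin.cons (Fin.cons 1 (-(Matrix.vecMul (Fin.tail y) U)))
      fun i => Fin.cons 0 (U i)), ?_, fun v hv => ?_, ?_⟩
    · rw [Matrix.det_succ_column_zero, Fin.sum_univ_succ, Finset.sum_eq_zero]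
      · have h : ∀ A : Matrix (Fin (r + 1)) (Fin (r + 1)) K, A 0 0 = 1 →
            A.submatrix Fin.succ Fin.succ = U →
            (-1) ^ ((0 : Fin (r + 1)) : ℕ) * A 0 0 *
              (A.submatrix (Fin.succAbove 0) Fin.succ).det + 0 = 1 := fun A hA0 hA => by
          have : A.submatrix (Fin.succAbove 0) Fin.succ = U := hA
          rw [this, hA0, hU]
          simp
        exact h _ rfl rfl
      · intro i _
        simp
    · have hv0 : v 0 ∈ J₀ := ⟨v, hv, rfl⟩
      refine Fin.cases ?_ fun k => ?_
      · simpa [Matrix.vecMul, dotProduct, Fin.sum_univ_succ] using hv0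
      · have hw : consZero K r (Fin.tail v - v 0 • Fin.tail y) ∈ E := by
          convert sub_mem hv (hyE _ hv0) using 1
          ext i
          refine Fin.cases ?_ (fun i => ?_) i <;> simp [Fin.tail, hy]
        have := hEU _ hw k
        rw [Fin.cons_succ]
        convert this using 1
        rw [Matrix.sub_vecMul, Matrix.smul_vecMul]
        simp [Matrix.vecMul, dotProduct, Fin.sum_univ_succ, Fin.tail]
        ring
    · rw [Fin.prod_univ_succ, ← relIndex_stdLattice_succ hO]
      have h2 := absNorm_mul_card_quotient (I := J₀) (L := E.map (p.restrictScalars (𝓞 K))) rfl h1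
      rw [map_one, abs_one] at h2
      have h3 : (Nat.card (↥(E.map (p.restrictScalars (𝓞 K))) ⧸ Submodule.comap
          (E.map (p.restrictScalars (𝓞 K))).subtype (Submodule.span (𝓞 K) {1}))) =
          (1 : Submodule (𝓞 K) K).toAddSubgroup.relIndex
            (E.map (LinearMap.proj 0)).toAddSubgroup := by
        rw [Submodule.one_eq_span]
        rfl
      rw [h3] at h2
      simp only [Fin.cons_zero, Fin.cons_succ]
      push_cast
      rw [← one_mul (1 : ℚ)]
      nth_rewrite 1 [← h2]
      rw [← hJ]
      ring

variable {ι : Type} [Fintype ι] [DecidableEq ι]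

theorem eForm_eq_apply {s : Type} (M : Matrix ι ι ℂ) (σ : K →+* ℂ) (X : Matrix s ι K) (a b : s) :
    eForm M σ (X a) (X b) = ((X.map σ).map (starRingEnd ℂ) * M * (X.map σ).transpose) a b := by
  simp only [eForm, cForm, Matrix.mul_apply, Matrix.map_apply, Matrix.transpose_apply,
    Finset.sum_mul]
  exact Finset.sum_comm

theorem exists_pseudoBasis {E : Submodule (𝓞 K) (ι → K)} (hfg : E.FG)
    (hfull : Submodule.span K (E : Set (ι → K)) = ⊤) {s : ℕ} {x : Fin s → ι → K}
    (hx : LinearIndependent K x) (hxE : ∀ a, x a ∈ E)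
    (hspan : ∀ y ∈ E, y ∈ Submodule.span K (Set.range x)) :
    ∃ (J : ι → FractionalIdeal (nonZeroDivisors (𝓞 K)) K) (Z : Matrix ι ι K), Z.det ≠ 0 ∧
      (∀ v ∈ E, ∀ k, Matrix.vecMul v Z k ∈ J k) ∧
      (∏ k, FractionalIdeal.absNorm (J k)) * Nat.card
        (↥E ⧸ Submodule.comap E.subtype (Submodule.span (𝓞 K) (Set.range x))) = 1 ∧
      ∀ (σ : K →+* ℂ) (M : Matrix ι ι ℂ), ((‖σ Z.det‖ ^ 2 : ℝ) : ℂ) *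
        (Matrix.of fun a b => eForm M σ (x a) (x b)).det = M.det := by
  have htop : ⊤ ≤ Submodule.span K (Set.range x) := by
    rw [← hfull]
    exact Submodule.span_le.2 hspan
  have hcard : Fintype.card (Fin s) = Fintype.card ι := by
    rw [← Module.finrank_eq_card_basis (Module.Basis.mk hx htop), Module.finrank_fintype_fun_eq_card]
  let e : Fin s ≃ ι := Fintype.equivOfCardEq hcard
  let Xs : Matrix (Fin s) ι K := x
  let f : (Fin s → K) →ₗ[K] (ι → K) := Matrix.vecMulLinear Xs
  have hf : ∀ c, f c = ∑ i, c i • x i := fun c => by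
    ext j
    rw [Finset.sum_apply]
    rfl
  have hfi : Function.Injective f := by
    refine (injective_iff_map_eq_zero f).2 fun c hc => ?_
    rw [hf] at hc
    exact funext (Fintype.linearIndependent_iff.1 hx c hc)
  have hsurj : ∀ v ∈ E, ∃ c, f c = v := fun v hv => by
    obtain ⟨c, hc⟩ := (Submodule.mem_span_range_iff_exists_fun K).1 (hspan v hv)
    exact ⟨c, (hf c).trans hc⟩
  set E' := E.comap (f.restrictScalars (𝓞 K)) with hE'
  have hmap : E'.map (f.restrictScalars (𝓞 K)) = E := by
    refine le_antisymm (Submodule.map_comap_le _ _) fun v hv => ?_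
    obtain ⟨c, rfl⟩ := hsurj v hv
    exact ⟨c, hv, rfl⟩
  have hmapO : (stdLattice K s).map (f.restrictScalars (𝓞 K)) =
      Submodule.span (𝓞 K) (Set.range x) := by
    ext v
    rw [Submodule.mem_span_range_iff_exists_fun]
    constructor
    · rintro ⟨c, hc, rfl⟩
      choose d hd using fun i => Submodule.mem_one.1 (mem_stdLattice.1 hc i)
      refine ⟨d, ?_⟩
      refine Eq.trans ?_ (hf c).symm
      exact Finset.sum_congr rfl fun i _ => by rw [← hd, algebraMap_smul]
    · rintro ⟨d, rfl⟩
      refine ⟨fun i => algebraMap (𝓞 K) K (d i), mem_stdLattice.2 fun i =>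
        Submodule.mem_one.2 ⟨_, rfl⟩, (hf _).trans ?_⟩
      exact Finset.sum_congr rfl fun i _ => by rw [algebraMap_smul]
  have hO : stdLattice K s ≤ E' := by
    rw [hE', ← Submodule.map_le_iff_le_comap, hmapO, Submodule.span_le]
    rintro - ⟨a, rfl⟩
    exact hxE a
  obtain ⟨J, U, hU, hEU, hJ⟩ := exists_unimodular s E'
    (Submodule.fg_of_fg_map_injective (f.restrictScalars (𝓞 K)) hfi (by rwa [hmap])) hO
  let X : Matrix ι ι K := Xs.submatrix e.symm id
  have hX : IsUnit X := by
    rw [← Matrix.linearIndependent_rows_iff_isUnit]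
    exact hx.comp _ e.symm.injective
  have hX' : IsUnit X.det := (Matrix.isUnit_iff_isUnit_det X).1 hX
  refine ⟨J ∘ e.symm, X⁻¹ * U.submatrix e.symm e.symm, ?_, fun v hv k => ?_, ?_, fun σ M => ?_⟩
  · rw [Matrix.det_mul, Matrix.det_submatrix_equiv_self, hU, mul_one, Matrix.det_nonsing_inv]
    exact hX'.ringInverse.ne_zero
  · obtain ⟨c, rfl⟩ := hsurj v hv
    have h1 : f c = Matrix.vecMul (c ∘ e.symm) X := by
      simp only [X, Matrix.submatrix_vecMul_equiv]
      simp [f, Function.comp_assoc]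
    rw [h1, Matrix.vecMul_vecMul, Matrix.mul_nonsing_inv_cancel_left _ _ hX',
      Matrix.submatrix_vecMul_equiv]
    simpa [Function.comp_assoc] using hEU c hv (e.symm k)
  · rw [← hJ, ← Equiv.prod_comp e.symm]
    congr 2
    change (Submodule.span (𝓞 K) (Set.range x)).toAddSubgroup.relIndex E.toAddSubgroup = _
    rw [← AddSubgroup.relIndex_map_map_of_injective (f := f.toAddMonoidHom) _ _ hfi]
    congr 1
    · rw [← hmapO]
      rfl
    · conv_lhs => rw [← hmap]
      rfl
  · have h1 : (Matrix.of fun a b => eForm M σ (x a) (x b)).det =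
        (X.map σ).det * (starRingEnd ℂ) (X.map σ).det * M.det := by
      rw [← Matrix.det_submatrix_equiv_self e.symm]
      have : (Matrix.of fun a b => eForm M σ (x a) (x b)).submatrix e.symm e.symm =
          (X.map σ).map (starRingEnd ℂ) * M * (X.map σ).transpose := by
        ext a b
        rw [← eForm_eq_apply]
        rfl
      rw [this, Matrix.det_mul, Matrix.det_mul, Matrix.det_transpose]
      have h2 : ((X.map σ).map (starRingEnd ℂ)).det = (starRingEnd ℂ) (X.map σ).det :=
        (RingHom.map_det (starRingEnd ℂ) (X.map σ)).symm
      rw [h2]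
      ring
    have h3 : (X.map σ).det = σ X.det := (RingHom.map_det σ X).symm
    have h4 : (X⁻¹ * U.submatrix e.symm e.symm).det = X.det⁻¹ := by
      rw [Matrix.det_mul, Matrix.det_submatrix_equiv_self, hU, mul_one, Matrix.det_nonsing_inv,
        Ring.inverse_eq_inv']
    have h5 : (‖σ X.det‖ ^ 2 : ℂ) ≠ 0 := by
      simpa using hX'.ne_zero
    rw [h1, h3, h4, Complex.mul_conj, Complex.normSq_eq_norm_sq, map_inv₀, norm_inv]
    push_cast
    rw [inv_pow, inv_mul_cancel_left₀ h5]

end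

section

variable {ι : Type} [Fintype ι] [DecidableEq ι]

/-- The exponents of the monomials of degree `n`. -/
abbrev Exponent (ι : Type) [Fintype ι] [DecidableEq ι] (n : ℕ) : Type :=
  ↥((Finset.univ : Finset ι).finsuppAntidiag n)

theorem mem_exponent {n : ℕ} {d : ι →₀ ℕ} :
    d ∈ (Finset.univ : Finset ι).finsuppAntidiag n ↔ ∑ i, d i = n := by
  simp [Finset.mem_finsuppAntidiag]

variable {R : Type} [CommRing R] {n : ℕ}

theorem eq_sum_exponent {F : MvPolynomial ι R} (hF : F.IsHomogeneous n) :
    F = ∑ c : Exponent ι n, coeff c.1 F • monomial c.1 (1 : R) := by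
  rw [Finset.sum_coe_sort ((Finset.univ : Finset ι).finsuppAntidiag n)
    (fun c => coeff c F • monomial c (1 : R))]
  conv_lhs => rw [F.as_sum]
  have : ∀ c : ι →₀ ℕ, monomial c (coeff c F) = coeff c F • monomial c (1 : R) := fun c => by
    rw [smul_monomial, smul_eq_mul, mul_one]
  simp_rw [this]
  refine Finset.sum_subset (fun d hd => ?_) fun d _ hd => by
    rw [notMem_support_iff.1 hd, zero_smul]
  have h := hF (mem_support_iff.mp hd)
  have hdeg : d.degree = n := by rwa [Finsupp.degree_eq_weight_one]
  rw [Finsupp.degree_eq_sum] at hdeg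
  exact mem_exponent.2 hdeg

/-- The matrix of coefficients of a family of forms of degree `n`. -/
def coeffMatrix (f : Exponent ι n → MvPolynomial ι R) : Matrix (Exponent ι n) (Exponent ι n) R :=
  Matrix.of fun a b => coeff b.1 (f a)

/-- The matrix of the substitution `T` on forms of degree `n`. -/
noncomputable def symMatrix (n : ℕ) (T : Matrix ι ι R) :
    Matrix (Exponent ι n) (Exponent ι n) R :=
  coeffMatrix fun a => subst T (monomial a.1 1)

theorem coeffMatrix_subst (T : Matrix ι ι R) {f : Exponent ι n → MvPolynomial ι R}
    (hf : ∀ a, (f a).IsHomogeneous n) :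
    coeffMatrix (fun a => subst T (f a)) = coeffMatrix f * symMatrix n T := by
  ext a b
  rw [Matrix.mul_apply, coeffMatrix, Matrix.of_apply]
  conv_lhs => rw [eq_sum_exponent (hf a), map_sum, coeff_sum]
  refine Finset.sum_congr rfl fun c _ => ?_
  rw [map_smul, coeff_smul]
  rfl

theorem isHomogeneous_exponent (a : Exponent ι n) : (monomial a.1 (1 : R)).IsHomogeneous n :=
  isHomogeneous_monomial _ (by rw [Finsupp.degree_eq_sum]; exact mem_exponent.1 a.2)

theorem subst_subst (T S : Matrix ι ι R) (F : MvPolynomial ι R) :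
    subst S (subst T F) = subst (T * S) F := by
  have : (subst S).comp (subst T) = subst (T * S) := by
    refine MvPolynomial.algHom_ext fun i => ?_
    rw [AlgHom.comp_apply, ← linForm_single, subst_linForm, subst_linForm, subst_linForm,
      Matrix.vecMul_vecMul]
  rw [← this]
  rfl

theorem symMatrix_mul (T S : Matrix ι ι R) :
    symMatrix n (T * S) = symMatrix n T * symMatrix n S := by
  rw [symMatrix, symMatrix, ← coeffMatrix_subst S
    fun a => subst_isHomogeneous T (isHomogeneous_exponent a)]
  simp_rw [subst_subst]

theorem symMatrix_diagonal (D : ι → R) : symMatrix n (Matrix.diagonal D) =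
    Matrix.diagonal fun a => ∏ i, D i ^ a.1 i := by
  have h : ∀ d : ι →₀ ℕ, subst (Matrix.diagonal D) (monomial d 1) =
      C (∏ i, D i ^ d i) * monomial d (1 : R) := fun d => by
    have hX : ∀ i, subst (Matrix.diagonal D) (X i : MvPolynomial ι R) = C (D i) * X i := fun i => by
      rw [← linForm_single, subst_linForm, linForm_apply]
      simp [Pi.single_apply, apply_ite C, ite_mul, linForm_single]
    rw [monomial_eq, C_1, one_mul, Finsupp.prod_fintype _ _ (fun i => pow_zero _), map_prod, map_prod,
      ← Finset.prod_mul_distrib]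
    refine Finset.prod_congr rfl fun i _ => ?_
    rw [map_pow, hX, mul_pow, map_pow]
  ext a b
  rw [symMatrix, coeffMatrix, Matrix.of_apply, h, coeff_C_mul, coeff_monomial,
    Matrix.diagonal_apply]
  by_cases hab : a = b
  · simp [hab]
  · rw [if_neg hab, if_neg (fun h => hab (Subtype.ext h)), mul_zero]

/-- The sum of the `i`-th exponents of all monomials of degree `n`. -/
def exponentSum (n : ℕ) (i : ι) : ℕ := ∑ a : Exponent ι n, a.1 i

theorem exponentSum_eq (n : ℕ) (i j : ι) : exponentSum n i = exponentSum n j := by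
  have hmem : ∀ a : Exponent ι n, Finsupp.equivMapDomain (Equiv.swap i j) a.1 ∈
      (Finset.univ : Finset ι).finsuppAntidiag n := fun a => by
    rw [mem_exponent]
    refine Eq.trans ?_ (mem_exponent.1 a.2)
    simp only [Finsupp.equivMapDomain_apply]
    exact Equiv.sum_comp (Equiv.swap i j).symm a.1
  refine Finset.sum_nbij' (fun a => ⟨_, hmem a⟩) (fun a => ⟨_, hmem a⟩) (by simp) (by simp)
    (fun a _ => ?_) (fun a _ => ?_) fun a _ => ?_
  · exact Subtype.ext (Finsupp.ext fun k => by simp [Finsupp.equivMapDomain_apply])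
  · exact Subtype.ext (Finsupp.ext fun k => by simp [Finsupp.equivMapDomain_apply])
  · simp [Finsupp.equivMapDomain_apply]

theorem exponentSum_mul_card (n : ℕ) (i : ι) :
    exponentSum n i * Fintype.card ι = n * Fintype.card (Exponent ι n) := by
  have h : ∑ j : ι, exponentSum n j = ∑ _ : Exponent ι n, n := by
    simp only [exponentSum]
    rw [Finset.sum_comm]
    exact Finset.sum_congr rfl fun a _ => mem_exponent.1 a.2
  simp_rw [fun j => exponentSum_eq n j i] at h
  simpa [mul_comm] using h

variable {k : Type} [Field k] [CharZero k]

theorem det_symMatrix_diagonal (i : ι) (D : ι → k) :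
    (symMatrix n (Matrix.diagonal D)).det = (Matrix.diagonal D).det ^ exponentSum n i := by
  rw [symMatrix_diagonal, Matrix.det_diagonal, Matrix.det_diagonal, Finset.prod_comm,
    ← Finset.prod_pow]
  refine Finset.prod_congr rfl fun j _ => ?_
  rw [Finset.prod_pow_eq_pow_sum, exponentSum_eq n i j]
  rfl

theorem det_symMatrix_transvection {i j : ι} (hij : i ≠ j) (c : k) :
    (symMatrix n (Matrix.transvection i j c)).det = 1 := by
  have h1 : ∀ a b : k, (symMatrix n (Matrix.transvection i j (a + b))).det =
      (symMatrix n (Matrix.transvection i j a)).det *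
        (symMatrix n (Matrix.transvection i j b)).det := fun a b => by
    rw [← Matrix.transvection_mul_transvection_same i j hij, symMatrix_mul, Matrix.det_mul]
  have h0 : (symMatrix n (Matrix.transvection i j (0 : k))).det = 1 := by
    have := det_symMatrix_diagonal (n := n) i (fun _ : ι => (1 : k))
    rwa [Matrix.diagonal_one, Matrix.det_one, one_pow, ← Matrix.transvection_zero i j] at this
  have hne : (symMatrix n (Matrix.transvection i j c)).det ≠ 0 := fun h => by
    have := h1 c (-c)
    rw [add_neg_cancel, h0, h, zero_mul] at this
    exact one_ne_zero this
  set d : Matrix ι ι k := Matrix.diagonal (Function.update 1 i 2)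
  have hd : (symMatrix n d).det ≠ 0 := by
    rw [det_symMatrix_diagonal i]
    refine pow_ne_zero _ ?_
    rw [Matrix.det_diagonal, Finset.prod_ne_zero_iff]
    intro l _
    by_cases hl : l = i
    · subst hl
      simp
    · simp [Function.update_of_ne hl]
  have hconj : d * Matrix.transvection i j c = Matrix.transvection i j (c + c) * d := by
    have : d * Matrix.single i j c = Matrix.single i j (c + c) * d := by
      ext a b
      simp only [d, Matrix.diagonal_mul, Matrix.mul_diagonal, Matrix.single_apply]
      split_ifs with h
      · rw [← h.1, ← h.2]
        simp [Function.update_of_ne hij.symm]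
        ring
      · simp
    rw [Matrix.transvection, Matrix.transvection, mul_add, add_mul, this, mul_one, one_mul]
  have h2 := congrArg (fun M => (symMatrix n M).det) hconj
  simp only [symMatrix_mul, Matrix.det_mul, h1] at h2
  have h3 := mul_left_cancel₀ hd (h2.trans (mul_comm _ _))
  exact (mul_left_cancel₀ hne ((mul_one _).trans h3)).symm

theorem det_symMatrix (i : ι) {T : Matrix ι ι k} (hT : T.det ≠ 0) :
    (symMatrix n T).det = T.det ^ exponentSum n i := by
  refine Matrix.diagonal_transvection_induction_of_det_ne_zero
    (fun T => (symMatrix n T).det = T.det ^ exponentSum n i) T hT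
    (fun D _ => det_symMatrix_diagonal i D) (fun t => ?_) fun A B _ _ hA hB => ?_
  · rw [Matrix.TransvectionStruct.det, one_pow]
    exact det_symMatrix_transvection t.hij t.c
  · rw [symMatrix_mul, Matrix.det_mul, Matrix.det_mul, hA, hB, mul_pow]

end

section

theorem norm_det_le_prod_sum {α : Type} [Fintype α] [DecidableEq α] (M : Matrix α α ℂ) :
    ‖M.det‖ ≤ ∏ a, ∑ b, ‖M a b‖ := by
  rw [Finset.prod_univ_sum, Fintype.piFinset_univ, ← Matrix.det_transpose, Matrix.det_apply]
  refine (norm_sum_le _ _).trans ?_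
  have h : ∀ π : Equiv.Perm α, ‖Equiv.Perm.sign π • ∏ i, M.transpose (π i) i‖ =
      ∏ i, ‖M i (π i)‖ := fun π => by
    rw [← norm_prod]
    rcases Int.units_eq_one_or (Equiv.Perm.sign π) with h | h <;> simp [h]
  simp_rw [h]
  rw [← Finset.sum_image (f := fun g : α → α => ∏ i, ‖M i (g i)‖) (g := fun π : Equiv.Perm α => ⇑π)
    fun _ _ _ _ h => DFunLike.coe_injective h]
  exact Finset.sum_le_sum_of_subset_of_nonneg (Finset.subset_univ _)
    fun _ _ _ => Finset.prod_nonneg fun _ _ => norm_nonneg _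

variable {K ι : Type} [Field K] [Fintype ι]

/-- The fractional ideal generated by the monomial with exponent `d` in the ideals `J`. -/
noncomputable def idealMonomial (J : ι → FractionalIdeal (nonZeroDivisors (𝓞 K)) K) (d : ι →₀ ℕ) :
    FractionalIdeal (nonZeroDivisors (𝓞 K)) K := ∏ i, J i ^ d i

theorem idealMonomial_add (J : ι → FractionalIdeal (nonZeroDivisors (𝓞 K)) K) (d e : ι →₀ ℕ) :
    idealMonomial J (d + e) = idealMonomial J d * idealMonomial J e := by
  simp [idealMonomial, pow_add, Finset.prod_mul_distrib]

theorem sum_mem_fractionalIdeal {α : Type*} {I : FractionalIdeal (nonZeroDivisors (𝓞 K)) K}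
    {s : Finset α} {f : α → K} (h : ∀ a ∈ s, f a ∈ I) : ∑ a ∈ s, f a ∈ I :=
  Submodule.sum_mem (I : Submodule (𝓞 K) K) h

theorem units_smul_mem_fractionalIdeal {I : FractionalIdeal (nonZeroDivisors (𝓞 K)) K} {x : K}
    (u : ℤˣ) (h : x ∈ I) : u • x ∈ I := by
  rcases Int.units_eq_one_or u with rfl | rfl
  · rwa [one_smul]
  · rw [Units.neg_smul, one_smul]
    exact Submodule.neg_mem (I : Submodule (𝓞 K) K) h

theorem coeff_subst_mem_idealMonomial {E : Submodule (𝓞 K) (ι → K)}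
    {J : ι → FractionalIdeal (nonZeroDivisors (𝓞 K)) K} {Z : Matrix ι ι K}
    (hZ : ∀ v ∈ E, ∀ k, Matrix.vecMul v Z k ∈ J k) {n : ℕ} {x : MvPolynomial ι K}
    (hx : x ∈ symLattice E n) (d : ι →₀ ℕ) : coeff d (subst Z x) ∈ idealMonomial J d := by
  let P : Submodule (𝓞 K) (MvPolynomial ι K) :=
    { carrier := {x | ∀ d, coeff d (subst Z x) ∈ idealMonomial J d}
      add_mem' := fun {a b} ha hb d => by
        rw [map_add, coeff_add]
        exact Submodule.add_mem (idealMonomial J d : Submodule (𝓞 K) K) (ha d) (hb d)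
      zero_mem' := fun d => by
        rw [map_zero, coeff_zero]
        exact Submodule.zero_mem (idealMonomial J d : Submodule (𝓞 K) K)
      smul_mem' := fun c x hx d => by
        rw [← algebraMap_smul K c x, map_smul, coeff_smul, algebraMap_smul]
        exact Submodule.smul_mem (idealMonomial J d : Submodule (𝓞 K) K) c (hx d) }
  refine symLattice_le (P := fun _ => P) (fun d => ?_) (fun _ y hy v hv d => ?_) n hx d
  · rw [map_one, coeff_one]
    split_ifs with h
    · subst h
      simp only [idealMonomial, Finsupp.coe_zero, Pi.zero_apply, pow_zero, Finset.prod_const_one]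
      exact FractionalIdeal.one_mem_one _
    · exact Submodule.zero_mem (idealMonomial J d : Submodule (𝓞 K) K)
  · rw [map_mul, subst_linForm, coeff_mul]
    refine sum_mem_fractionalIdeal fun p hp => ?_
    rw [← Finset.HasAntidiagonal.mem_antidiagonal.1 hp, idealMonomial_add]
    refine FractionalIdeal.mul_mem_mul (hy p.1) ?_
    rw [linForm_apply, coeff_sum]
    refine sum_mem_fractionalIdeal fun i _ => ?_
    rw [coeff_C_mul, coeff_X]
    split_ifs with h
    · rw [← h, mul_one]
      have : idealMonomial J (Finsupp.single i 1) = J i := by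
        rw [idealMonomial, Finset.prod_eq_single i]
        · simp
        · intro j _ hj
          simp [hj.symm]
        · simp
      rw [this]
      exact hZ v hv i
    · rw [mul_zero]
      exact Submodule.zero_mem (idealMonomial J p.2 : Submodule (𝓞 K) K)

theorem prod_mem_fractionalIdeal {α : Type*} {s : Finset α} {f : α → K}
    {I : α → FractionalIdeal (nonZeroDivisors (𝓞 K)) K} (h : ∀ a ∈ s, f a ∈ I a) :
    ∏ a ∈ s, f a ∈ ∏ a ∈ s, I a := by
  induction s using Finset.induction_on with
  | empty => exact FractionalIdeal.one_mem_one _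
  | insert a s ha ih =>
    rw [Finset.prod_insert ha, Finset.prod_insert ha]
    exact FractionalIdeal.mul_mem_mul (h a (Finset.mem_insert_self a s))
      (ih fun b hb => h b (Finset.mem_insert_of_mem hb))

variable [DecidableEq ι] {n : ℕ}

theorem det_coeffMatrix_mul_mem {E : Submodule (𝓞 K) (ι → K)} [NumberField K]
    {J : ι → FractionalIdeal (nonZeroDivisors (𝓞 K)) K} {Z : Matrix ι ι K}
    (hZ : ∀ v ∈ E, ∀ k, Matrix.vecMul v Z k ∈ J k) (hZ0 : Z.det ≠ 0)
    {f : Exponent ι n → MvPolynomial ι K} (hf : ∀ a, f a ∈ symLattice E n) (i : ι) :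
    (coeffMatrix f).det * Z.det ^ exponentSum n i ∈ (∏ j, J j) ^ exponentSum n i := by
  rw [← det_symMatrix i hZ0, ← Matrix.det_mul,
    ← coeffMatrix_subst Z fun a => isHomogeneous_of_mem_symLattice (hf a), Matrix.det_apply]
  refine sum_mem_fractionalIdeal fun π _ => ?_
  have h : ∏ b : Exponent ι n, coeffMatrix (fun a => subst Z (f a)) (π b) b ∈
      (∏ j, J j) ^ exponentSum n i := by
    have h1 : ∏ b : Exponent ι n, idealMonomial J b.1 = (∏ j, J j) ^ exponentSum n i := by
      simp only [idealMonomial]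
      rw [Finset.prod_comm, ← Finset.prod_pow]
      refine Finset.prod_congr rfl fun j _ => ?_
      rw [Finset.prod_pow_eq_pow_sum, exponentSum_eq n i j]
      rfl
    rw [← h1]
    exact prod_mem_fractionalIdeal fun b _ => coeff_subst_mem_idealMonomial hZ (hf (π b)) b.1
  exact units_smul_mem_fractionalIdeal _ h

end

section

variable {K ι : Type} [Field K] [NumberField K] [Fintype ι] [DecidableEq ι]

theorem exists_reindex_of_span_eq_top {α κ : Type} [Fintype α] [DecidableEq α] {v : κ → α → K}
    (hv : Submodule.span K (Set.range v) = ⊤) :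
    ∃ g : α → κ, LinearIndependent K (v ∘ g) := by
  obtain ⟨κ', g, -, hspan, hli⟩ := exists_linearIndependent' K v
  let b := Module.Basis.mk hli (by rw [hspan, hv])
  let e := (Pi.basisFun K α).indexEquiv b
  exact ⟨g ∘ e, hli.comp e e.injective⟩

theorem exists_small_forms {E : Submodule (𝓞 K) (ι → K)}
    {hfull : Submodule.span K (E : Set (ι → K)) = ⊤} {T : (K →+* ℂ) → Matrix ι ι ℂ}
    (hgood : (sections E hfull T).Good ⊥ 0) {ε : ℝ} (hε : 0 < ε) :
    ∀ᶠ n : ℕ in Filter.atTop, ∃ f : Exponent ι n → MvPolynomial ι K,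
      (∀ a, f a ∈ symLattice E n) ∧ (coeffMatrix f).det ≠ 0 ∧
      ∀ σ a, l1 (subst (T σ) (map σ (f a))) ≤ Real.exp (ε * n) := by
  filter_upwards [hgood (ε / 2) (half_pos hε), eventually_mul_pow_le_exp 3 0 (half_pos hε)]
    with n hcov hn
  obtain ⟨u, hu, -, hspan⟩ := hcov.exists_basis (Real.exp_pos _)
  let cf : MvPolynomial ι K →ₗ[K] (Exponent ι n → K) :=
    LinearMap.pi fun b => MvPolynomial.lcoeff K b.1
  have htop : Submodule.span K (Set.range fun i => cf (u i)) = ⊤ := by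
    rw [eq_top_iff, ← (Pi.basisFun K (Exponent ι n)).span_eq, Submodule.span_le]
    rintro - ⟨b, rfl⟩
    obtain ⟨c, hc⟩ := (Submodule.mem_span_range_iff_exists_fun ℚ).1
      (hspan (monomial b.1 1) (isHomogeneous_exponent b))
    have h1 : ∑ i, c i • u i = monomial b.1 1 := by
      have : Ideal.Quotient.mkₐ ℚ (⊥ : Ideal (MvPolynomial ι K)) (∑ i, c i • u i) =
          Ideal.Quotient.mkₐ ℚ ⊥ (monomial b.1 1) := by
        rw [map_sum]
        simp_rw [map_smul]
        exact hc
      have h := Ideal.Quotient.eq.1 this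
      rwa [Ideal.mem_bot, sub_eq_zero] at h
    have h2 : Pi.basisFun K (Exponent ι n) b = ∑ i, c i • cf (u i) := by
      ext a
      have := congrArg (coeff a.1) h1
      rw [coeff_sum] at this
      simp only [coeff_smul] at this
      rw [Finset.sum_apply]
      refine Eq.trans ?_ this.symm
      rw [coeff_monomial, Pi.basisFun_apply, Pi.single_apply]
      exact if_congr (by rw [Subtype.ext_iff, eq_comm]) rfl rfl
    rw [h2]
    exact sum_mem fun i _ => Submodule.smul_of_tower_mem _ _ (Submodule.subset_span ⟨i, rfl⟩)
  obtain ⟨g, hg⟩ := exists_reindex_of_span_eq_top htop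
  refine ⟨u ∘ g, fun a => (hu (g a)).1, ?_, fun σ a => ?_⟩
  · have h : IsUnit (coeffMatrix (u ∘ g)) := by
      rw [← Matrix.linearIndependent_rows_iff_isUnit]
      exact hg
    exact ((Matrix.isUnit_iff_isUnit_det _).1 h).ne_zero
  · obtain ⟨-, y, hy, hle⟩ := hu (g a)
    have hy0 : y = 0 := by
      have : (sections E hfull T).realSpan ⊥ n ≤ ⊥ := by
        refine Submodule.span_le.2 ?_
        rintro - ⟨x, hx, rfl⟩
        have hx0 : x = 0 := hx.1
        rw [hx0, map_zero]
        exact zero_mem _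
      exact this hy
    rw [hy0, sub_zero, sections_norm] at hle
    refine ((l1_realization_le T _ (σ, false)).trans hle).trans ?_
    have h1 : Real.exp (ε * n) = Real.exp (ε / 2 * n) * Real.exp (ε / 2 * n) := by
      rw [← Real.exp_add]
      ring_nf
    rw [h1, zero_add]
    refine mul_le_mul_of_nonneg_right ?_ (Real.exp_pos _).le
    simpa using hn

theorem absNorm_le_abs_norm {I : FractionalIdeal (nonZeroDivisors (𝓞 K)) K} {x : K} (hx : x ∈ I)
    (hx0 : x ≠ 0) : (FractionalIdeal.absNorm I : ℝ) ≤ |(Algebra.norm ℚ x : ℝ)| := by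
  have h := absNorm_mul_card_quotient (I := I) rfl hx
  have h0 : |Algebra.norm ℚ x| ≠ 0 := abs_ne_zero.2 (Algebra.norm_ne_zero_iff.2 hx0)
  rw [← h] at h0
  have h1 := Nat.one_le_iff_ne_zero.2 (Nat.cast_ne_zero.1 (right_ne_zero_of_mul h0))
  have h2 : FractionalIdeal.absNorm I ≤ |Algebra.norm ℚ x| := by
    rw [← h]
    exact le_mul_of_one_le_right (FractionalIdeal.absNorm_nonneg I) (by exact_mod_cast h1)
  exact_mod_cast h2

theorem norm_det_coeffMatrix_mul_le {n : ℕ} {f : Exponent ι n → MvPolynomial ι K} {ρ : ℝ}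
    (hf : ∀ a, (f a).IsHomogeneous n) {σ : K →+* ℂ} {T : Matrix ι ι ℂ} (hT : T.det ≠ 0)
    (hρ : ∀ a, l1 (subst T (map σ (f a))) ≤ ρ) (i : ι) :
    ‖σ (coeffMatrix f).det‖ * ‖T.det‖ ^ exponentSum n i ≤ ρ ^ Fintype.card (Exponent ι n) := by
  have h1 : (coeffMatrix fun a => subst T (map σ (f a))).det =
      σ (coeffMatrix f).det * T.det ^ exponentSum n i := by
    rw [coeffMatrix_subst T fun a => (hf a).map σ, Matrix.det_mul, det_symMatrix i hT]
    congr 1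
    rw [RingHom.map_det]
    refine congrArg Matrix.det ?_
    ext a b
    exact coeff_map σ (f a) b.1
  rw [← norm_pow, ← norm_mul, ← h1]
  refine (norm_det_le_prod_sum _).trans ?_
  rw [Fintype.card, ← Finset.prod_const]
  refine Finset.prod_le_prod (fun _ _ => Finset.sum_nonneg fun _ _ => norm_nonneg _) fun a _ => ?_
  refine le_trans ?_ (hρ a)
  exact (Finset.sum_coe_sort ((Finset.univ : Finset ι).finsuppAntidiag n)
    (fun b => ‖coeff b (subst T (map σ (f a)))‖)).trans_le (sum_norm_coeff_le _ _)

theorem norm_mul_prod_norm_det_le {n : ℕ} {f : Exponent ι n → MvPolynomial ι K} {ρ : ℝ}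
    (hf : ∀ a, (f a).IsHomogeneous n) {T : (K →+* ℂ) → Matrix ι ι ℂ} (hT : ∀ σ, (T σ).det ≠ 0)
    (hρ : ∀ σ a, l1 (subst (T σ) (map σ (f a))) ≤ ρ) (i : ι) :
    |(Algebra.norm ℚ (coeffMatrix f).det : ℝ)| * (∏ σ, ‖(T σ).det‖) ^ exponentSum n i ≤
      (ρ ^ Fintype.card (Exponent ι n)) ^ Module.finrank ℚ K := by
  have h : ∏ σ : K →+* ℂ, (‖σ (coeffMatrix f).det‖ * ‖(T σ).det‖ ^ exponentSum n i) ≤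
      ∏ _σ : K →+* ℂ, ρ ^ Fintype.card (Exponent ι n) :=
    Finset.prod_le_prod (fun σ _ => mul_nonneg (norm_nonneg _) (pow_nonneg (norm_nonneg _) _))
      fun σ _ => norm_det_coeffMatrix_mul_le hf (hT σ) (hρ σ) i
  rwa [Finset.prod_mul_distrib, prod_norm_embeddings, Finset.prod_pow, Finset.prod_const,
    Finset.card_univ, NumberField.Embeddings.card] at h

theorem prod_absNorm_pow_le {E : Submodule (𝓞 K) (ι → K)} {n : ℕ}
    {J : ι → FractionalIdeal (nonZeroDivisors (𝓞 K)) K} {Z : Matrix ι ι K}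
    (hZ : ∀ v ∈ E, ∀ k, Matrix.vecMul v Z k ∈ J k) (hZ0 : Z.det ≠ 0)
    {f : Exponent ι n → MvPolynomial ι K} (hf : ∀ a, f a ∈ symLattice E n)
    (hdet : (coeffMatrix f).det ≠ 0) (i : ι) :
    ((∏ k, FractionalIdeal.absNorm (J k) : ℚ) : ℝ) ^ exponentSum n i ≤
      |(Algebra.norm ℚ (coeffMatrix f).det : ℝ)| *
        |(Algebra.norm ℚ Z.det : ℝ)| ^ exponentSum n i := by
  have h := absNorm_le_abs_norm (det_coeffMatrix_mul_mem hZ hZ0 hf i)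
    (mul_ne_zero hdet (pow_ne_zero _ hZ0))
  rw [map_mul, map_pow, map_pow, map_prod, Rat.cast_pow, Rat.cast_mul, Rat.cast_pow, abs_mul,
    abs_pow] at h
  exact h

theorem exponentSum_ne_zero {n : ℕ} (hn : n ≠ 0) (i : ι) : exponentSum n i ≠ 0 := fun h => by
  have hw := exponentSum_mul_card n i
  have : Nonempty (Exponent ι n) := ⟨⟨Finsupp.single i n, mem_exponent.2 (by
    simp [Finsupp.single_apply])⟩⟩
  rw [h, zero_mul] at hw
  exact mul_ne_zero hn Fintype.card_ne_zero hw.symm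

theorem mul_le_of_pow_mul_le {P Q A B C : ℝ} {w : ℕ} (hw : w ≠ 0) (hQ : 0 ≤ Q)
    (hB : 0 ≤ B) (hC : 0 ≤ C) (h1 : P ^ w ≤ A * B ^ w) (h2 : A * Q ^ w ≤ C ^ w) : P * Q ≤ B * C := by
  refine le_of_pow_le_pow_left₀ hw (mul_nonneg hB hC) ?_
  rw [mul_pow, mul_pow]
  calc P ^ w * Q ^ w ≤ A * B ^ w * Q ^ w := mul_le_mul_of_nonneg_right h1 (pow_nonneg hQ w)
    _ = B ^ w * (A * Q ^ w) := by ring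
    _ ≤ B ^ w * C ^ w := mul_le_mul_of_nonneg_left h2 (pow_nonneg hB w)

theorem exp_pow_eq_pow_exponentSum (ε : ℝ) (n d : ℕ) (i : ι) :
    (Real.exp (ε * n) ^ Fintype.card (Exponent ι n)) ^ d =
      Real.exp (ε * (Fintype.card ι * d)) ^ exponentSum n i := by
  have h : (exponentSum n i : ℝ) * Fintype.card ι = n * Fintype.card (Exponent ι n) := by
    exact_mod_cast exponentSum_mul_card n i
  rw [← Real.exp_nat_mul, ← Real.exp_nat_mul, ← Real.exp_nat_mul]
  congr 1
  linear_combination (-(ε * d)) * h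

theorem prod_absNorm_mul_prod_norm_det_le [Nonempty ι] {E : Submodule (𝓞 K) (ι → K)}
    {hfull : Submodule.span K (E : Set (ι → K)) = ⊤} {T : (K →+* ℂ) → Matrix ι ι ℂ}
    (hT : ∀ σ, (T σ).det ≠ 0) (hgood : (sections E hfull T).Good ⊥ 0)
    {J : ι → FractionalIdeal (nonZeroDivisors (𝓞 K)) K} {Z : Matrix ι ι K}
    (hZ : ∀ v ∈ E, ∀ k, Matrix.vecMul v Z k ∈ J k) (hZ0 : Z.det ≠ 0) :
    ((∏ k, FractionalIdeal.absNorm (J k) : ℚ) : ℝ) * ∏ σ, ‖(T σ).det‖ ≤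
      |(Algebra.norm ℚ Z.det : ℝ)| := by
  obtain ⟨i⟩ := ‹Nonempty ι›
  have key : ∀ ε : ℝ, 0 < ε → ((∏ k, FractionalIdeal.absNorm (J k) : ℚ) : ℝ) * ∏ σ, ‖(T σ).det‖ ≤
      |(Algebra.norm ℚ Z.det : ℝ)| * Real.exp (ε * (Fintype.card ι * Module.finrank ℚ K)) := by
    intro ε hε
    obtain ⟨n, ⟨f, hf, hdet, hle⟩, hn⟩ :=
      ((exists_small_forms hgood hε).and (Filter.eventually_gt_atTop 0)).exists
    refine mul_le_of_pow_mul_le (exponentSum_ne_zero hn.ne' i)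
      (Finset.prod_nonneg fun σ _ => norm_nonneg _) (abs_nonneg _) (Real.exp_pos _).le
      (prod_absNorm_pow_le hZ hZ0 hf hdet i) ?_
    rw [← exp_pow_eq_pow_exponentSum]
    exact norm_mul_prod_norm_det_le (fun a => isHomogeneous_of_mem_symLattice (hf a)) hT hle i
  have hlim : ∀ B c : ℝ, Filter.Tendsto (fun ε : ℝ => B * Real.exp (ε * c))
      (nhdsWithin 0 (Set.Ioi 0)) (nhds B) := fun B c => by
    have : Continuous fun ε : ℝ => B * Real.exp (ε * c) := by fun_prop
    have h := this.tendsto 0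
    rw [zero_mul, Real.exp_zero, mul_one] at h
    exact h.mono_left nhdsWithin_le_nhds
  exact ge_of_tendsto (hlim _ _) (Filter.eventually_of_mem self_mem_nhdsWithin key)

theorem exists_linearIndependent_spanning [Nonempty ι] {E : Submodule (𝓞 K) (ι → K)}
    (hfull : Submodule.span K (E : Set (ι → K)) = ⊤) :
    ∃ p : (s : ℕ) × (Fin s → ι → K), 0 < p.1 ∧ (∀ a, p.2 a ∈ E) ∧
      LinearIndependent K p.2 ∧ ∀ y ∈ E, y ∈ Submodule.span K (Set.range p.2) := by
  obtain ⟨g, hg⟩ := exists_reindex_of_span_eq_top (v := fun x : E => (x : ι → K))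
    (by rw [Subtype.range_coe_subtype]; exact hfull)
  let e := Fintype.equivFin ι
  have hli := hg.comp e.symm e.symm.injective
  refine ⟨⟨Fintype.card ι, _⟩, Fintype.card_pos, fun a => (g (e.symm a)).2, hli, fun y _ => ?_⟩
  have h := hli.span_eq_top_of_card_eq_finrank' (by simp)
  exact (SetLike.ext_iff.1 h y).2 Submodule.mem_top

end

end HermitianLattice

open HermitianLattice

/-- Let `K` be a number field and `Ē` a nef hermitian `𝒪_K`-lattice of rank
`r ≥ 1` (a finitely generated full `𝒪_K`-lattice `E` in `K^ι`, `r = #ι`, with positive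
definite conjugation-compatible metrics `H`).  Then `deg Ē ≥ -([K:ℚ]/2) · r · log r`. -/
theorem deg_ge_of_isNef (K : Type) [Field K] [NumberField K]
    {ι : Type} [Fintype ι] [DecidableEq ι] [Nonempty ι]
    (E : Submodule (𝓞 K) (ι → K)) (hfg : E.FG)
    (hfull : Submodule.span K ((E : Set (ι → K))) = ⊤)
    (H : (K →+* ℂ) → Matrix ι ι ℂ)
    (hpos : ∀ σ, (H σ).PosDef) (hconj : ConjCompatible K H)
    (hnef : IsNef K H E) :
    -(((Module.finrank ℚ K : ℝ) / 2) * (Fintype.card ι) * Real.log (Fintype.card ι)) ≤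
      hDeg K H E := by
  choose T hT hTdet using fun σ => exists_matrix_of_posDef (hpos σ)
  have hr : 0 < (Fintype.card ι : ℝ) := by exact_mod_cast Fintype.card_pos
  have hdet : ∀ σ, (T σ).det ≠ 0 := fun σ h => by
    have h1 := hTdet σ
    rw [h, norm_zero, zero_pow two_ne_zero, zero_mul] at h1
    exact (Complex.pos_iff.1 (hpos σ).det_pos).1.ne h1
  have hgood := good_bot_of_isNef hfg hfull hconj hnef hT hdet
  have hex := exists_linearIndependent_spanning hfull
  rw [hDeg, dif_pos hex]
  obtain ⟨-, hxE, hx, hspan⟩ := hex.choose_spec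
  set x := hex.choose.2
  obtain ⟨J, Z, hZ0, hZ, hJ, hGram⟩ := exists_pseudoBasis hfg hfull hx hxE hspan
  have hle := prod_absNorm_mul_prod_norm_det_le hdet hgood hZ hZ0
  set q := Nat.card (↥E ⧸ Submodule.comap E.subtype (Submodule.span (𝓞 K) (Set.range x)))
  set P := ∏ k, FractionalIdeal.absNorm (J k)
  have hP : 0 < (P : ℝ) := by
    have h1 : 0 ≤ P := Finset.prod_nonneg fun k _ => FractionalIdeal.absNorm_nonneg (J k)
    have h2 : P ≠ 0 := fun h => by
      rw [h, zero_mul] at hJ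
      exact zero_ne_one hJ
    exact_mod_cast lt_of_le_of_ne h1 h2.symm
  have hq : (q : ℝ) = (P : ℝ)⁻¹ := by
    refine eq_inv_of_mul_eq_one_right ?_
    exact_mod_cast hJ
  have hσZ : ∀ σ : K →+* ℂ, ‖σ Z.det‖ ≠ 0 := fun σ => by simpa using hZ0
  have hlog : ∀ σ : K →+* ℂ, Real.log (Real.sqrt
      ((Matrix.of fun a b => eForm (H σ) σ (x a) (x b)).det.re)) =
      Real.log ‖(T σ).det‖ + (Fintype.card ι : ℝ) / 2 * Real.log (Fintype.card ι) -
        Real.log ‖σ Z.det‖ := fun σ => by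
    have h1 := congrArg Complex.re (hGram σ (H σ))
    rw [Complex.re_ofReal_mul, ← hTdet σ] at h1
    have h2 : (Matrix.of fun a b => eForm (H σ) σ (x a) (x b)).det.re =
        ‖(T σ).det‖ ^ 2 * (Fintype.card ι : ℝ) ^ Fintype.card ι / ‖σ Z.det‖ ^ 2 := by
      rw [eq_div_iff (pow_ne_zero _ (hσZ σ)), mul_comm, h1]
    have h3 := norm_ne_zero_iff.2 (hdet σ)
    rw [Real.log_sqrt (by rw [h2]; positivity), h2, Real.log_div (by positivity)
      (pow_ne_zero _ (hσZ σ)), Real.log_mul (by positivity) (by positivity), Real.log_pow,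
      Real.log_pow, Real.log_pow]
    push_cast
    ring
  rw [finsum_eq_sum_of_fintype, Finset.sum_congr rfl fun σ _ => hlog σ, Finset.sum_sub_distrib,
    Finset.sum_add_distrib, Finset.sum_const, Finset.card_univ, NumberField.Embeddings.card,
    ← Real.log_prod fun σ _ => norm_ne_zero_iff.2 (hdet σ), ← Real.log_prod fun σ _ => hσZ σ,
    prod_norm_embeddings, hq, Real.log_inv, nsmul_eq_mul]
  have hQ : 0 < ∏ σ, ‖(T σ).det‖ := Finset.prod_pos fun σ _ => norm_pos_iff.2 (hdet σ)
  have h := Real.log_le_log (mul_pos hP hQ) hle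
  rw [Real.log_mul hP.ne' hQ.ne'] at h
  linarith
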